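/- For every prime ℓ with 5 ≤ ℓ < 10^11, spt has a congruence at ℓ if and only if ℓ ∈ {5, 7, 13}. -/

import Mathlib

open Finset

/-- `spt n`: the total number of smallest parts in the partitions of `n`. -/
def spt (n : ℕ) : ℕ :=
  ∑ p : Nat.Partition n, (p.parts.filter (fun j => ∀ i ∈ p.parts, j ≤ i)).card

open PowerSeries in
/-- Evaluation `F(z) ↦ F(q)` of a power series in `z` whose coefficients are power series in `q`. -/
noncomputable def diagFun {B : Type*} [CommRing B] (F : PowerSeries (PowerSeries B)) :
    PowerSeries B :=
  PowerSeries.mk fun n => ∑ p ∈ antidiagonal n, coeff p.2 (coeff p.1 F)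

section diag
open PowerSeries
variable {B : Type*} [CommRing B]

lemma eq_zero_of_forall_X_pow_dvd {f : PowerSeries B} (h : ∀ n, (X : PowerSeries B) ^ n ∣ f) :
    f = 0 := by
  ext n
  exact (X_pow_dvd_iff.1 (h (n + 1))) n (Nat.lt_succ_self n)

lemma diagFun_add (F G : PowerSeries (PowerSeries B)) :
    diagFun (F + G) = diagFun F + diagFun G := by
  ext n; simp [diagFun, sum_add_distrib]

lemma diagFun_X_mul (F : PowerSeries (PowerSeries B)) : diagFun (X * F) = X * diagFun F := by
  ext n
  cases n with
  | zero => simp [diagFun]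
  | succ n => simp [diagFun, coeff_succ_X_mul, Finset.Nat.sum_antidiagonal_succ]

lemma diagFun_C (a : PowerSeries B) : diagFun (C a) = a := by
  ext n
  rw [diagFun, coeff_mk, Finset.sum_eq_single (0, n)]
  · simp
  · rintro ⟨i, j⟩ h hne
    rw [HasAntidiagonal.mem_antidiagonal] at h
    have : i ≠ 0 := by rintro rfl; simp_all
    simp [coeff_C, this]
  · simp

lemma eq_C_add_X_mul (F : PowerSeries (PowerSeries B)) :
    F = C (coeff 0 F) + X * PowerSeries.mk fun i => coeff (i + 1) F := by
  ext1 n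
  cases n with
  | zero => simp
  | succ n => simp [coeff_succ_X_mul]

lemma diagFun_eq (F : PowerSeries (PowerSeries B)) :
    diagFun F = coeff 0 F + X * diagFun (PowerSeries.mk fun i => coeff (i + 1) F) := by
  conv_lhs => rw [eq_C_add_X_mul F, diagFun_add, diagFun_X_mul, diagFun_C]

lemma diagFun_C_mul (a : PowerSeries B) (G : PowerSeries (PowerSeries B)) :
    diagFun (C a * G) = a * diagFun G := by
  rw [← sub_eq_zero]
  apply eq_zero_of_forall_X_pow_dvd
  intro n
  induction n generalizing G with
  | zero => simp
  | succ n ih =>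
    have h1 := diagFun_eq G
    have h2 := diagFun_eq (C a * G)
    have h3 : (PowerSeries.mk fun i => coeff (i + 1) (C a * G)) =
        C a * PowerSeries.mk fun i => coeff (i + 1) G := by
      ext1 i; simp
    rw [h3] at h2
    rw [h1, h2, coeff_C_mul, show ∀ x y z : PowerSeries B, a * x + X * y - a * (x + X * z)
      = X * (y - a * z) from fun x y z => by ring, pow_succ']
    exact mul_dvd_mul_left _ (ih _)

lemma diagFun_mul (F G : PowerSeries (PowerSeries B)) :
    diagFun (F * G) = diagFun F * diagFun G := by
  rw [← sub_eq_zero]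
  apply eq_zero_of_forall_X_pow_dvd
  intro n
  induction n generalizing F with
  | zero => simp
  | succ n ih =>
    have h1 := diagFun_eq F
    set F1 := PowerSeries.mk fun i => coeff (i + 1) F
    have h2 : diagFun (F * G) = coeff 0 F * diagFun G + X * diagFun (F1 * G) := by
      conv_lhs => rw [eq_C_add_X_mul F, add_mul, mul_assoc, diagFun_add, diagFun_X_mul,
        diagFun_C_mul]
    rw [h1, h2, show ∀ x y z w : PowerSeries B, x * y + X * z - (x + X * w) * y
      = X * (z - w * y) from fun x y z w => by ring, pow_succ']
    exact mul_dvd_mul_left _ (ih _)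

/-- `diagFun` as a ring homomorphism. -/
noncomputable def diagEval : PowerSeries (PowerSeries B) →+* PowerSeries B where
  toFun := diagFun
  map_one' := by simpa using diagFun_C (1 : PowerSeries B)
  map_mul' := diagFun_mul
  map_zero' := by ext; simp [diagFun]
  map_add' := diagFun_add

lemma diagEval_X : diagEval (X : PowerSeries (PowerSeries B)) = X := by
  have h := diagFun_X_mul (B := B) (C 1)
  rw [diagFun_C] at h
  simpa [diagEval] using h

lemma diagEval_C (a : PowerSeries B) : diagEval (C a) = a := diagFun_C a

lemma diagEval_eq (F : PowerSeries (PowerSeries B)) :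
    diagEval F = coeff 0 F + X * diagEval (PowerSeries.mk fun i => coeff (i + 1) F) := diagFun_eq F

lemma diagEval_sub_sum_dvd (F : PowerSeries (PowerSeries B)) (n : ℕ) :
    X ^ n ∣ diagEval F - ∑ i ∈ range n, X ^ i * coeff i F := by
  induction n generalizing F with
  | zero => simp
  | succ n ih =>
    rw [diagEval_eq, sum_range_succ']
    have := ih (PowerSeries.mk fun i => coeff (i + 1) F)
    simp only [coeff_mk] at this
    have h : ∑ i ∈ range n, (X : PowerSeries B) ^ (i + 1) * coeff (i + 1) F =
        X * ∑ i ∈ range n, X ^ i * coeff (i + 1) F := by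
      rw [mul_sum]; exact sum_congr rfl fun i _ => by ring
    rw [h, show ∀ x y z : PowerSeries B, x + X * y - (X * z + X ^ 0 * x) = X * (y - z) from
      fun x y z => by ring, pow_succ']
    exact mul_dvd_mul_left _ this

end diag

section qseries
open PowerSeries

/-- The finite product `(q; q)_n`. -/
noncomputable def qfac (n : ℕ) : PowerSeries ℚ := ∏ i ∈ range n, (1 - X ^ (i + 1))

lemma constantCoeff_qfac (n : ℕ) : constantCoeff (qfac n) = 1 := by
  simp [qfac, map_prod]

lemma qfac_mul_inv (n : ℕ) : qfac n * (qfac n)⁻¹ = 1 :=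
  PowerSeries.mul_inv_cancel _ (by simp [constantCoeff_qfac])

lemma qfac_zero : qfac 0 = 1 := by simp [qfac]

lemma qfac_succ (n : ℕ) : qfac (n + 1) = qfac n * (1 - X ^ (n + 1)) := prod_range_succ _ _

lemma qfac_inv_eq (n : ℕ) : (qfac n)⁻¹ = (1 - X ^ (n + 1)) * (qfac (n + 1))⁻¹ := by
  have h1 := qfac_mul_inv n
  have h2 := qfac_mul_inv (n + 1)
  rw [qfac_succ] at h2 ⊢
  linear_combination (-(qfac n)⁻¹) * h2 +
    ((1 - X ^ (n + 1)) * (qfac n * (1 - X ^ (n + 1)))⁻¹) * h1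

/-- The coefficients of `(z; q)_∞`. -/
noncomputable def pochSeries : PowerSeries (PowerSeries ℚ) :=
  PowerSeries.mk fun i => (-1) ^ i * X ^ (i.choose 2) * (qfac i)⁻¹

/-- The series `1 / (z; q)_∞`. -/
noncomputable def pochInvSeries : PowerSeries (PowerSeries ℚ) :=
  PowerSeries.mk fun i => (qfac i)⁻¹

lemma pochInvSeries_func : (1 - X) * pochInvSeries = rescale X pochInvSeries := by
  ext1 n
  cases n with
  | zero => simp [pochInvSeries, sub_mul]
  | succ n =>
    simp only [pochInvSeries, sub_mul, one_mul, map_sub, coeff_mk, coeff_succ_X_mul,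
      coeff_rescale]
    rw [qfac_inv_eq n]; ring

lemma coeff_pochSeries_succ (n : ℕ) : coeff (n + 1) pochSeries =
    X ^ (n + 1) * coeff (n + 1) pochSeries - X ^ n * coeff n pochSeries := by
  simp only [pochSeries, coeff_mk]
  rw [qfac_inv_eq n, Nat.choose_succ_succ' n 1, Nat.choose_one_right, pow_add, pow_succ (-1)]
  ring

lemma pochSeries_func : pochSeries = (1 - X) * rescale X pochSeries := by
  ext1 n
  cases n with
  | zero =>
    rw [sub_mul, one_mul, map_sub, coeff_zero_X_mul, coeff_rescale]
    simp
  | succ n =>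
    simp only [sub_mul, one_mul, map_sub, coeff_succ_X_mul, coeff_rescale]
    exact coeff_pochSeries_succ n

lemma coeff_zero_pochSeries : coeff 0 pochSeries = 1 := by simp [pochSeries, qfac_zero]

lemma coeff_zero_pochInvSeries : coeff 0 pochInvSeries = 1 := by simp [pochInvSeries, qfac_zero]

lemma eq_C_of_rescale_eq {F : PowerSeries (PowerSeries ℚ)} (h : F = rescale X F) :
    F = C (coeff 0 F) := by
  ext1 n
  cases n with
  | zero => simp
  | succ n =>
    have h1 := congrArg (coeff (n + 1)) h
    rw [coeff_rescale] at h1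
    have h2 : (1 - (X : PowerSeries ℚ) ^ (n + 1)) * coeff (n + 1) F = 0 := by
      linear_combination h1
    have h3 : (1 - (X : PowerSeries ℚ) ^ (n + 1)) ≠ 0 := by
      intro h
      have := congrArg constantCoeff h
      simp at this
    rw [(mul_eq_zero.1 h2).resolve_left h3]
    simp

lemma pochInv_mul_poch : pochInvSeries * pochSeries = 1 := by
  have h : pochInvSeries * pochSeries = rescale X (pochInvSeries * pochSeries) := by
    rw [map_mul, ← pochInvSeries_func]
    conv_lhs => rw [pochSeries_func]
    ring
  rw [eq_C_of_rescale_eq h]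
  rw [coeff_mul]
  simp only [Finset.HasAntidiagonal.antidiagonal_zero, sum_singleton, coeff_zero_pochSeries,
      coeff_zero_pochInvSeries,
    mul_one, map_one]

/-- Euler's product `(q; q)_∞`. -/
noncomputable def euler : PowerSeries ℚ := diagEval pochSeries

/-- The generating function of partitions `1 / (q; q)_∞`. -/
noncomputable def partGen : PowerSeries ℚ := diagEval pochInvSeries

lemma partGen_mul_euler : partGen * euler = 1 := by
  rw [partGen, euler, ← map_mul, pochInv_mul_poch, map_one]

lemma pochSeries_iter (n : ℕ) :
    euler = qfac n * diagEval (rescale (X ^ n) pochSeries) := by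
  induction n with
  | zero => simp [qfac_zero, euler]
  | succ n ih =>
    have h := congrArg (fun F => diagEval (rescale (X ^ n) F)) pochSeries_func
    simp only [map_mul, map_sub, map_one, rescale_X, diagEval_C, diagEval_X,
      rescale_rescale] at h
    rw [ih, h, qfac_succ, pow_succ']
    ring

lemma euler_sub_qfac_dvd (n : ℕ) : X ^ (n + 1) ∣ euler - qfac n := by
  rw [pochSeries_iter n, diagEval_eq]
  have : (PowerSeries.mk fun i => coeff (i + 1) (rescale (X ^ n) pochSeries)) =
      C (X ^ n) * PowerSeries.mk fun i => X ^ (n * i) * coeff (i + 1) pochSeries := by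
    ext1 i
    simp only [coeff_mk, coeff_rescale, coeff_C_mul]
    ring
  rw [this, map_mul, diagEval_C, coeff_rescale, coeff_zero_pochSeries]
  exact ⟨qfac n * diagEval (PowerSeries.mk fun i => X ^ (n * i) * coeff (i + 1) pochSeries),
    by ring⟩

end qseries

section pairing
open PowerSeries
variable {B : Type*} [CommRing B]

/-- The `k`-th coefficient is `∑ j, q ^ j F_{j+k} G_j`. -/
noncomputable def crossSeries (F G : PowerSeries (PowerSeries B)) : PowerSeries (PowerSeries B) :=
  PowerSeries.mk fun k => diagEval (PowerSeries.mk fun j => X ^ j * coeff (j + k) F * coeff j G)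

lemma crossSeries_eq (F G : PowerSeries (PowerSeries B)) :
    crossSeries F G = C (coeff 0 G) * F +
      C (X ^ 2) * crossSeries (PowerSeries.mk fun i => coeff (i + 1) F)
        (PowerSeries.mk fun i => coeff (i + 1) G) := by
  ext1 k
  simp only [crossSeries, coeff_mk, map_add, coeff_C_mul]
  rw [diagEval_eq]
  simp only [coeff_mk]
  have : (PowerSeries.mk fun j => (X : PowerSeries B) ^ (j + 1) * coeff (j + 1 + k) F *
      coeff (j + 1) G) = C X * PowerSeries.mk fun j => X ^ j * coeff (j + k + 1) F *
        coeff (j + 1) G := by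
    ext1 j
    simp only [coeff_mk, coeff_C_mul]
    rw [show j + 1 + k = j + k + 1 by ring]; ring
  rw [this, map_mul, diagEval_C]
  simp only [pow_zero, zero_add]
  ring

lemma diagEval_mul_diagEval (F G : PowerSeries (PowerSeries B)) :
    diagEval F * diagEval G = diagEval (crossSeries F G) + diagEval (crossSeries G F) -
      coeff 0 (crossSeries F G) := by
  rw [← sub_eq_zero]
  apply eq_zero_of_forall_X_pow_dvd
  intro n
  induction n generalizing F G with
  | zero => simp
  | succ n ih =>
    set F1 := PowerSeries.mk fun i => coeff (i + 1) F with hF1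
    set G1 := PowerSeries.mk fun i => coeff (i + 1) G with hG1
    obtain ⟨a, ha⟩ := ih F1 G1
    have e1 := diagEval_eq F
    have e2 := diagEval_eq G
    rw [← hF1] at e1
    rw [← hG1] at e2
    rw [crossSeries_eq F G, crossSeries_eq G F, ← hF1, ← hG1]
    simp only [map_add, map_mul, diagEval_C, coeff_C_mul]
    refine ⟨X * a, ?_⟩
    rw [show (X : PowerSeries B) ^ (n + 1) * (X * a) = X ^ 2 * (X ^ n * a) by ring, ← ha, e1, e2]
    ring

lemma map_diagEval {A : Type*} [CommRing A] (f : A →+* B) (F : PowerSeries (PowerSeries A)) :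
    PowerSeries.map f (diagEval F) = diagEval (PowerSeries.map (PowerSeries.map f) F) := by
  ext n
  simp [diagEval, diagFun]

variable [Algebra ℚ B]

/-- The inclusion `ℚ⟦q⟧ → B⟦q⟧`. -/
noncomputable abbrev qIncl (B : Type*) [CommRing B] [Algebra ℚ B] : PowerSeries ℚ →+*
    PowerSeries B :=
  PowerSeries.map (algebraMap ℚ B)

/-- Evaluation `F(z) ↦ F(qw)`. -/
noncomputable def evalAt (w : B) : PowerSeries (PowerSeries ℚ) →+* PowerSeries B :=
  diagEval.comp ((rescale (C w)).comp (PowerSeries.map (qIncl B)))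

lemma rescale_C' {A : Type*} [CommRing A] (a b : A) : rescale a (C b) = C b := by
  ext1 n
  rw [coeff_rescale, coeff_C]
  split_ifs with h <;> simp [h]

lemma evalAt_C (w : B) (a : PowerSeries ℚ) : evalAt w (C a) = qIncl B a := by
  simp [evalAt, diagEval_C, rescale_C']

lemma evalAt_X (w : B) : evalAt w X = C w * X := by
  simp [evalAt, diagEval_C, diagEval_X, rescale_X]

lemma crossSeries_rescale (F : PowerSeries (PowerSeries ℚ)) {w w' : B} (h : w * w' = 1) :
    crossSeries (rescale (C w) (PowerSeries.map (qIncl B) F))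
      (rescale (C w') (PowerSeries.map (qIncl B) F)) =
    rescale (C w) (PowerSeries.map (qIncl B) (crossSeries F F)) := by
  ext1 k
  simp only [crossSeries, coeff_mk, coeff_rescale, coeff_map, map_diagEval]
  conv_rhs => rw [← diagEval_C ((C w : PowerSeries B) ^ k), ← map_mul]
  congr 1
  ext1 j
  simp only [coeff_C_mul, coeff_mk, coeff_map]
  simp only [map_mul, map_pow, PowerSeries.map_X]
  have : (C w : PowerSeries B) ^ j * C w' ^ j = 1 := by
    rw [← mul_pow, ← map_mul, h]; simp
  rw [pow_add]
  linear_combination (X ^ j * C w ^ k * (qIncl B) (coeff (j + k) F) * (qIncl B) (coeff j F)) * this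

lemma evalAt_mul_evalAt (F : PowerSeries (PowerSeries ℚ)) {w w' : B} (h : w * w' = 1) :
    evalAt w F * evalAt w' F = evalAt w (crossSeries F F) + evalAt w' (crossSeries F F) -
      qIncl B (coeff 0 (crossSeries F F)) := by
  simp only [evalAt, RingHom.comp_apply]
  rw [diagEval_mul_diagEval, crossSeries_rescale F h, crossSeries_rescale F (mul_comm w w' ▸ h)]
  simp
end pairing

section jtp
open PowerSeries

/-- `∑ (-1) ^ m q ^ (m(m-1)/2) z ^ m`. -/
noncomputable def thetaSeries : PowerSeries (PowerSeries ℚ) :=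
  PowerSeries.mk fun m => (-1) ^ m * X ^ (m.choose 2)

/-- `∑ j, q ^ j l_{j+m} l_j` for the coefficients `l` of `(z; q)_∞`. -/
noncomputable def pochCorr (m : ℕ) : PowerSeries ℚ :=
  diagEval (PowerSeries.mk fun j => coeff (j + m) pochSeries * coeff j pochSeries)

lemma diagEval_mk_mul (a : PowerSeries ℚ) (f : ℕ → PowerSeries ℚ) :
    diagEval (PowerSeries.mk fun j => a * f j) = a * diagEval (PowerSeries.mk f) := by
  have : (PowerSeries.mk fun j => a * f j) = C a * PowerSeries.mk f := by ext1; simp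
  rw [this, map_mul, diagEval_C]

lemma diagEval_mk_sub (f g : ℕ → PowerSeries ℚ) :
    diagEval (PowerSeries.mk fun j => f j - g j) =
      diagEval (PowerSeries.mk f) - diagEval (PowerSeries.mk g) := by
  rw [← map_sub]; rfl

lemma coeff_crossSeries (F G : PowerSeries (PowerSeries ℚ)) (k : ℕ) : coeff k (crossSeries F G) =
    diagEval (PowerSeries.mk fun j => X ^ j * coeff (j + k) F * coeff j G) := by
  simp [crossSeries]

lemma pochCorr_succ (m : ℕ) : pochCorr (m + 1) =
    X ^ (m + 1) * coeff (m + 1) (crossSeries pochSeries pochSeries) -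
      X ^ m * coeff m (crossSeries pochSeries pochSeries) := by
  rw [coeff_crossSeries, coeff_crossSeries, ← diagEval_mk_mul, ← diagEval_mk_mul,
    ← diagEval_mk_sub, pochCorr]
  congr 2
  ext1 j
  rw [← add_assoc]
  linear_combination coeff j pochSeries * coeff_pochSeries_succ (j + m)

lemma X_pow_mul_pochCorr (m : ℕ) : X ^ m * pochCorr m =
    X ^ m * coeff m (crossSeries pochSeries pochSeries) -
      X ^ (m + 1) * coeff (m + 1) (crossSeries pochSeries pochSeries) := by
  have h : diagEval (PowerSeries.mk fun j => X ^ m * (coeff (j + m) pochSeries *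
      (coeff j pochSeries - X ^ j * coeff j pochSeries))) =
      - (X ^ (m + 1) * coeff (m + 1) (crossSeries pochSeries pochSeries)) := by
    rw [coeff_crossSeries, diagEval_eq]
    simp only [coeff_mk, pow_zero, one_mul, sub_self, mul_zero, zero_add]
    rw [pow_succ', mul_assoc, ← mul_neg]
    congr 1
    rw [← diagEval_mk_mul, ← map_neg]
    congr 1
    ext1 j
    simp only [coeff_mk, map_neg]
    have := coeff_pochSeries_succ j
    rw [show j + 1 + m = j + (m + 1) by ring]
    linear_combination X ^ m * coeff (j + (m + 1)) pochSeries * this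
  rw [sub_eq_add_neg, ← h, coeff_crossSeries, pochCorr, ← diagEval_mk_mul, ← diagEval_mk_mul,
    ← map_add]
  congr 1
  ext1 j
  simp only [coeff_mk, map_add]
  ring

lemma pochCorr_eq (m : ℕ) : pochCorr m = (-1) ^ m * X ^ (m.choose 2) * pochCorr 0 := by
  induction m with
  | zero => simp
  | succ m ih =>
    have h : pochCorr (m + 1) = - (X ^ m * pochCorr m) := by
      rw [X_pow_mul_pochCorr, pochCorr_succ]; ring
    rw [h, ih, Nat.choose_succ_succ' m 1, Nat.choose_one_right]
    ring

lemma choose_two_add (m j : ℕ) : (j + 1 + m).choose 2 = m.choose 2 + m * (j + 1) + (j +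
    1).choose 2 := by
  induction m with
  | zero => simp
  | succ m ih =>
    rw [← add_assoc, Nat.choose_succ_succ' _ 1, Nat.choose_one_right, ih,
      Nat.choose_succ_succ' m 1, Nat.choose_one_right]
    ring

lemma pochCorr_zero_sub_dvd (m : ℕ) : X ^ (m + 1) ∣ pochCorr 0 - (qfac m)⁻¹ := by
  have h : pochCorr m = (-1) ^ m * X ^ (m.choose 2) * ((qfac m)⁻¹ + X ^ (m + 1) * diagEval
      (PowerSeries.mk fun j => (-1) ^ (j + 1) * X ^ (m * j + (j + 1).choose 2) *
        (qfac (j + 1 + m))⁻¹ * coeff (j + 1) pochSeries)) := by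
    rw [pochCorr, diagEval_eq, mul_add, pow_succ' X m, mul_assoc X, mul_left_comm _ X,
      ← mul_assoc ((-1) ^ m * X ^ (m.choose 2)) (X ^ m), ← diagEval_mk_mul ((-1) ^ m * _ * _)]
    simp only [coeff_mk, zero_add]
    refine congrArg₂ (· + ·) ?_ (congrArg (fun f => X * diagEval (PowerSeries.mk f))
      (funext fun j => ?_))
    · simp [pochSeries, qfac_zero]
    · simp only [pochSeries, coeff_mk]
      rw [choose_two_add]
      ring
  rw [pochCorr_eq] at h
  have h0 : (-1 : PowerSeries ℚ) ^ m * X ^ (m.choose 2) ≠ 0 := by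
    refine mul_ne_zero (pow_ne_zero _ (by simp)) (pow_ne_zero _ X_ne_zero)
  rw [mul_left_cancel₀ h0 h]
  exact ⟨_, add_sub_cancel_left _ _⟩

lemma euler_mul_pochCorr_zero : euler * pochCorr 0 = 1 := by
  rw [← sub_eq_zero]
  apply eq_zero_of_forall_X_pow_dvd
  intro n
  apply (pow_dvd_pow X (Nat.le_add_right n 1)).trans
  obtain ⟨a, ha⟩ := pochCorr_zero_sub_dvd n
  obtain ⟨b, hb⟩ := euler_sub_qfac_dvd n
  refine ⟨b * pochCorr 0 + qfac n * a, ?_⟩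
  linear_combination pochCorr 0 * hb + qfac n * ha + qfac_mul_inv n

variable {B : Type*} [CommRing B]

variable [Algebra ℚ B]

lemma jacobi_aux {w : B} : (1 - C w) * evalAt w (crossSeries pochSeries pochSeries) =
    qIncl B (coeff 0 (crossSeries pochSeries pochSeries)) -
      qIncl B (pochCorr 0) * C w * evalAt w thetaSeries := by
  set F := crossSeries pochSeries pochSeries
  have h : (C X - X) * F = C X * C (coeff 0 F) - C (pochCorr 0) * (X * thetaSeries) := by
    ext1 m
    cases m with
    | zero => simp [sub_mul]
    | succ m =>
      simp only [sub_mul, map_sub, coeff_C_mul, coeff_succ_X_mul, thetaSeries, coeff_mk,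
        coeff_C, Nat.succ_ne_zero, if_false, mul_zero, zero_sub]
      have h1 := pochCorr_succ m
      rw [pochCorr_eq, Nat.choose_succ_succ' m 1, Nat.choose_one_right] at h1
      apply mul_left_cancel₀ (pow_ne_zero m (X_ne_zero (R := ℚ)))
      linear_combination -h1
  have h2 := congrArg (evalAt w) h
  simp only [map_mul, map_sub, evalAt_C, evalAt_X, PowerSeries.map_X] at h2
  apply X_mul_cancel
  linear_combination h2

/-- The Jacobi triple product identity. -/
lemma jacobi_triple {w w' : B} (h : w * w' = 1) :
    qIncl B euler * ((1 - C w) * (evalAt w pochSeries * evalAt w' pochSeries)) =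
      evalAt w' thetaSeries - C w * evalAt w thetaSeries := by
  rw [evalAt_mul_evalAt _ h]
  have h1 := jacobi_aux (w := w)
  have h2 := jacobi_aux (w := w')
  have h3 := congrArg (qIncl B) euler_mul_pochCorr_zero
  have h4 := congrArg (C (R := B)) h
  simp only [map_mul, map_one] at h3 h4
  linear_combination qIncl B euler * h1 - qIncl B euler * C w * h2 +
    (evalAt w' thetaSeries - C w * evalAt w thetaSeries) * h3 +
    qIncl B euler * (qIncl B (pochCorr 0) *
        evalAt w' thetaSeries - evalAt w' (crossSeries pochSeries pochSeries)) * h4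
end jtp

section crank
open PowerSeries

/-- The series `1 / (z; q)_∞ ^ 3`. -/
noncomputable def cubeSeries : PowerSeries (PowerSeries ℚ) := pochInvSeries ^ 3

lemma cubeSeries_func : rescale X cubeSeries = cubeSeries - X * cubeSeries - X * cubeSeries
    - X * cubeSeries + X * (X * cubeSeries) + X * (X * cubeSeries) + X * (X * cubeSeries) -
      X * (X * (X * cubeSeries)) := by
  rw [cubeSeries, map_pow, ← pochInvSeries_func]; ring

/-- `∑ j, q ^ j F_{j+m} G_j`. -/
noncomputable def corr (F G : PowerSeries (PowerSeries ℚ)) (m : ℕ) : PowerSeries ℚ :=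
  diagEval (PowerSeries.mk fun j => coeff (j + m) F * coeff j G)

lemma corr_add_left (F F' G : PowerSeries (PowerSeries ℚ)) (m : ℕ) :
    corr (F + F') G m = corr F G m + corr F' G m := by
  rw [corr, corr, corr, ← map_add]
  congr 1; ext1 j; simp [add_mul]

lemma corr_sub_left (F F' G : PowerSeries (PowerSeries ℚ)) (m : ℕ) :
    corr (F - F') G m = corr F G m - corr F' G m := by
  rw [corr, corr, corr, ← map_sub]
  congr 1; ext1 j; simp [sub_mul]

lemma corr_add_right (F G G' : PowerSeries (PowerSeries ℚ)) (m : ℕ) :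
    corr F (G + G') m = corr F G m + corr F G' m := by
  rw [corr, corr, corr, ← map_add]
  congr 1; ext1 j; simp [mul_add]

lemma corr_sub_right (F G G' : PowerSeries (PowerSeries ℚ)) (m : ℕ) :
    corr F (G - G') m = corr F G m - corr F G' m := by
  rw [corr, corr, corr, ← map_sub]
  congr 1; ext1 j; simp [mul_sub]

lemma corr_X_mul_left_succ (F G : PowerSeries (PowerSeries ℚ)) (m : ℕ) :
    corr (X * F) G (m + 1) = corr F G m := by
  simp only [corr, ← add_assoc, coeff_succ_X_mul]

lemma corr_X_mul_right (F G : PowerSeries (PowerSeries ℚ)) (m : ℕ) :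
    corr F (X * G) m = X * corr F G (m + 1) := by
  rw [corr, diagEval_eq, corr]
  simp only [coeff_mk, coeff_zero_X_mul, mul_zero, zero_add, coeff_succ_X_mul]
  simp only [add_comm m 1, ← add_assoc]

lemma corr_X_mul_left_zero (F G : PowerSeries (PowerSeries ℚ)) :
    corr (X * F) G 0 = X * corr G F 1 := by
  rw [← corr_X_mul_right, corr, corr]
  congr 2; ext1 j; rw [add_zero, mul_comm]

lemma X_pow_mul_coeff_crossSeries (F G : PowerSeries (PowerSeries ℚ)) (m : ℕ) :
    X ^ m * coeff m (crossSeries F G) = corr (rescale X F) G m := by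
  rw [coeff_crossSeries, ← diagEval_mk_mul, corr]
  congr 2; ext1 j; rw [coeff_rescale]; ring

lemma coeff_crossSeries_eq_corr (F G : PowerSeries (PowerSeries ℚ)) (m : ℕ) :
    coeff m (crossSeries F G) = corr F (rescale X G) m := by
  rw [coeff_crossSeries, corr]
  congr 2; ext1 j; rw [coeff_rescale]; ring

/-- `∑ j, q ^ j h_{j+m} h_j` for the coefficients `h` of `1 / (z; q)_∞ ^ 3`. -/
noncomputable def cubeCorr (m : ℕ) : PowerSeries ℚ := corr cubeSeries cubeSeries m

/-- The Laurent coefficients of `1 / ((zq; q)_∞ (q/z; q)_∞) ^ 3`. -/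
noncomputable def cubeCross : PowerSeries (PowerSeries ℚ) := crossSeries cubeSeries cubeSeries

lemma coeff_cubeCross (m : ℕ) : coeff m cubeCross = cubeCorr m - 3 * X * cubeCorr (m + 1) +
    3 * X ^ 2 * cubeCorr (m + 2) - X ^ 3 * cubeCorr (m + 3) := by
  rw [cubeCross, coeff_crossSeries_eq_corr, cubeSeries_func]
  simp only [corr_sub_right, corr_add_right, corr_X_mul_right, cubeCorr]
  ring

lemma X_pow_mul_coeff_cubeCross (m : ℕ) : X ^ (m + 3) * coeff (m + 3) cubeCross =
    cubeCorr (m + 3) - 3 * cubeCorr (m + 2) + 3 * cubeCorr (m + 1) - cubeCorr m := by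
  rw [cubeCross, X_pow_mul_coeff_crossSeries, cubeSeries_func]
  simp only [corr_sub_left, corr_add_left, corr_X_mul_left_succ, cubeCorr]
  ring

lemma X_pow_two_mul_coeff_cubeCross : X ^ 2 * coeff 2 cubeCross =
    cubeCorr 2 - 3 * cubeCorr 1 + 3 * cubeCorr 0 - X * cubeCorr 1 := by
  rw [cubeCross, X_pow_mul_coeff_crossSeries, cubeSeries_func]
  simp only [corr_sub_left, corr_add_left, corr_X_mul_left_succ, corr_X_mul_left_zero, cubeCorr]
  ring

lemma X_mul_coeff_cubeCross : X ^ 1 * coeff 1 cubeCross =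
    cubeCorr 1 - 3 * cubeCorr 0 + 3 * X * cubeCorr 1 - X ^ 2 * cubeCorr 2 := by
  rw [cubeCross, X_pow_mul_coeff_crossSeries, cubeSeries_func]
  simp only [corr_sub_left, corr_add_left, corr_X_mul_left_zero,
    corr_X_mul_right, cubeCorr, corr_X_mul_left_succ (m := 0)]
  ring

/-- The sequence `X γ₁, γ₀, γ₁, γ₂, …` of correlations. -/
noncomputable def corrSeq : ℕ → PowerSeries ℚ
  | 0 => X * cubeCorr 1
  | i + 1 => cubeCorr i

noncomputable def corrSum (i : ℕ) : PowerSeries ℚ := corrSeq i + X ^ (i + 2) * corrSeq (i + 3)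

lemma corrSum_add_three (i : ℕ) : corrSum (i + 3) =
    3 * corrSum (i + 2) - 3 * corrSum (i + 1) + corrSum i := by
  cases i with
  | zero =>
    have h1 := X_pow_two_mul_coeff_cubeCross
    rw [coeff_cubeCross] at h1
    simp only [corrSum, corrSeq, zero_add] at h1 ⊢
    linear_combination -h1
  | succ m =>
    have h1 := X_pow_mul_coeff_cubeCross m
    rw [coeff_cubeCross] at h1
    simp only [corrSum, corrSeq] at h1 ⊢
    linear_combination -h1

lemma corrSum_two : corrSum 2 = 3 * corrSum 1 - 2 * corrSum 0 := by
  have h1 := X_mul_coeff_cubeCross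
  rw [coeff_cubeCross] at h1
  simp only [corrSum, corrSeq] at h1 ⊢
  linear_combination -h1

/-- The coefficient of `(2i+1)²` in `corrSum i`. -/
noncomputable def corrLead : PowerSeries ℚ := C (1 / 8) * (corrSum 1 - corrSum 0)

/-- The constant term of the quadratic polynomial `corrSum i`. -/
noncomputable def corrConst : PowerSeries ℚ := corrSum 0 - corrLead

lemma eight_mul_corrLead : 8 * corrLead = corrSum 1 - corrSum 0 := by
  have : (8 : PowerSeries ℚ) * C (1 / 8) = 1 := by
    rw [show (8 : PowerSeries ℚ) = C 8 from rfl, ← map_mul]; norm_num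
  rw [corrLead, ← mul_assoc, this, one_mul]

lemma corrSum_eq (i : ℕ) : corrSum i = corrConst + corrLead * (2 * i + 1) ^ 2 := by
  have key : ∀ i, corrSum i = corrConst + corrLead * (2 * i + 1) ^ 2 ∧
      corrSum (i + 1) = corrConst + corrLead * (2 * (i + 1) + 1) ^ 2 ∧
      corrSum (i + 2) = corrConst + corrLead * (2 * (i + 2) + 1) ^ 2 := by
    intro i
    have h8 := eight_mul_corrLead
    induction i with
    | zero =>
      rw [zero_add, zero_add, corrSum_two]
      refine ⟨?_, ?_, ?_⟩ <;> rw [corrConst] <;> push_cast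
      · ring
      · linear_combination -h8
      · linear_combination -3 * h8
    | succ i ih =>
      obtain ⟨h1, h2, h3⟩ := ih
      refine ⟨by rw [h2]; push_cast; ring,
        by rw [show i + 1 + 1 = i + 2 by ring, h3]; push_cast; ring, ?_⟩
      rw [show i + 1 + 2 = i + 3 by ring, corrSum_add_three, h1, h2, h3]
      push_cast; ring
  exact (key i).1

lemma corrSeq_eq (i : ℕ) : corrSeq i = corrConst + corrLead * (2 * (i : PowerSeries ℚ) + 1) ^ 2 -
    X ^ (i + 2) * corrSeq (i + 3) := by
  rw [← corrSum_eq, corrSum]; ring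

/-- The series `∑ i, a_i z ^ i - ∑ i, t_i z ^ i`, with `t` the quadratic part of `a`. -/
noncomputable def errSeries : PowerSeries (PowerSeries ℚ) :=
  PowerSeries.mk fun i => -(X ^ 2 * cubeCorr (i + 2))

variable {B : Type*} [CommRing B]

lemma coeff_one_X_mul (f : PowerSeries B) : coeff 1 (X * f) = coeff 0 f := coeff_succ_X_mul 0 f

lemma coeff_two_X_mul (f : PowerSeries B) : coeff 2 (X * f) = coeff 1 f := coeff_succ_X_mul 1 f

variable [Algebra ℚ B]

lemma evalAt_cubeCross (w : B) : C w ^ 3 * evalAt w cubeCross =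
    (C w - 1) ^ 3 * (qIncl B (cubeCorr 0) + C w * X * qIncl B (cubeCorr 1)
      - C w * (C w * evalAt w errSeries)) +
    C w ^ 2 * (3 * qIncl B (cubeCorr 0) - 3 * X * qIncl B (cubeCorr 1) +
      X ^ 2 * qIncl B (cubeCorr 2)) +
    C w * (X * qIncl B (cubeCorr 1) - 3 * qIncl B (cubeCorr 0)) + qIncl B (cubeCorr 0) := by
  have h1 : X ^ 3 * cubeCross = (X - C X) ^ 3 * PowerSeries.mk cubeCorr +
      X ^ 2 * C (3 * X * cubeCorr 0 - 3 * X ^ 2 * cubeCorr 1 + X ^ 3 * cubeCorr 2) +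
      X * C (X ^ 3 * cubeCorr 1 - 3 * X ^ 2 * cubeCorr 0) + C (X ^ 3 * cubeCorr 0) := by
    have h2 : (X - C X) ^ 3 * PowerSeries.mk cubeCorr = X * (X * (X * PowerSeries.mk cubeCorr)) -
        C (3 * X) * (X * (X * PowerSeries.mk cubeCorr)) +
        C (3 * X ^ 2) * (X * PowerSeries.mk cubeCorr) - C (X ^ 3) * PowerSeries.mk cubeCorr := by
      simp only [map_mul, map_pow, map_ofNat]
      ring
    rw [h2, pow_succ' X 2, pow_two X, mul_assoc X, mul_assoc X X cubeCross, mul_assoc X X (C _)]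
    ext1 k
    match k with
    | 0 =>
      simp only [map_add, map_sub, coeff_zero_X_mul, coeff_C_mul, coeff_mk, coeff_C, if_true]
      ring
    | 1 =>
      simp only [map_add, map_sub, coeff_one_X_mul, coeff_zero_X_mul, coeff_C_mul, coeff_mk,
        coeff_C, one_ne_zero, if_true, if_false]
      ring
    | 2 =>
      simp only [map_add, map_sub, coeff_two_X_mul, coeff_one_X_mul, coeff_zero_X_mul,
        coeff_C_mul, coeff_mk, coeff_C, one_ne_zero, two_ne_zero, if_true, if_false]
      ring
    | k + 3 =>
      simp only [map_add, map_sub, coeff_succ_X_mul, coeff_C_mul, coeff_mk, coeff_C,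
        Nat.succ_ne_zero, if_false, add_zero, coeff_cubeCross]
      ring
  have h3 : C (X ^ 2) * PowerSeries.mk cubeCorr = C (X ^ 2 * cubeCorr 0) +
      X * C (X ^ 2 * cubeCorr 1) - X * (X * errSeries) := by
    ext1 k
    match k with
    | 0 =>
      simp only [map_add, map_sub, coeff_zero_X_mul, coeff_C_mul, coeff_mk, coeff_C, if_true]
      ring
    | 1 =>
      simp only [map_add, map_sub, coeff_one_X_mul, coeff_zero_X_mul, coeff_C_mul, coeff_mk,
        coeff_C, one_ne_zero, if_true, if_false]
      ring
    | k + 2 =>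
      simp only [map_add, map_sub, coeff_succ_X_mul, coeff_C_mul, coeff_mk, coeff_C,
        Nat.succ_ne_zero, if_false, errSeries]
      ring
  have h2 := congrArg (evalAt w) h1
  have h4 := congrArg (evalAt w) h3
  simp only [map_mul, map_sub, map_add, map_pow, evalAt_C, evalAt_X, PowerSeries.map_X,
    map_ofNat] at h2 h4 ⊢
  have h5 : X ^ 2 * evalAt w (PowerSeries.mk cubeCorr) = X ^ 2 * ((qIncl B) (cubeCorr 0) +
      C w * X * (qIncl B) (cubeCorr 1) - C w * (C w * evalAt w errSeries)) := by
    linear_combination h4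
  rw [PowerSeries.X_pow_mul_inj] at h5
  rw [h5] at h2
  rw [← PowerSeries.X_pow_mul_inj (k := 3)]
  linear_combination h2

/-- The crank side of the rank-crank identity. -/
lemma evalAt_cubeSeries_mul {w w' : B} (h : w * w' = 1) :
    C w * (evalAt w cubeSeries * evalAt w' cubeSeries) =
      (1 - C w) ^ 3 * (evalAt w errSeries - C w' * evalAt w' errSeries) +
        C w * qIncl B (6 * corrLead - 2 * corrConst) +
        (1 + C w ^ 2) * qIncl B (corrConst + corrLead) := by
  have e1 : 6 * corrLead - 2 * corrConst = cubeCorr 0 + X ^ 3 * cubeCorr 3 - 3 * X * cubeCorr 1 -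
      3 * X ^ 2 * cubeCorr 2 := by
    have := eight_mul_corrLead
    simp only [corrConst, corrSum, corrSeq] at this ⊢
    linear_combination this
  have e2 : corrConst + corrLead = X * cubeCorr 1 + X ^ 2 * cubeCorr 2 := by
    simp only [corrConst, corrSum, corrSeq]
    ring
  have hC := congrArg (C (R := B)) h
  have h1 := evalAt_cubeCross w
  have h2 := evalAt_cubeCross w'
  have h0 := congrArg (qIncl B) (coeff_cubeCross 0)
  rw [evalAt_mul_evalAt _ h, e1, e2]
  change C w * (evalAt w cubeCross + evalAt w' cubeCross - qIncl B (coeff 0 cubeCross)) = _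
  simp only [map_mul, map_one, map_add, map_sub, map_pow, map_ofNat, PowerSeries.map_X,
    zero_add] at h0 hC ⊢
  generalize evalAt w cubeCross = Q1 at *
  generalize evalAt w' cubeCross = Q2 at *
  generalize evalAt w errSeries = s1 at *
  generalize evalAt w' errSeries = s2 at *
  generalize qIncl B (coeff 0 cubeCross) = q0 at *
  generalize qIncl B (cubeCorr 0) = g0 at *
  generalize qIncl B (cubeCorr 1) = g1 at *
  generalize qIncl B (cubeCorr 2) = g2 at *
  generalize qIncl B (cubeCorr 3) = g3 at *
  generalize C w = a at *
  generalize C w' = b at *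
  have k1 : Q1 = b ^ 3 * (a ^ 3 * Q1) := by
    linear_combination -(a ^ 2 * b ^ 2 + a * b + 1) * Q1 * hC
  have k2 : Q2 = a ^ 3 * (b ^ 3 * Q2) := by
    linear_combination -(a ^ 2 * b ^ 2 + a * b + 1) * Q2 * hC
  rw [h1] at k1
  rw [h2] at k2
  rw [k1, k2, h0]
  clear k1 k2 h1 h2 h0 e1 e2
  grind

end crank

section theta
open PowerSeries

/-- The derivation `q d/dq`. -/
noncomputable def theta (R : Type*) [CommRing R] : Derivation R (PowerSeries R) (PowerSeries R) :=
  (X : PowerSeries R) • PowerSeries.derivative R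

lemma coeff_theta {R : Type*} [CommRing R] (f : PowerSeries R) (n : ℕ) :
    coeff n (theta R f) = n * coeff n f := by
  cases n with
  | zero => simp [theta]
  | succ n => simp [theta, coeff_succ_X_mul, coeff_derivative, mul_comm]

lemma theta_X_pow {R : Type*} [CommRing R] (n : ℕ) :
    theta R ((X : PowerSeries R) ^ n) = (n : PowerSeries R) * X ^ n := by
  ext m
  rw [coeff_theta, ← map_natCast (C (R := R)), coeff_C_mul, coeff_X_pow]
  split_ifs with h <;> simp [h]

lemma theta_X_pow_mul {R : Type*} [CommRing R] (n : ℕ) (f : PowerSeries R) :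
    theta R (X ^ n * f) = X ^ n * ((n : PowerSeries R) * f + theta R f) := by
  rw [Derivation.leibniz, theta_X_pow]
  simp only [smul_eq_mul]
  ring

/-- The Eisenstein series `1 - 24 ∑ σ(n) q ^ n`. -/
noncomputable def eis2 : PowerSeries ℚ :=
  PowerSeries.mk fun n => if n = 0 then 1 else -24 * (ArithmeticFunction.sigma 1 n : ℚ)

/-- The Lambert series `q ^ d / (1 - q ^ d)`. -/
noncomputable def lambert (d : ℕ) : PowerSeries ℚ :=
  PowerSeries.mk fun n => if d ∣ n ∧ n ≠ 0 then 1 else 0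

lemma one_sub_X_pow_mul_lambert {d : ℕ} (hd : d ≠ 0) : (1 - X ^ d) * lambert d = X ^ d := by
  ext n
  rw [sub_mul, one_mul, map_sub, coeff_X_pow_mul', coeff_X_pow]
  simp only [lambert, coeff_mk]
  by_cases h : d ≤ n
  · obtain ⟨m, rfl⟩ := Nat.exists_eq_add_of_le h
    have hd' : d ∣ d + m ↔ d ∣ m := (Nat.dvd_add_right (dvd_refl d))
    simp only [le_add_iff_nonneg_right, zero_le, if_true, add_tsub_cancel_left, hd']
    by_cases hm : m = 0 <;> simp [hm, hd]
  · rw [if_neg h, if_neg, if_neg (by omega), sub_zero]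
    rintro ⟨h1, h2⟩
    exact h (Nat.le_of_dvd (Nat.pos_of_ne_zero h2) h1)

lemma theta_qfac (n : ℕ) : theta ℚ (qfac n) =
    -(qfac n * ∑ i ∈ range n, ((i + 1 : ℕ) : PowerSeries ℚ) * lambert (i + 1)) := by
  induction n with
  | zero => simp [qfac_zero]
  | succ n ih =>
    have h := one_sub_X_pow_mul_lambert (d := n + 1) (by simp)
    rw [qfac_succ, Derivation.leibniz, ih, map_sub, theta_X_pow, Finset.sum_range_succ]
    simp only [smul_eq_mul, Derivation.map_one_eq_zero]
    linear_combination ((n + 1 : ℕ) : PowerSeries ℚ) * qfac n * h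

lemma theta_dvd {R : Type*} [CommRing R] {n : ℕ} {f : PowerSeries R} (h : X ^ n ∣ f) :
    X ^ n ∣ theta R f := by
  obtain ⟨g, rfl⟩ := h
  rw [theta_X_pow_mul]
  exact dvd_mul_right _ _

lemma sum_lambert_dvd (n : ℕ) : X ^ (n + 1) ∣
    24 * ∑ i ∈ range n, ((i + 1 : ℕ) : PowerSeries ℚ) * lambert (i + 1) - (1 - eis2) := by
  rw [X_pow_dvd_iff]
  intro m hm
  rw [map_sub, map_sub, ← map_ofNat (C (R := ℚ)), coeff_C_mul, map_sum, sub_eq_zero]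
  simp only [← map_natCast (C (R := ℚ)), coeff_C_mul]
  rcases Nat.eq_zero_or_pos m with rfl | hm0
  · simp [lambert, eis2]
  · have : ∑ i ∈ range n, ((i + 1 : ℕ) : ℚ) * coeff m (lambert (i + 1)) =
        (ArithmeticFunction.sigma 1 m : ℚ) := by
      have hd : m.divisors = (Finset.Ioc 0 n).filter (· ∣ m) := by
        ext d
        simp only [Nat.mem_divisors, mem_filter, mem_Ioc]
        constructor
        · rintro ⟨h1, h2⟩
          have := Nat.le_of_dvd hm0 h1
          exact ⟨⟨Nat.pos_of_dvd_of_pos h1 hm0, by omega⟩, h1⟩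
        · rintro ⟨_, h1⟩
          exact ⟨h1, hm0.ne'⟩
      rw [ArithmeticFunction.sigma_one_apply, Nat.cast_sum, hd, Finset.sum_filter,
        Finset.range_eq_Ico, Finset.sum_Ico_add' (fun d => ((d : ℕ) : ℚ) *
            coeff m (lambert d)) 0 n 1]
      refine Finset.sum_congr (by ext; simp; omega) (fun d _ => ?_)
      simp [lambert, hm0.ne']
    rw [this]
    simp [eis2, hm0.ne', coeff_one]

lemma theta_euler : 24 * theta ℚ euler = euler * (eis2 - 1) := by
  rw [← sub_eq_zero]
  apply eq_zero_of_forall_X_pow_dvd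
  intro n
  apply (pow_dvd_pow X (Nat.le_add_right n 1)).trans
  obtain ⟨a, ha⟩ := theta_dvd (euler_sub_qfac_dvd n)
  obtain ⟨b, hb⟩ := euler_sub_qfac_dvd n
  obtain ⟨c, hc⟩ := sum_lambert_dvd n
  rw [map_sub, theta_qfac] at ha
  exact ⟨24 * a - qfac n * c - b * (eis2 - 1), by
    linear_combination 24 * ha - qfac n * hc - (eis2 - 1) * hb⟩

/-- The partial theta series `∑ r, (-1) ^ r q ^ (r(3r+2i+1)/2)`. -/
noncomputable def partialTheta (i : ℕ) : PowerSeries ℚ :=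
  diagEval (PowerSeries.mk fun r => (-1) ^ r * X ^ (3 * r.choose 2 + (i + 1) * r))

lemma partialTheta_eq (i : ℕ) : partialTheta i = 1 - X ^ (i + 2) * partialTheta (i + 3) := by
  rw [partialTheta, diagEval_eq, partialTheta]
  have : (PowerSeries.mk fun j => coeff (j + 1) (PowerSeries.mk fun r =>
      (-1 : PowerSeries ℚ) ^ r * X ^ (3 * r.choose 2 + (i + 1) * r))) = PowerSeries.mk fun r =>
      (-X ^ (i + 1)) * ((-1) ^ r * X ^ (3 * r.choose 2 + (i + 3 + 1) * r)) := by
    ext1 r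
    simp only [coeff_mk, Nat.choose_succ_succ' r 1, Nat.choose_one_right]
    ring
  rw [this, diagEval_mk_mul]
  simp
  ring

lemma eq_zero_of_recursion {f : ℕ → PowerSeries ℚ} (h : ∀ i, f i = -X ^ (i + 2) * f (i + 3))
    (i : ℕ) : f i = 0 := by
  apply eq_zero_of_forall_X_pow_dvd
  intro n
  induction n generalizing i with
  | zero => simp
  | succ n ih =>
    rw [h, pow_succ' X n]
    exact mul_dvd_mul (Dvd.dvd.neg_right (dvd_pow_self _ (by simp))) (ih _)

/-- The heat operator `24 q d/dq + (2i+1)² - E₂` applied to a series. -/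
noncomputable def heatOp (i : ℕ) (f : PowerSeries ℚ) : PowerSeries ℚ :=
  24 * theta ℚ f + ((2 * (i : PowerSeries ℚ) + 1) ^ 2 - eis2) * f

lemma corrSeq_eq_heatOp (h : corrConst = -(corrLead * eis2)) (i : ℕ) :
    corrSeq i = corrLead * heatOp i (partialTheta i) := by
  rw [← sub_eq_zero]
  refine eq_zero_of_recursion (f := fun i => corrSeq i - corrLead * heatOp i (partialTheta i))
    (fun i => ?_) i
  have h1 := corrSeq_eq i
  rw [h] at h1
  have h2 : theta ℚ (partialTheta i) = -(X ^ (i + 2) *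
      (((i + 2 : ℕ) : PowerSeries ℚ) * partialTheta (i + 3) + theta ℚ (partialTheta (i + 3)))) := by
    rw [partialTheta_eq, map_sub, theta_X_pow_mul, Derivation.map_one_eq_zero, zero_sub]
  rw [h1, heatOp, heatOp, h2]
  have h3 := partialTheta_eq i
  push_cast at h3 ⊢
  linear_combination (-corrLead * ((2 * (i : PowerSeries ℚ) + 1) ^ 2 - eis2)) * h3

lemma X_pow_mul_coeff_errSeries (h : corrConst = -(corrLead * eis2)) (i : ℕ) :
    X ^ i * coeff i errSeries = corrLead * heatOp i (partialTheta i - 1) := by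
  have h1 := corrSeq_eq_heatOp h i
  have h2 := corrSeq_eq i
  rw [h] at h2
  simp only [errSeries, coeff_mk, heatOp, map_sub, Derivation.map_one_eq_zero] at h1 h2 ⊢
  have h3 : corrSeq (i + 3) = cubeCorr (i + 2) := rfl
  rw [h3] at h2
  linear_combination h1 - h2

end theta

section uworld
open PowerSeries

/-- The exponential series `exp (c u)`. -/
noncomputable def expU (c : ℚ) : PowerSeries ℚ := rescale c (PowerSeries.exp ℚ)

lemma coeff_expU (c : ℚ) (k : ℕ) : coeff k (expU c) = c ^ k / (k.factorial : ℚ) := by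
  simp [expU, coeff_exp, div_eq_mul_inv]

lemma expU_mul (a b : ℚ) : expU a * expU b = expU (a + b) := exp_mul_exp_eq_exp_add a b

lemma expU_zero : expU 0 = 1 := by
  ext k
  rw [coeff_expU, coeff_one]
  split_ifs with h
  · simp [h]
  · simp [h]

lemma expU_pow (c : ℚ) (i : ℕ) : expU c ^ i = expU (c * i) := by
  induction i with
  | zero => simp [expU_zero]
  | succ i ih => rw [pow_succ, ih, expU_mul]; push_cast; ring_nf

lemma theta_expU (c : ℚ) : theta ℚ (expU c) = C c * X * expU c := by
  ext k
  rw [coeff_theta, coeff_expU, mul_assoc, coeff_C_mul]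
  cases k with
  | zero => simp
  | succ k =>
    rw [coeff_succ_X_mul, coeff_expU, Nat.factorial_succ]
    have : (k.factorial : ℚ) ≠ 0 := by positivity
    have h2 : ((k : ℚ) + 1) ≠ 0 := by positivity
    push_cast
    field_simp
    ring

/-- Exchange of the two variables. -/
noncomputable def swapFun (F : PowerSeries (PowerSeries ℚ)) : PowerSeries (PowerSeries ℚ) :=
  PowerSeries.mk fun i => PowerSeries.mk fun j => coeff i (coeff j F)

noncomputable def swapHom : PowerSeries (PowerSeries ℚ) →+* PowerSeries (PowerSeries ℚ) where
  toFun := swapFun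
  map_one' := by
    ext i j
    simp only [swapFun, coeff_mk, coeff_one]
    split_ifs <;> simp [coeff_one, *]
  map_mul' F G := by
    ext i j
    simp only [swapFun, coeff_mk, coeff_mul, map_sum]
    rw [sum_comm]
  map_zero' := by ext; simp [swapFun]
  map_add' F G := by ext; simp [swapFun]

lemma coeff_swapHom (F : PowerSeries (PowerSeries ℚ)) (i j : ℕ) :
    coeff j (coeff i (swapHom F)) = coeff i (coeff j F) := by
  simp [swapHom, swapFun]

lemma swapHom_C (f : PowerSeries ℚ) : swapHom (C f) = PowerSeries.map C f := by
  ext i j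
  rw [coeff_swapHom, coeff_C, coeff_map, coeff_C]
  split_ifs <;> simp

lemma swapHom_qIncl (f : PowerSeries ℚ) : swapHom (qIncl (PowerSeries ℚ) f) = C f := by
  ext i j
  rw [coeff_swapHom, coeff_map, coeff_C, PowerSeries.algebraMap_apply, coeff_C]
  split_ifs <;> simp

/-- Evaluation of `∑ F_i q ^ i exp ((c i + d) u)`. -/
lemma coeff_swapHom_evalAt (c d : ℚ) (F : PowerSeries (PowerSeries ℚ)) (k : ℕ) :
    coeff k (swapHom (C (expU d) * evalAt (expU c) F)) =
      diagEval (PowerSeries.mk fun i => C ((c * i + d) ^ k / (k.factorial : ℚ)) * coeff i F) := by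
  have h : C (expU d) * evalAt (expU c) F = diagEval (PowerSeries.mk fun i =>
      C (expU (c * i + d)) * qIncl (PowerSeries ℚ) (coeff i F)) := by
    rw [← diagEval_C (C (expU d)), evalAt, RingHom.comp_apply, ← map_mul]
    congr 1
    ext1 i
    rw [coeff_C_mul, coeff_mk, RingHom.comp_apply, coeff_rescale, coeff_map, ← map_pow, expU_pow,
      ← mul_assoc, ← map_mul, expU_mul, add_comm]
  ext n
  rw [coeff_swapHom, h]
  simp only [diagEval, RingHom.coe_mk, MonoidHom.coe_mk, OneHom.coe_mk, diagFun, coeff_mk,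
    map_sum, coeff_C_mul, coeff_map, PowerSeries.algebraMap_apply, coeff_mul_C,
        Algebra.algebraMap_self,
    RingHom.id_apply]
  simp [coeff_expU]

/-- `2 ∑ F_i q ^ i sinh ((2i+1) u)`. -/
noncomputable def oddSeries (F : PowerSeries (PowerSeries ℚ)) : PowerSeries (PowerSeries ℚ) :=
  swapHom (C (expU 1) * evalAt (expU 2) F - C (expU (-1)) * evalAt (expU (-2)) F)

/-- The coefficient of `u ^ k` in `2 sinh ((2i+1) u)`. -/
noncomputable def oddCoeff (k i : ℕ) : ℚ :=
  ((2 * i + 1) ^ k - (-(2 * i + 1)) ^ k) / (k.factorial : ℚ)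

lemma coeff_oddSeries (F : PowerSeries (PowerSeries ℚ)) (k : ℕ) : coeff k (oddSeries F) =
    diagEval (PowerSeries.mk fun i => C (oddCoeff k i) * coeff i F) := by
  rw [oddSeries, map_sub, map_sub, coeff_swapHom_evalAt, coeff_swapHom_evalAt, ← map_sub]
  congr 1
  ext1 i
  rw [map_sub, coeff_mk, coeff_mk, coeff_mk, ← sub_mul, ← map_sub]
  congr 2
  rw [oddCoeff, sub_div, show -2 * (i : ℚ) + -1 = -(2 * i + 1) by ring]

lemma oddCoeff_add_two (k i : ℕ) : ((k : ℚ) + 2) * (k + 1) * oddCoeff (k + 2) i =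
    (2 * i + 1) ^ 2 * oddCoeff k i := by
  have : (k.factorial : ℚ) ≠ 0 := by positivity
  have h1 : ((k : ℚ) + 1) ≠ 0 := by positivity
  have h2 : ((k : ℚ) + 1 + 1) ≠ 0 := by positivity
  rw [oddCoeff, oddCoeff, Nat.factorial_succ, Nat.factorial_succ]
  push_cast
  field_simp
  ring

lemma oddCoeff_of_even {k : ℕ} (h : Even k) (i : ℕ) : oddCoeff k i = 0 := by
  rw [oddCoeff, h.neg_pow, sub_self, zero_div]

lemma theta_diagEval {R : Type*} [CommRing R] (f : ℕ → PowerSeries R) :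
    theta R (diagEval (PowerSeries.mk f)) =
      diagEval (PowerSeries.mk fun i => (i : PowerSeries R) * f i + theta R (f i)) := by
  ext n
  rw [coeff_theta]
  simp only [diagEval, RingHom.coe_mk, MonoidHom.coe_mk, OneHom.coe_mk, diagFun, coeff_mk, mul_sum]
  refine sum_congr rfl fun p hp => ?_
  rw [HasAntidiagonal.mem_antidiagonal] at hp
  rw [map_add, coeff_theta, ← map_natCast (C (R := R)), coeff_C_mul, ← hp]
  push_cast
  ring

lemma theta_C {R : Type*} [CommRing R] (c : R) : theta R (C c) = 0 := by
  simp [theta]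

lemma theta_C_mul {R : Type*} [CommRing R] (c : R) (f : PowerSeries R) :
    theta R (C c * f) = C c * theta R f := by
  rw [Derivation.leibniz, theta_C]; simp

lemma heat_thetaSeries (k : ℕ) : 8 * theta ℚ (coeff k (oddSeries thetaSeries)) +
    coeff k (oddSeries thetaSeries) =
      C (((k : ℚ) + 2) * (k + 1)) * coeff (k + 2) (oddSeries thetaSeries) := by
  simp only [coeff_oddSeries]
  rw [theta_diagEval, ← diagEval_mk_mul, ← diagEval_mk_mul, ← map_add]
  congr 1
  ext1 i
  simp only [coeff_mk, map_add]
  rw [← mul_assoc (C _) (C _), ← map_mul, oddCoeff_add_two, theta_C_mul, thetaSeries, coeff_mk]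
  have h1 : theta ℚ ((-1) ^ i * X ^ i.choose 2) = (i.choose 2 : PowerSeries ℚ) * ((-1) ^ i *
      X ^ i.choose 2) := by
    rw [show (-1 : PowerSeries ℚ) ^ i = C ((-1) ^ i) by simp, theta_C_mul, theta_X_pow]
    ring
  have h2 : (2 : PowerSeries ℚ) * (i.choose 2 : PowerSeries ℚ) = i * (i - 1) := by
    have := Nat.choose_two_right i
    have h3 : i.choose 2 * 2 = i * (i - 1) := by
      rw [this, Nat.div_mul_cancel (Nat.even_mul_pred_self i).two_dvd]
    have h4 := congrArg (Nat.cast (R := PowerSeries ℚ)) h3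
    cases i with
    | zero => simp
    | succ i => push_cast at h4 ⊢; rw [mul_comm, h4]; simp
  rw [h1]
  simp only [map_mul, map_pow, map_add, map_one, map_ofNat, map_natCast]
  linear_combination 4 * C (oddCoeff k i) * ((-1) ^ i * X ^ i.choose 2) * h2

/-- The generating function of `q ^ (-i) (b_i - 1)` for the partial theta series `b_i`. -/
noncomputable def partialThetaGen : PowerSeries (PowerSeries ℚ) :=
  PowerSeries.mk fun i => -(X ^ 2 * partialTheta (i + 3))

lemma X_pow_mul_coeff_partialThetaGen (i : ℕ) :
    X ^ i * coeff i partialThetaGen = partialTheta i - 1 := by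
  rw [partialThetaGen, coeff_mk, partialTheta_eq i]; ring

lemma coeff_oddSeries_errSeries (h : corrConst = -(corrLead * eis2)) (k : ℕ) :
    coeff k (oddSeries errSeries) = corrLead * (24 * theta ℚ (coeff k (oddSeries partialThetaGen)) -
      eis2 * coeff k (oddSeries partialThetaGen) +
      C (((k : ℚ) + 2) * (k + 1)) * coeff (k + 2) (oddSeries partialThetaGen)) := by
  simp only [coeff_oddSeries]
  rw [theta_diagEval, ← diagEval_mk_mul, ← diagEval_mk_mul, ← diagEval_mk_mul, ← map_sub, ← map_add,
    ← diagEval_C corrLead, ← map_mul]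
  congr 1
  ext1 i
  simp only [coeff_mk, map_add, coeff_C_mul, map_sub]
  rw [← mul_assoc (C _) (C _), ← map_mul, oddCoeff_add_two, theta_C_mul]
  have h1 := X_pow_mul_coeff_errSeries h i
  rw [← X_pow_mul_coeff_partialThetaGen, heatOp, theta_X_pow_mul] at h1
  have h2 : coeff i errSeries = corrLead * (24 * (i * coeff i partialThetaGen +
      theta ℚ (coeff i partialThetaGen)) + ((2 * (i : PowerSeries ℚ) + 1) ^ 2 - eis2) *
        coeff i partialThetaGen) := by
    apply X_pow_mul_cancel (k := i)
    rw [h1]; ring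
  rw [h2]
  simp only [map_mul, map_pow, map_add, map_one, map_ofNat, map_natCast]
  ring

end uworld

section pde
open PowerSeries

/-- The series `sinh u / u`. -/
noncomputable def shc : PowerSeries ℚ :=
  PowerSeries.mk fun k => if Even k then 1 / ((k + 1).factorial : ℚ) else 0

lemma two_mul_X_mul_shc : 2 * (X * shc) = expU 1 - expU (-1) := by
  ext k
  rw [← map_ofNat (C (R := ℚ)), coeff_C_mul, map_sub, coeff_expU, coeff_expU]
  cases k with
  | zero => simp
  | succ k =>
    rw [coeff_succ_X_mul, shc, coeff_mk]
    split_ifs with h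
    · rw [h.add_one.neg_pow]; simp; ring
    · rw [(Nat.even_add_one.2 h).neg_pow]; simp

lemma constantCoeff_shc : constantCoeff shc = 1 := by
  rw [← coeff_zero_eq_constantCoeff_apply]; simp [shc]

lemma shc_mul_inv : shc * shc⁻¹ = 1 :=
  PowerSeries.mul_inv_cancel _ (by simp [constantCoeff_shc])

/-- Differential equation of `u / sinh u`, coefficientwise. -/
lemma shc_inv_ode (j : ℕ) : ((j : ℚ) + 1) * j * coeff (j + 2) shc⁻¹ =
    2 * coeff (j + 2) (shc⁻¹ ^ 3) + coeff j shc⁻¹ := by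
  set f := shc⁻¹ with hf
  have hfs : shc * f = 1 := shc_mul_inv
  obtain ⟨c, hc⟩ : ∃ c, 2 * c = expU 1 + expU (-1) := ⟨C (1 / 2) * (expU 1 + expU (-1)), by
    rw [← mul_assoc, ← map_ofNat (C (R := ℚ)), ← map_mul]; norm_num⟩
  have hXs := two_mul_X_mul_shc
  have hvv : expU 1 * expU (-1) = 1 := by rw [expU_mul]; norm_num [expU_zero]
  have : CharZero (PowerSeries ℚ) := algebraRat.charZero _
  have h2 : (2 : PowerSeries ℚ) ≠ 0 := two_ne_zero
  have hX : theta ℚ (X : PowerSeries ℚ) = X := by simpa using theta_X_pow (R := ℚ) 1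
  have hX2 : theta ℚ (X ^ 2 : PowerSeries ℚ) = 2 * X ^ 2 := by simpa using theta_X_pow (R := ℚ) 2
  have ht2 (g : PowerSeries ℚ) : theta ℚ (2 * g) = 2 * theta ℚ g := by
    rw [← map_ofNat (C (R := ℚ)), theta_C_mul]
  have hcc : c ^ 2 = 1 + X ^ 2 * shc ^ 2 := by
    apply mul_left_cancel₀ (mul_ne_zero h2 h2)
    linear_combination (2 * c + expU 1 + expU (-1)) * hc -
      (2 * X * shc + expU 1 - expU (-1)) * hXs + 4 * hvv
  have hDs : theta ℚ shc = c - shc := by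
    have h3 := congrArg (theta ℚ) hXs
    rw [ht2, Derivation.leibniz, map_sub, theta_expU, theta_expU, hX] at h3
    simp only [smul_eq_mul, map_one, map_neg] at h3
    apply mul_left_cancel₀ (mul_ne_zero h2 (X_ne_zero (R := ℚ)))
    linear_combination h3 - X * hc
  have hDc : theta ℚ c = X ^ 2 * shc := by
    have h3 := congrArg (theta ℚ) hc
    rw [ht2, map_add, theta_expU, theta_expU] at h3
    simp only [map_one, map_neg] at h3
    apply mul_left_cancel₀ h2
    linear_combination h3 - X * hXs
  have hDf : theta ℚ f = f - c * f ^ 2 := by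
    have h3 := congrArg (theta ℚ) hfs
    rw [Derivation.leibniz, hDs, Derivation.map_one_eq_zero] at h3
    simp only [smul_eq_mul] at h3
    linear_combination f * h3 - (theta ℚ f - f) * hfs
  have hDDf : theta ℚ (theta ℚ f) - 3 * theta ℚ f + 2 * f = 2 * f ^ 3 + X ^ 2 * f := by
    have h4 : theta ℚ (f ^ 2) = 2 * f * theta ℚ f := by
      rw [pow_two, Derivation.leibniz]; simp only [smul_eq_mul]; ring
    rw [hDf, map_sub, Derivation.leibniz, h4, hDc, hDf]
    simp only [smul_eq_mul]
    linear_combination 2 * f ^ 3 * hcc + (2 * X ^ 2 * f * (shc * f + 1) - X ^ 2 * f) * hfs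
  have h5 := congrArg (coeff (j + 2)) hDDf
  rw [show (3 : PowerSeries ℚ) = C 3 from rfl, show (2 : PowerSeries ℚ) = C 2 from rfl] at h5
  simp only [map_add, map_sub, coeff_C_mul, coeff_theta, coeff_X_pow_mul] at h5
  push_cast at h5
  linear_combination h5

/-- Constants in `q` inside the two-variable series. -/
noncomputable abbrev uIncl : PowerSeries ℚ →+* PowerSeries (PowerSeries ℚ) := PowerSeries.map C

/-- The series `∏ (1 - e^{2u} q^n)(1 - e^{-2u} q^n)`. -/
noncomputable def thetaProd : PowerSeries (PowerSeries ℚ) :=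
  swapHom (evalAt (expU 2) pochSeries * evalAt (expU (-2)) pochSeries)

/-- The series `∏ ((1 - e^{2u} q^n)(1 - e^{-2u} q^n))⁻³`. -/
noncomputable def cubeProd : PowerSeries (PowerSeries ℚ) :=
  swapHom (evalAt (expU 2) cubeSeries * evalAt (expU (-2)) cubeSeries)

lemma cubeProd_mul_thetaProd : cubeProd * thetaProd ^ 3 = 1 := by
  have h : cubeSeries * pochSeries ^ 3 = 1 := by
    rw [cubeSeries, ← mul_pow, pochInv_mul_poch, one_pow]
  rw [cubeProd, thetaProd, ← map_pow, ← map_mul]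
  rw [show ∀ a b c d : PowerSeries (PowerSeries ℚ), a * b * (c * d) ^ 3 = (a * c ^ 3) * (b * d ^ 3)
    by intros; ring, ← map_pow, ← map_pow, ← map_mul, ← map_mul, h]
  simp

lemma expU_facts : expU 2 * expU (-2) = 1 ∧ expU 1 * expU (-1) = 1 ∧ expU 1 * expU 1 = expU 2 ∧
    expU (-1) * expU (-1) = expU (-2) := by
  simp only [expU_mul]; norm_num [expU_zero]

/-- The series `∑ (-1)^m q^(m(m+1)/2) sinh((2m+1)u) / u`. -/
noncomputable def oddTheta : PowerSeries (PowerSeries ℚ) :=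
  C (C (1 / 2)) * PowerSeries.mk fun k => coeff (k + 1) (oddSeries thetaSeries)

lemma two_mul_C_half : (2 : PowerSeries (PowerSeries ℚ)) * C (C (1 / 2)) = 1 := by
  rw [show (2 : PowerSeries (PowerSeries ℚ)) = C (C 2) from rfl, ← map_mul, ← map_mul]; norm_num

lemma two_mul_X_mul_oddTheta : 2 * (X * oddTheta) = oddSeries thetaSeries := by
  have : oddSeries thetaSeries = X * PowerSeries.mk fun k => coeff (k +
      1) (oddSeries thetaSeries) := by
    ext1 k
    cases k with
    | zero =>
      rw [coeff_zero_X_mul, coeff_oddSeries]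
      simp only [oddCoeff_of_even Even.zero, map_zero, zero_mul]
      exact map_zero _
    | succ k => rw [coeff_succ_X_mul, coeff_mk]
  rw [oddTheta]
  conv_rhs => rw [this]
  linear_combination (X * PowerSeries.mk fun k => coeff (k + 1) (oddSeries thetaSeries)) *
    two_mul_C_half

lemma heat_oddTheta (k : ℕ) : 8 * theta ℚ (coeff k oddTheta) + coeff k oddTheta =
    C (((k : ℚ) + 3) * (k + 2)) * coeff (k + 2) oddTheta := by
  have h := heat_thetaSeries (k + 1)
  simp only [oddTheta, coeff_C_mul, coeff_mk, theta_C_mul]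
  push_cast at h
  rw [show (k : ℚ) + 1 + 2 = k + 3 by ring, show (k : ℚ) + 1 + 1 = k + 2 by ring,
    show k + 1 + 2 = k + 2 + 1 by ring] at h
  linear_combination C (1 / 2) * h

lemma euler_mul_thetaProd : C euler * (uIncl shc * thetaProd) = oddTheta := by
  obtain ⟨h1, h2, h3, h4⟩ := expU_facts
  have h := congrArg swapHom (jacobi_triple h1)
  have hs : uIncl (2 * (X * shc)) = uIncl (expU 1 - expU (-1)) := by rw [two_mul_X_mul_shc]
  have ho := two_mul_X_mul_oddTheta
  have k2 := congrArg uIncl h2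
  have k3 := congrArg uIncl h3
  simp only [oddSeries, map_mul, map_sub, map_one, swapHom_qIncl, swapHom_C, map_ofNat,
      PowerSeries.map_X] at h hs ho k2 k3
  rw [← k3] at h
  apply X_mul_cancel
  have : CharZero (PowerSeries (PowerSeries ℚ)) := algebraRat.charZero _
  apply mul_left_cancel₀ (two_ne_zero (α := PowerSeries (PowerSeries ℚ)))
  rw [thetaProd, map_mul, ho]
  linear_combination (-uIncl (expU (-1))) * h + C euler * (swapHom (evalAt (expU 2) pochSeries) *
     swapHom (evalAt (expU (-2)) pochSeries)) * hs + (- uIncl (expU 1) * C euler *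
         (swapHom (evalAt (expU 2) pochSeries) *
     swapHom (evalAt (expU (-2)) pochSeries)) + uIncl (expU 1) *
         swapHom (evalAt (expU 2) thetaSeries)) * k2

lemma cubeProd_eq : cubeProd = -8 * (X ^ 3 * uIncl shc ^ 3 * oddSeries errSeries) +
    8 * C corrLead + 4 * (X ^ 2 * uIncl shc ^ 2 * C (corrConst + corrLead)) := by
  obtain ⟨h1, h2, h3, h4⟩ := expU_facts
  have h := congrArg swapHom (evalAt_cubeSeries_mul h1)
  have hs : uIncl (2 * (X * shc)) = uIncl (expU 1 - expU (-1)) := by rw [two_mul_X_mul_shc]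
  have k2 := congrArg uIncl h2
  have k3 := congrArg uIncl h3
  have k4 := congrArg uIncl h4
  simp only [map_mul, map_sub, map_one, map_add, map_pow, swapHom_qIncl, swapHom_C, map_ofNat,
    PowerSeries.map_X] at h hs k2 k3 k4
  rw [cubeProd, oddSeries]
  simp only [map_mul, map_sub, map_add, swapHom_C]
  rw [← k3, ← k4] at h
  generalize swapHom (evalAt (expU 2) cubeSeries) = A1 at *
  generalize swapHom (evalAt (expU (-2)) cubeSeries) = A2 at *
  generalize swapHom (evalAt (expU 2) errSeries) = B1 at *
  generalize swapHom (evalAt (expU (-2)) errSeries) = B2 at *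
  generalize uIncl (expU 1) = v at *
  generalize uIncl (expU (-1)) = v' at *
  generalize C corrLead = c1 at *
  generalize C corrConst = c2 at *
  have e3 : 8 * (X ^ 3 * uIncl shc ^ 3) = (v - v') ^ 3 := by
    rw [← hs]; ring
  have e2 : 4 * (X ^ 2 * uIncl shc ^ 2) = (v - v') ^ 2 := by
    rw [← hs]; ring
  have : A1 * A2 = -((v - v') ^ 3 * (v * B1 - v' * B2)) + 8 * c1 + (v - v') ^ 2 * (c2 + c1) := by
    clear e3 e2 hs h1 h2 h3 h4 k3 k4
    have : A1 * A2 = v' ^ 2 * (v * v * (A1 * A2)) := by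
      linear_combination (-(v * v' + 1) * A1 * A2) * k2
    rw [this, h]
    clear this h
    grind
  rw [this, ← e3, ← e2]
  ring

end pde

section pde2
open PowerSeries

lemma coeff_zero_mul_eq {R : Type*} [CommRing R] (f g : PowerSeries R) :
    coeff 0 (f * g) = coeff 0 f * coeff 0 g := by simp

lemma coeff_zero_pow_eq {R : Type*} [CommRing R] (f : PowerSeries R) (n : ℕ) :
    coeff 0 (f ^ n) = coeff 0 f ^ n := by simp

lemma swapHom_evalAt_coeff_zero (c : ℚ) (F : PowerSeries (PowerSeries ℚ)) :
    coeff 0 (swapHom (evalAt (expU c) F)) = diagEval F := by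
  have h := coeff_swapHom_evalAt c 0 F 0
  rw [expU_zero, map_one, one_mul] at h
  rw [h]
  congr 1
  ext1 i
  simp

lemma coeff_zero_thetaProd : coeff 0 thetaProd = euler ^ 2 := by
  rw [thetaProd, map_mul, coeff_zero_mul_eq]
  rw [swapHom_evalAt_coeff_zero, swapHom_evalAt_coeff_zero, pow_two]
  rfl

lemma coeff_uIncl_zero_shc : coeff 0 (uIncl shc) = 1 := by
  simp [shc]

lemma coeff_oddTheta_zero : coeff 0 oddTheta = euler ^ 3 := by
  rw [← euler_mul_thetaProd, coeff_C_mul, coeff_zero_mul_eq, coeff_uIncl_zero_shc,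
    coeff_zero_thetaProd]
  ring

lemma coeff_oddTheta_of_odd {k : ℕ} (hk : Odd k) : coeff k oddTheta = 0 := by
  rw [oddTheta, coeff_C_mul, coeff_mk, coeff_oddSeries]
  simp only [oddCoeff_of_even hk.add_one, map_zero, zero_mul]
  rw [show (PowerSeries.mk fun _ => (0 : PowerSeries ℚ)) = 0 from rfl, map_zero, mul_zero]

lemma theta_euler_pow_three : 8 * theta ℚ (euler ^ 3) = euler ^ 3 * (eis2 - 1) := by
  rw [Derivation.leibniz_pow]
  simp only [smul_eq_mul, nsmul_eq_mul]
  push_cast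
  linear_combination euler ^ 2 * theta_euler

/-- The inverse of `(q; q)_∞`. -/
lemma euler_mul_partGen : euler * partGen = 1 := by rw [mul_comm, partGen_mul_euler]

/-- `oddTheta / (q; q)_∞ ^ 3`. -/
noncomputable def psiSeries : PowerSeries (PowerSeries ℚ) := C (partGen ^ 3) * oddTheta

lemma oddTheta_eq : oddTheta = C (euler ^ 3) * psiSeries := by
  rw [psiSeries, ← mul_assoc, ← map_mul, ← mul_pow, euler_mul_partGen]; simp

lemma coeff_psiSeries_zero : coeff 0 psiSeries = 1 := by
  rw [psiSeries, coeff_C_mul, coeff_oddTheta_zero, ← mul_pow, partGen_mul_euler, one_pow]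

lemma coeff_psiSeries_of_odd {k : ℕ} (hk : Odd k) : coeff k psiSeries = 0 := by
  rw [psiSeries, coeff_C_mul, coeff_oddTheta_of_odd hk, mul_zero]

/-- The heat equation for `psiSeries`. -/
lemma heat_psiSeries (k : ℕ) : 8 * theta ℚ (coeff k psiSeries) + eis2 * coeff k psiSeries =
    C (((k : ℚ) + 3) * (k + 2)) * coeff (k + 2) psiSeries := by
  have h := heat_oddTheta k
  have he : (euler : PowerSeries ℚ) ^ 3 ≠ 0 := by
    intro h0
    have := euler_mul_partGen
    rw [pow_eq_zero_iff (by norm_num)] at h0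
    rw [h0, zero_mul] at this
    exact zero_ne_one this
  rw [oddTheta_eq, coeff_C_mul, coeff_C_mul, Derivation.leibniz] at h
  simp only [smul_eq_mul] at h
  apply mul_left_cancel₀ he
  linear_combination h - coeff k psiSeries * theta_euler_pow_three

lemma coeff_psiSeries_two : 6 * coeff 2 psiSeries = eis2 := by
  have h := heat_psiSeries 0
  rw [coeff_psiSeries_zero, Derivation.map_one_eq_zero] at h
  norm_num at h
  rw [h]; rfl

lemma cubeProd_mul_psiSeries : C (euler ^ 6) * cubeProd * psiSeries ^ 3 = uIncl shc ^ 3 := by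
  have h1 := cubeProd_mul_thetaProd
  have h2 := euler_mul_thetaProd
  have h3 := congrArg (C (R := PowerSeries ℚ)) euler_mul_partGen
  rw [psiSeries, ← h2]
  simp only [map_mul, map_pow, map_one] at h3 ⊢
  generalize C euler = e at *
  generalize C partGen = p at *
  have : e ^ 6 * cubeProd * (p ^ 3 * (e * (uIncl shc * thetaProd))) ^ 3 =
    (e * p) ^ 9 * uIncl shc ^ 3 * (cubeProd * thetaProd ^ 3) := by ring
  rw [this, h1, h3]; ring

lemma coeff_two_of_even_aux (f g : PowerSeries (PowerSeries ℚ)) (hf : coeff 1 f = 0) :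
    coeff 2 (f * g) = coeff 0 f * coeff 2 g + coeff 2 f * coeff 0 g := by
  rw [coeff_mul, Finset.Nat.sum_antidiagonal_eq_sum_range_succ_mk]
  simp [Finset.sum_range_succ, hf]

lemma coeff_one_aux (f g : PowerSeries (PowerSeries ℚ)) (hf : coeff 1 f = 0) (hg : coeff 1 g = 0) :
    coeff 1 (f * g) = 0 := by
  rw [coeff_mul, Finset.Nat.sum_antidiagonal_eq_sum_range_succ_mk]
  simp [Finset.sum_range_succ, hf, hg]

lemma coeff_two_pow_three (f : PowerSeries (PowerSeries ℚ)) (hf : coeff 1 f = 0) :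
    coeff 2 (f ^ 3) = 3 * (coeff 0 f ^ 2 * coeff 2 f) := by
  rw [pow_succ, pow_two, mul_assoc, coeff_two_of_even_aux _ _ hf, coeff_two_of_even_aux _ _ hf,
    coeff_zero_mul_eq]
  ring

lemma coeff_cubeProd : coeff 0 cubeProd = 8 * corrLead ∧ coeff 1 cubeProd = 0 ∧
    coeff 2 cubeProd = 4 * (corrConst + corrLead) := by
  rw [cubeProd_eq]
  have e1 : -8 * (X ^ 3 * uIncl shc ^ 3 * oddSeries errSeries) =
    X * (X * (X * (-8 * (uIncl shc ^ 3 * oddSeries errSeries)))) := by ring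
  have e2 : 4 * (X ^ 2 * uIncl shc ^ 2 * C (corrConst + corrLead)) =
    X * (X * (C (4 * (corrConst + corrLead)) * uIncl shc ^ 2)) := by
    simp only [map_mul, map_ofNat]; ring
  have e3 : (8 : PowerSeries (PowerSeries ℚ)) * C corrLead = C (8 * corrLead) := by
    simp only [map_mul, map_ofNat]
  rw [e1, e2, e3]
  refine ⟨?_, ?_, ?_⟩
  · simp only [map_add, coeff_zero_X_mul, coeff_C, if_true]; ring
  · simp only [map_add, coeff_zero_X_mul, coeff_C, coeff_one_X_mul, one_ne_zero, if_false]; ring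
  · simp only [map_add, coeff_zero_X_mul, coeff_C, coeff_one_X_mul, coeff_two_X_mul, two_ne_zero,
      if_false, coeff_C_mul]
    rw [pow_two, coeff_zero_mul_eq, coeff_uIncl_zero_shc]
    ring

lemma coeff_one_shc : coeff 1 shc = 0 := by simp [shc]

lemma coeff_two_shc : coeff 2 shc = 1 / 6 := by
  rw [shc, coeff_mk, if_pos even_two]; norm_num [Nat.factorial]

lemma corrLead_eq : 8 * (euler ^ 6 * corrLead) = 1 := by
  have h := congrArg (coeff 0) cubeProd_mul_psiSeries
  rw [coeff_zero_mul_eq, coeff_C_mul, coeff_zero_pow_eq, coeff_zero_pow_eq, coeff_psiSeries_zero,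
    coeff_uIncl_zero_shc, coeff_cubeProd.1] at h
  linear_combination h

lemma corrConst_eq : corrConst = -(corrLead * eis2) := by
  have h := congrArg (coeff 2) cubeProd_mul_psiSeries
  have h1 : coeff 1 (C (euler ^ 6) * cubeProd) = 0 := by
    rw [coeff_C_mul, coeff_cubeProd.2.1, mul_zero]
  have h2 : coeff 1 (uIncl shc) = 0 := by rw [coeff_map, coeff_one_shc, map_zero]
  have h3 : coeff 2 (uIncl shc) = C (1 / 6) := by rw [coeff_map, coeff_two_shc]
  have h4 : coeff 1 psiSeries = 0 := coeff_psiSeries_of_odd odd_one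
  rw [coeff_two_of_even_aux _ _ h1, coeff_two_pow_three _ h4, coeff_two_pow_three _ h2,
    coeff_zero_pow_eq, coeff_C_mul, coeff_C_mul, coeff_cubeProd.1, coeff_cubeProd.2.2,
    coeff_psiSeries_zero, coeff_uIncl_zero_shc, h3] at h
  have h5 := corrLead_eq
  have h6 := coeff_psiSeries_two
  have h7 : (6 : PowerSeries ℚ) * C (1 / 6) = 1 := by
    rw [show (6 : PowerSeries ℚ) = C 6 from rfl, ← map_mul]; norm_num
  have he : (8 * euler ^ 6 : PowerSeries ℚ) ≠ 0 := by
    intro h0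
    rw [← mul_assoc, h0, zero_mul] at h5
    exact zero_ne_one h5
  apply mul_left_cancel₀ he
  have h8 : (8 : PowerSeries ℚ) * euler ^ 6 * corrLead = 1 := by linear_combination h5
  linear_combination 2 * h - h5 * (6 * coeff 2 psiSeries) - h6 + h7 + eis2 * h8 - h8

/-- The series `u 𝓓(u) = u / sinh u - 4 u ∑ (b_i - 1) sinh ((2i+1) u)`. -/
noncomputable def crankSeries : PowerSeries (PowerSeries ℚ) :=
  uIncl shc⁻¹ - 2 * (X * oddSeries partialThetaGen)

/-- The inverse cube of `psiSeries`. -/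
noncomputable def psiInvCube : PowerSeries (PowerSeries ℚ) :=
  C (euler ^ 6) * cubeProd * uIncl shc⁻¹ ^ 3

lemma uIncl_shc_mul_inv : uIncl shc * uIncl shc⁻¹ = 1 := by
  rw [← map_mul, shc_mul_inv, map_one]

lemma psiInvCube_mul : psiInvCube * psiSeries ^ 3 = 1 := by
  have h := cubeProd_mul_psiSeries
  have h2 := uIncl_shc_mul_inv
  have : psiInvCube * psiSeries ^ 3 = (uIncl shc * uIncl shc⁻¹) ^ 3 := by
    rw [psiInvCube, mul_pow, ← h]; ring
  rw [this, h2, one_pow]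

lemma psiInvCube_eq : 2 * psiInvCube = -16 * (X ^ 3 * (C (euler ^ 6) * oddSeries errSeries)) +
    2 * uIncl shc⁻¹ ^ 3 + X ^ 2 * (C (1 - eis2) * uIncl shc⁻¹) := by
  have h1 := uIncl_shc_mul_inv
  have h2 := congrArg (C (R := PowerSeries ℚ)) corrLead_eq
  rw [psiInvCube, cubeProd_eq, corrConst_eq]
  simp only [map_mul, map_pow, map_one, map_ofNat, map_add, map_sub, map_neg] at h2 ⊢
  generalize oddSeries errSeries = o at *
  generalize uIncl shc = s at *
  generalize uIncl shc⁻¹ = t at *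
  generalize C euler = e at *
  generalize C corrLead = c at *
  generalize C eis2 = g at *
  have h3 : s ^ 3 * t ^ 3 = 1 := by rw [← mul_pow, h1, one_pow]
  have h4 : s ^ 2 * t ^ 3 = t := by
    linear_combination t * (s * t + 1) * h1
  linear_combination (-16 * X ^ 3 * e ^ 6 * o) * h3 +
    (2 * t ^ 3 + X ^ 2 * (1 - g) * t) * h2 + 8 * X ^ 2 * e ^ 6 * (1 - g) * c * h4

lemma coeff_crankSeries_succ (j : ℕ) : coeff (j + 1) crankSeries =
    C (coeff (j + 1) shc⁻¹) - 2 * coeff j (oddSeries partialThetaGen) := by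
  rw [crankSeries, map_sub, coeff_map, ← map_ofNat (C (R := PowerSeries ℚ)), coeff_C_mul,
    coeff_succ_X_mul]

lemma coeff_shc_inv_zero : coeff 0 shc⁻¹ = 1 := by
  have := congrArg (coeff 0) shc_mul_inv
  rw [coeff_zero_mul_eq, coeff_zero_eq_constantCoeff_apply shc, constantCoeff_shc, one_mul] at this
  simpa using this

lemma coeff_crankSeries_zero : coeff 0 crankSeries = 1 := by
  rw [crankSeries, map_sub, coeff_map, coeff_shc_inv_zero, mul_left_comm]
  simp

/-- The rank-crank differential equation, coefficientwise. -/
lemma crank_pde (j : ℕ) : 2 * coeff (j + 2) psiInvCube =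
    24 * theta ℚ (coeff j crankSeries) - eis2 * coeff j crankSeries +
      C (((j : ℚ) + 1) * j) * coeff (j + 2) crankSeries := by
  have h := congrArg (coeff (j + 2)) psiInvCube_eq
  have e1 : -16 * (X ^ 3 * (C (euler ^ 6) * oddSeries errSeries)) =
    X ^ 2 * (X * (C (-16 * euler ^ 6) * oddSeries errSeries)) := by
    simp only [map_mul, map_neg, map_ofNat]; ring
  have hode := congrArg (C (R := ℚ)) (shc_inv_ode j)
  rw [e1, show (2 : PowerSeries (PowerSeries ℚ)) = C 2 from rfl, coeff_C_mul, map_add, map_add,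
    coeff_C_mul, ← map_pow, coeff_map, coeff_X_pow_mul, coeff_X_pow_mul, coeff_C_mul,
        coeff_map] at h
  rw [h]
  cases j with
  | zero =>
    rw [coeff_crankSeries_zero, coeff_zero_X_mul, Derivation.map_one_eq_zero]
    simp only [map_mul, map_ofNat, map_add, coeff_shc_inv_zero, map_one, CharP.cast_eq_zero,
      mul_zero, map_zero, zero_mul] at hode ⊢
    linear_combination -hode
  | succ j =>
    rw [coeff_succ_X_mul, coeff_C_mul, coeff_oddSeries_errSeries corrConst_eq,
      show j + 1 + 2 = j + 2 + 1 by ring, coeff_crankSeries_succ, coeff_crankSeries_succ, map_sub,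
      theta_C, show (2 : PowerSeries ℚ) * coeff j (oddSeries partialThetaGen) =
        C 2 * coeff j (oddSeries partialThetaGen) from rfl, theta_C_mul, map_ofNat]
    have h5 := corrLead_eq
    rw [show j + 1 + 2 = j + 2 + 1 by ring] at hode
    push_cast at hode ⊢
    rw [show (j : ℚ) + 1 + 1 = j + 2 by ring] at hode ⊢
    simp only [map_mul, map_ofNat, map_add, map_one, map_natCast] at hode ⊢
    generalize coeff j (oddSeries partialThetaGen) = n0 at *
    generalize coeff (j + 2) (oddSeries partialThetaGen) = n2 at *
    linear_combination (-2 * (24 * theta ℚ n0 - eis2 * n0 + (j + 2) * (j + 1) * n2)) * h5 - hode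

end pde2

section Ramanujan

open PowerSeries UpperHalfPlane ModularForm Derivative EisensteinSeries
open scoped Manifold MatrixGroups ModularForm

/-- A function on the upper half plane is the sum of a given rational `q`-series. -/
def HasQSeries (F : ℍ → ℂ) (f : PowerSeries ℚ) : Prop :=
  ∀ z : ℍ, HasSum (fun m : ℕ => ((coeff m f : ℚ) : ℂ) • Function.Periodic.qParam 1 z ^ m) (F z)

lemma HasQSeries.sub {F G : ℍ → ℂ} {f g : PowerSeries ℚ} (hF : HasQSeries F f)
    (hG : HasQSeries G g) : HasQSeries (F - G) (f - g) := fun z => by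
  simpa [sub_mul] using (hF z).sub (hG z)

lemma HasQSeries.const_mul {F : ℍ → ℂ} {f : PowerSeries ℚ} (c : ℚ) (hF : HasQSeries F f) :
    HasQSeries ((c : ℂ) • F) (C c * f) := fun z => by
  simpa [mul_assoc] using (hF z).mul_left (c : ℂ)

lemma HasQSeries.mul {F G : ℍ → ℂ} {f g : PowerSeries ℚ} (hF : HasQSeries F f)
    (hG : HasQSeries G g) : HasQSeries (F * G) (f * g) := fun z => by
  have hf := (hF z).summable.norm
  have hg := (hG z).summable.norm
  have h := (summable_norm_sum_mul_antidiagonal_of_summable_norm hf hg).of_norm.hasSum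
  rw [← tsum_mul_tsum_eq_tsum_sum_antidiagonal_of_summable_norm hf hg, (hF z).tsum_eq,
    (hG z).tsum_eq] at h
  convert! h using 2 with m
  rw [coeff_mul, Rat.cast_sum, Finset.sum_smul]
  refine Finset.sum_congr rfl fun p hp => ?_
  rw [HasAntidiagonal.mem_antidiagonal] at hp
  rw [← hp, pow_add]
  simp only [Rat.cast_mul, smul_eq_mul]
  ring

lemma hasQSeries_eis2 : HasQSeries E2 eis2 := fun z => by
  convert! hasSum_qExpansion_E2 (z := z) using 2 with m
  congr 1
  · simp only [eis2, coeff_mk]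
    split_ifs <;> simp
  · simp [Function.Periodic.qParam]

lemma HasQSeries.derivative {F : ℍ → ℂ} {f : PowerSeries ℚ} (hF : HasQSeries F f) :
    HasQSeries (normalizedDerivOfComplex F) (theta ℚ f) := fun z => by
  set y : ℝ := z.im with hy
  have hy0 : 0 < y := z.im_pos
  set r : ℝ := Real.exp (-(Real.pi * y / 2)) with hr
  have hr0 : 0 < r := Real.exp_pos _
  have hpi := Real.pi_pos
  have hsum : Summable fun m : ℕ => ‖((coeff m f : ℚ) : ℂ)‖ * r ^ m := by
    have h := (hF ⟨(y / 4 : ℝ) * Complex.I, by simp; positivity⟩).summable.norm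
    refine h.congr fun m => ?_
    rw [norm_smul, norm_pow, Function.Periodic.norm_qParam]
    congr 2
    rw [hr]
    congr 1
    simp
    ring
  set t : Set ℂ := {w | y / 2 < w.im} with ht
  have hto : IsOpen t := isOpen_lt continuous_const Complex.continuous_im
  have htc : IsPreconnected t := (convex_halfSpace_im_gt (y / 2)).isPreconnected
  have hzt : (z : ℂ) ∈ t := by
    simp only [ht, Set.mem_ofPred_eq, coe_im]
    linarith
  have hpos : ∀ w ∈ t, 0 < w.im := fun w hw => lt_trans (by positivity) hw
  have hu : Summable fun m : ℕ => (2 * Real.pi * (2 / (Real.pi * y))) *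
      (‖((coeff m f : ℚ) : ℂ)‖ * r ^ m) := hsum.mul_left _
  have hbound : ∀ (m : ℕ), ∀ w ∈ t, ‖((coeff m f : ℚ) : ℂ) *
      (m * (2 * Real.pi * Complex.I) * Function.Periodic.qParam 1 w ^ m)‖ ≤
      (2 * Real.pi * (2 / (Real.pi * y))) * (‖((coeff m f : ℚ) : ℂ)‖ * r ^ m) := by
    intro m w hw
    have h1 : ‖Function.Periodic.qParam 1 w‖ ≤ r * r := by
      rw [Function.Periodic.norm_qParam, hr, ← Real.exp_add]
      apply Real.exp_le_exp.mpr
      have : y / 2 < w.im := hw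
      have := mul_lt_mul_of_pos_left this hpi
      rw [div_one]
      linarith
    have h2 : (m : ℝ) * r ^ m ≤ 2 / (Real.pi * y) := by
      rw [le_div_iff₀ (by positivity), hr, ← Real.exp_nat_mul]
      have h3 := Real.add_one_le_exp ((m : ℝ) * (Real.pi * y / 2))
      have h4 : Real.exp ((m : ℝ) * (-(Real.pi * y / 2))) *
          Real.exp ((m : ℝ) * (Real.pi * y / 2)) = 1 := by
        rw [← Real.exp_add]
        simp
      have h5 := Real.exp_pos ((m : ℝ) * (-(Real.pi * y / 2)))
      nlinarith
    have h6 : ‖Function.Periodic.qParam 1 w‖ ^ m ≤ r ^ m * r ^ m := by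
      rw [← mul_pow]
      exact pow_le_pow_left₀ (norm_nonneg _) h1 m
    have h7 : ‖(m : ℂ) * (2 * Real.pi * Complex.I)‖ = m * (2 * Real.pi) := by
      simp [abs_of_pos hpi]
    rw [norm_mul, norm_mul, norm_pow, h7]
    have h8 : (m : ℝ) * (2 * Real.pi) * ‖Function.Periodic.qParam 1 w‖ ^ m ≤
        2 * Real.pi * (2 / (Real.pi * y)) * r ^ m := by
      calc (m : ℝ) * (2 * Real.pi) * ‖Function.Periodic.qParam 1 w‖ ^ m
          ≤ (m : ℝ) * (2 * Real.pi) * (r ^ m * r ^ m) := by gcongr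
        _ = 2 * Real.pi * (m * r ^ m) * r ^ m := by ring
        _ ≤ _ := by gcongr
    calc _ ≤ ‖((coeff m f : ℚ) : ℂ)‖ * (2 * Real.pi * (2 / (Real.pi * y)) * r ^ m) := by gcongr
      _ = _ := by ring
  have hderiv : HasDerivAt (fun w => ∑' m : ℕ, ((coeff m f : ℚ) : ℂ) *
      Function.Periodic.qParam 1 w ^ m) (∑' m : ℕ, ((coeff m f : ℚ) : ℂ) *
      (m * (2 * Real.pi * Complex.I) * Function.Periodic.qParam 1 (z : ℂ) ^ m)) z := by
    refine hasDerivAt_tsum_of_isPreconnected hu hto htc (fun m w _ => ?_) hbound hzt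
      (hF z).summable hzt
    have h1 : ∀ w : ℂ, Function.Periodic.qParam 1 w ^ m =
        Complex.exp (m * (2 * Real.pi * Complex.I) * w) := fun w => by
      rw [Function.Periodic.qParam, ← Complex.exp_nat_mul]
      congr 1
      push_cast
      ring
    simp only [h1]
    apply HasDerivAt.const_mul
    convert! ((hasDerivAt_id w).const_mul ((m : ℂ) * (2 * Real.pi * Complex.I))).cexp using 1
    simp [mul_comm]
  have heq : F ∘ ofComplex =ᶠ[nhds (z : ℂ)] fun w => ∑' m : ℕ, ((coeff m f : ℚ) : ℂ) *
      Function.Periodic.qParam 1 w ^ m := by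
    filter_upwards [hto.mem_nhds hzt] with w hw
    rw [Function.comp_apply, ofComplex_apply_of_im_pos (hpos w hw)]
    exact (hF ⟨w, hpos w hw⟩).tsum_eq.symm
  have hsm : Summable fun m : ℕ => ((coeff m f : ℚ) : ℂ) *
      (m * (2 * Real.pi * Complex.I) * Function.Periodic.qParam 1 (z : ℂ) ^ m) :=
    Summable.of_norm_bounded hu fun m => hbound m z hzt
  rw [normalizedDerivOfComplex, (hderiv.congr_of_eventuallyEq heq).deriv]
  convert! hsm.hasSum.mul_left (2 * Real.pi * Complex.I)⁻¹ using 2 with m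
  have : (2 * Real.pi * Complex.I : ℂ) ≠ 0 := Complex.two_pi_I_ne_zero
  rw [coeff_theta]
  simp only [Rat.cast_mul, Rat.cast_natCast, smul_eq_mul]
  field

lemma normalizedDerivOfComplex_D2 (γ : SL(2, ℤ)) (z : ℍ) :
    normalizedDerivOfComplex (D2 γ) z = -((γ 1 0 : ℂ) / denom γ z) ^ 2 := by
  have h1 := (hasDerivAt_denom_zpow (γ : GL (Fin 2) ℝ) (-1) z).const_mul
    (2 * Real.pi * Complex.I * (γ 1 0 : ℂ))
  have h2 : D2 γ ∘ ofComplex =ᶠ[nhds (z : ℂ)] fun w =>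
      2 * Real.pi * Complex.I * (γ 1 0 : ℂ) * denom (γ : GL (Fin 2) ℝ) w ^ (-1 : ℤ) := by
    filter_upwards [isOpen_upperHalfPlaneSet.mem_nhds z.im_pos] with w hw
    rw [Function.comp_apply, ofComplex_apply_of_im_pos hw, D2, zpow_neg_one, div_eq_mul_inv]
  rw [normalizedDerivOfComplex, (h1.congr_of_eventuallyEq h2).deriv]
  have hz := denom_ne_zero (γ : GL (Fin 2) ℝ) z
  have : (2 * Real.pi * Complex.I : ℂ) ≠ 0 := Complex.two_pi_I_ne_zero
  have h3 : (((γ : GL (Fin 2) ℝ) 1 0 : ℝ) : ℂ) = (γ 1 0 : ℂ) := by simp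
  rw [h3, show (-1 - 1 : ℤ) = -2 by norm_num, zpow_neg]
  push_cast
  rw [zpow_ofNat]
  field

lemma mdifferentiable_D2 (γ : SL(2, ℤ)) : MDifferentiable 𝓘(ℂ) 𝓘(ℂ) (D2 γ) := fun z => by
  rw [mdifferentiableAt_iff]
  have h1 := (hasDerivAt_denom_zpow (γ : GL (Fin 2) ℝ) (-1) z).const_mul
    (2 * Real.pi * Complex.I * (γ 1 0 : ℂ))
  have h2 : D2 γ ∘ ofComplex =ᶠ[nhds (z : ℂ)] fun w =>
      2 * Real.pi * Complex.I * (γ 1 0 : ℂ) * denom (γ : GL (Fin 2) ℝ) w ^ (-1 : ℤ) := by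
    filter_upwards [isOpen_upperHalfPlaneSet.mem_nhds z.im_pos] with w hw
    rw [Function.comp_apply, ofComplex_apply_of_im_pos hw, D2, zpow_neg_one, div_eq_mul_inv]
  exact (h1.congr_of_eventuallyEq h2).differentiableAt

lemma eis4_slash (γ : SL(2, ℤ)) :
    (E2 * E2 - (12 : ℂ) • normalizedDerivOfComplex E2) ∣[(4 : ℤ)] γ =
      E2 * E2 - (12 : ℂ) • normalizedDerivOfComplex E2 := by
  have h1 := normalizedDerivOfComplex_SL_slash (k := 2) E2_mdifferentiable (γ := γ)
  have h2 := E2_slash_action γ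
  rw [h2, normalizedDerivOfComplex_sub _ _ E2_mdifferentiable
    ((mdifferentiable_D2 γ).const_smul _), normalizedDerivOfComplex_smul _ _
    (mdifferentiable_D2 γ)] at h1
  have h3 := ModularForm.mul_slash_SL2 2 2 γ E2 E2
  rw [h2] at h3
  rw [sub_eq_add_neg, SlashAction.add_slash, SlashAction.neg_slash, ModularForm.SL_smul_slash]
  ext z
  have h1z := congrFun h1 z
  have h3z := congrFun h3 z
  simp only [Pi.sub_apply, Pi.smul_apply, Pi.mul_apply, Pi.add_apply, Pi.neg_apply, smul_eq_mul,
    normalizedDerivOfComplex_D2, riemannZeta_two, D2] at h1z h3z ⊢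
  have hpi : (Real.pi : ℂ) ≠ 0 := by simp
  have hI : Complex.I ≠ 0 := Complex.I_ne_zero
  have hI2 := Complex.I_sq
  norm_num at h1z h3z ⊢
  simp only [mul_div_assoc (2 * (Real.pi : ℂ) * Complex.I)] at h1z h3z
  generalize (γ 1 0 : ℂ) / denom γ z = j at *
  have hp : (Real.pi : ℂ)⁻¹ * Real.pi = 1 := inv_mul_cancel₀ hpi
  rw [h3z]
  simp only [div_eq_mul_inv] at h1z ⊢
  generalize (Real.pi : ℂ)⁻¹ = p at *
  generalize (Real.pi : ℂ) = q at *
  grind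

lemma HasQSeries.eq_zero_of_weight_eight {F : ℍ → ℂ} {f : PowerSeries ℚ} (hF : HasQSeries F f)
    (hd : MDifferentiable 𝓘(ℂ) 𝓘(ℂ) F) (hs : ∀ γ : SL(2, ℤ), F ∣[(8 : ℤ)] γ = F)
    (h0 : coeff 0 f = 0) : f = 0 := by
  have hb : IsBoundedAtImInfty F := isBoundedAtImInfty_of_hasSum_qExpansion one_pos hF
  let M : ModularForm 𝒮ℒ ((8 : ℕ) : ℤ) :=
    { toFun := F
      slash_action_eq' := fun A ⟨γ, hγ⟩ => hγ ▸ hs γ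
      holo' := hd
      bdd_at_cusps' := fun {c} hc => by
        rw [OnePoint.isBoundedAt_iff_forall_SL2Z hc]
        intro γ _
        exact (hs γ).symm ▸ hb }
  have hq : ∀ n, (qExpansion 1 F).coeff n = ((coeff n f : ℚ) : ℂ) := by
    exact fun n => (ModularFormClass.qExpansion_coeff_unique one_pos one_mem_strictPeriods_SL
      (f := M) hF n).symm
  have hM : M = 0 := by
    apply ModularForm.sturm_bound_levelOne_nat
    have : 1 ≤ (qExpansion 1 F).order := by
      apply PowerSeries.nat_le_order
      intro i hi
      obtain rfl : i = 0 := by omega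
      rw [hq, h0]
      simp
    exact lt_of_lt_of_le (by norm_num) this
  have hF0 : F = 0 := congrArg (fun M : ModularForm 𝒮ℒ ((8 : ℕ) : ℤ) => (M : ℍ → ℂ)) hM
  ext n
  have := hq n
  rw [hF0, qExpansion_zero] at this
  simpa using this.symm

/-- The Eisenstein series of weight four, through Ramanujan's formula. -/
noncomputable def eis4 : PowerSeries ℚ := eis2 ^ 2 - 12 * theta ℚ eis2

/-- The Eisenstein series of weight six, through Ramanujan's formula. -/
noncomputable def eis6 : PowerSeries ℚ := eis2 * eis4 - 3 * theta ℚ eis4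

lemma theta_eis6 : 2 * theta ℚ eis6 = eis2 * eis6 - eis4 ^ 2 := by
  set F4 : ℍ → ℂ := E2 * E2 - ((12 : ℚ) : ℂ) • normalizedDerivOfComplex E2 with hF4
  have q4 : HasQSeries F4 eis4 := by
    convert! (hasQSeries_eis2.mul hasQSeries_eis2).sub (hasQSeries_eis2.derivative.const_mul 12)
      using 1
    rw [eis4, map_ofNat]
    ring
  have d4 : MDifferentiable 𝓘(ℂ) 𝓘(ℂ) F4 := (E2_mdifferentiable.mul E2_mdifferentiable).sub
    ((normalizedDerivOfComplex_mdifferentiable E2_mdifferentiable).const_smul _)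
  have s4 : ∀ γ : SL(2, ℤ), F4 ∣[(4 : ℤ)] γ = F4 := fun γ => by
    simpa [hF4] using eis4_slash γ
  set F6 : ℍ → ℂ := serreDerivative ((4 : ℤ) : ℂ) F4 with hF6
  have q6 : HasQSeries F6 (C (-1 / 3) * eis6) := by
    convert! q4.derivative.sub ((hasQSeries_eis2.mul q4).const_mul (1 / 3)) using 1
    · ext z
      simp only [hF6, serreDerivative_apply, Pi.sub_apply, Pi.smul_apply, Pi.mul_apply,
        smul_eq_mul]
      push_cast
      ring
    · have h3 : (3 : PowerSeries ℚ) * C (1 / 3) = 1 := by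
        rw [← map_ofNat (C (R := ℚ)), ← map_mul]
        norm_num
      rw [eis6, neg_div, map_neg]
      linear_combination theta ℚ eis4 * h3
  have d6 : MDifferentiable 𝓘(ℂ) 𝓘(ℂ) F6 := serreDerivative_mdifferentiable _ d4
  have s6 : ∀ γ : SL(2, ℤ), F6 ∣[(4 + 2 : ℤ)] γ = F6 := fun γ =>
    serreDerivative_slash_invariant d4 (s4 γ)
  set F8 : ℍ → ℂ := serreDerivative ((4 + 2 : ℤ) : ℂ) F6 with hF8
  have s8 : ∀ γ : SL(2, ℤ), F8 ∣[(4 + 2 + 2 : ℤ)] γ = F8 := fun γ =>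
    serreDerivative_slash_invariant d6 (s6 γ)
  have d8 : MDifferentiable 𝓘(ℂ) 𝓘(ℂ) F8 := serreDerivative_mdifferentiable _ d6
  have q8 : HasQSeries F8 (C (-1 / 3) * theta ℚ eis6 + C (1 / 6) * (eis2 * eis6)) := by
    convert! q6.derivative.sub ((hasQSeries_eis2.mul q6).const_mul (1 / 2)) using 1
    · ext z
      simp only [hF8, serreDerivative_apply, Pi.sub_apply, Pi.smul_apply, Pi.mul_apply,
        smul_eq_mul]
      push_cast
      ring
    · have h3 : C (1 / 2 : ℚ) * C (-1 / 3) = -C (1 / 6) := by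
        rw [← map_mul, ← map_neg]
        norm_num
      rw [theta_C_mul]
      linear_combination (eis2 * eis6) * h3
  have hq := q8.sub ((q4.mul q4).const_mul (1 / 6))
  have h := hq.eq_zero_of_weight_eight (d8.sub ((d4.mul d4).const_smul _)) (fun γ => by
    have h1 := ModularForm.mul_slash_SL2 4 4 γ F4 F4
    rw [s4 γ] at h1
    rw [sub_eq_add_neg, SlashAction.add_slash, SlashAction.neg_slash, ModularForm.SL_smul_slash]
    exact congrArg₂ _ (s8 γ) (congrArg _ (congrArg _ h1))) (by
    have c2 : constantCoeff eis2 = 1 := by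
      rw [← coeff_zero_eq_constantCoeff_apply, eis2, coeff_mk, if_pos rfl]
    have ct : ∀ f : PowerSeries ℚ, constantCoeff (theta ℚ f) = 0 := fun f => by
      rw [← coeff_zero_eq_constantCoeff_apply, coeff_theta, Nat.cast_zero, zero_mul]
    have c4 : constantCoeff eis4 = 1 := by simp [eis4, c2, ct]
    have c6 : constantCoeff eis6 = 1 := by simp [eis6, c2, c4, ct]
    rw [coeff_zero_eq_constantCoeff_apply]
    simp [c2, c4, c6, ct])
  have h6 : (6 : PowerSeries ℚ) * C (1 / 6) = 1 := by
    rw [← map_ofNat (C (R := ℚ)), ← map_mul]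
    norm_num
  have h3 : C (-1 / 3 : ℚ) = -2 * C (1 / 6) := by
    rw [← map_ofNat (C (R := ℚ)), ← map_neg, ← map_mul]
    norm_num
  rw [h3] at h
  linear_combination (-6) * h - (2 * theta ℚ eis6 - eis2 * eis6 + eis4 ^ 2) * h6

end Ramanujan

section ModularRing

open PowerSeries

lemma theta_map {R S : Type*} [CommRing R] [CommRing S] (φ : R →+* S) (f : PowerSeries R) :
    theta S (PowerSeries.map φ f) = PowerSeries.map φ (theta R f) := by
  ext n
  simp [coeff_theta]

/-- The Eisenstein series of weight two, with integral coefficients. -/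
noncomputable def eis2Int : PowerSeries ℤ :=
  PowerSeries.mk fun n => if n = 0 then 1 else -24 * (ArithmeticFunction.sigma 1 n : ℤ)

/-- The Eisenstein series of weight two over a ring. -/
noncomputable def e2 (R : Type*) [CommRing R] : PowerSeries R :=
  PowerSeries.map (Int.castRingHom R) eis2Int

/-- The Eisenstein series of weight four over a ring. -/
noncomputable def e4 (R : Type*) [CommRing R] : PowerSeries R :=
  e2 R ^ 2 - 12 * theta R (e2 R)

/-- The Eisenstein series of weight six over a ring. -/
noncomputable def e6 (R : Type*) [CommRing R] : PowerSeries R :=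
  e2 R * e4 R - 3 * theta R (e4 R)

lemma map_e2 {R S : Type*} [CommRing R] [CommRing S] (φ : R →+* S) :
    PowerSeries.map φ (e2 R) = e2 S := by
  ext n
  simp [e2]

lemma map_e4 {R S : Type*} [CommRing R] [CommRing S] (φ : R →+* S) :
    PowerSeries.map φ (e4 R) = e4 S := by
  simp only [e4, map_sub, map_mul, map_pow, map_ofNat, map_e2, ← theta_map]

lemma map_e6 {R S : Type*} [CommRing R] [CommRing S] (φ : R →+* S) :
    PowerSeries.map φ (e6 R) = e6 S := by
  simp only [e6, map_sub, map_mul, map_ofNat, map_e2, map_e4, ← theta_map]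

lemma e2_rat : e2 ℚ = eis2 := by
  ext n
  simp only [e2, eis2Int, eis2, coeff_map, coeff_mk]
  split_ifs <;> simp

lemma e4_rat : e4 ℚ = eis4 := by rw [e4, eis4, e2_rat]

lemma e6_rat : e6 ℚ = eis6 := by rw [e6, eis6, e2_rat, e4_rat]

variable (R : Type*) [CommRing R]

lemma theta_e2 : 12 * theta R (e2 R) = e2 R ^ 2 - e4 R := by
  rw [e4]
  ring

lemma theta_e4 : 3 * theta R (e4 R) = e2 R * e4 R - e6 R := by
  rw [e6]
  ring

lemma theta_e6 : 2 * theta R (e6 R) = e2 R * e6 R - e4 R ^ 2 := by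
  have h : 2 * theta ℤ (e6 ℤ) = e2 ℤ * e6 ℤ - e4 ℤ ^ 2 := by
    apply PowerSeries.map_injective (Int.castRingHom ℚ) Int.cast_injective
    simp only [map_mul, map_sub, map_pow, ← theta_map, map_e2, map_e4, map_e6, map_ofNat]
    rw [e2_rat, e4_rat, e6_rat]
    exact theta_eis6
  have := congrArg (PowerSeries.map (Int.castRingHom R)) h
  simpa only [map_mul, map_sub, map_pow, ← theta_map, map_e2, map_e4, map_e6, map_ofNat] using this

lemma constantCoeff_theta (f : PowerSeries R) : constantCoeff (theta R f) = 0 := by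
  rw [← coeff_zero_eq_constantCoeff_apply, coeff_theta, Nat.cast_zero, zero_mul]

@[simp] lemma constantCoeff_e2 : constantCoeff (e2 R) = 1 := by
  rw [← coeff_zero_eq_constantCoeff_apply]
  simp only [e2, eis2Int, coeff_map, coeff_mk]
  simp

@[simp] lemma constantCoeff_e4 : constantCoeff (e4 R) = 1 := by
  simp [e4, constantCoeff_theta]

@[simp] lemma constantCoeff_e6 : constantCoeff (e6 R) = 1 := by
  simp [e6, constantCoeff_theta]

/-- The discriminant `e4 ^ 3 - e6 ^ 2`. -/
noncomputable def discr : PowerSeries R := e4 R ^ 3 - e6 R ^ 2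

@[simp] lemma constantCoeff_discr : constantCoeff (discr R) = 0 := by
  simp [discr]

lemma coeff_one_discr : coeff 1 (discr R) = 1728 := by
  have hm : ∀ f g : PowerSeries R, coeff 1 (f * g) =
      coeff 1 f * constantCoeff g + constantCoeff f * coeff 1 g := fun f g => by
    rw [coeff_mul, Finset.Nat.antidiagonal_succ]
    simp
    ring
  have h2 : coeff 1 (e2 R) = -24 := by
    simp [e2, eis2Int, coeff_map, coeff_mk]
  have h12 : coeff 1 (12 * theta R (e2 R)) = -288 := by
    rw [← map_ofNat (C (R := R)), coeff_C_mul, coeff_theta, h2]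
    norm_num
  have h4 : coeff 1 (e4 R) = 240 := by
    rw [e4, map_sub, h12, pow_two, hm, h2]
    simp
    norm_num
  have h3 : coeff 1 (3 * theta R (e4 R)) = 720 := by
    rw [← map_ofNat (C (R := R)), coeff_C_mul, coeff_theta, h4]
    norm_num
  have h6 : coeff 1 (e6 R) = -504 := by
    rw [e6, map_sub, h3, hm, h2, h4]
    simp
    norm_num
  rw [discr, map_sub, pow_succ, pow_two, pow_two, hm, hm, hm, h4, h6]
  simp
  norm_num

/-- Polynomials in `e4` and `e6` of a given weight. -/
noncomputable def modForms (k : ℤ) : Submodule R (PowerSeries R) :=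
  Submodule.span R {f | ∃ a b : ℕ, 4 * a + 6 * b = k ∧ f = e4 R ^ a * e6 R ^ b}

variable {R}

lemma monomial_mem_modForms (a b : ℕ) {k : ℤ} (h : 4 * a + 6 * b = k) :
    e4 R ^ a * e6 R ^ b ∈ modForms R k :=
  Submodule.subset_span ⟨a, b, h, rfl⟩

lemma e4_mem_modForms : e4 R ∈ modForms R 4 := by
  simpa using monomial_mem_modForms (R := R) 1 0 (k := 4) (by norm_num)

lemma e6_mem_modForms : e6 R ∈ modForms R 6 := by
  simpa using monomial_mem_modForms (R := R) 0 1 (k := 6) (by norm_num)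

lemma one_mem_modForms : 1 ∈ modForms R 0 := by
  simpa using monomial_mem_modForms (R := R) 0 0 (k := 0) (by norm_num)

lemma C_mul_mem_modForms {k : ℤ} (c : R) {f : PowerSeries R} (hf : f ∈ modForms R k) :
    C c * f ∈ modForms R k := by
  rw [← smul_eq_C_mul]
  exact Submodule.smul_mem _ _ hf

lemma mul_mem_modForms {j k l : ℤ} {f g : PowerSeries R} (hf : f ∈ modForms R j)
    (hg : g ∈ modForms R k) (h : j + k = l) : f * g ∈ modForms R l := by
  subst h
  induction hf using Submodule.span_induction with
  | zero => simp
  | add x y _ _ hx hy => rw [add_mul]; exact add_mem hx hy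
  | smul c x _ hx => rw [smul_mul_assoc]; exact Submodule.smul_mem _ _ hx
  | mem x hx =>
    obtain ⟨a, b, hab, rfl⟩ := hx
    induction hg using Submodule.span_induction with
    | zero => simp
    | add x y _ _ hx hy => rw [mul_add]; exact add_mem hx hy
    | smul c x _ hx => rw [mul_smul_comm]; exact Submodule.smul_mem _ _ hx
    | mem y hy =>
      obtain ⟨a', b', hab', rfl⟩ := hy
      refine Submodule.subset_span ⟨a + a', b + b', by push_cast; linarith, by ring⟩

lemma serre_mem_modForms {k : ℤ} {f : PowerSeries R} (hf : f ∈ modForms R k) :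
    12 * theta R f - k * (e2 R * f) ∈ modForms R (k + 2) := by
  induction hf using Submodule.span_induction with
  | zero => simp
  | add x y _ _ hx hy =>
    convert! add_mem hx hy using 1
    rw [map_add]
    ring
  | smul c x _ hx =>
    convert! Submodule.smul_mem _ c hx using 1
    rw [Derivation.map_smul, smul_sub, mul_smul_comm, mul_smul_comm, mul_smul_comm]
  | mem x hx =>
    obtain ⟨a, b, hab, rfl⟩ := hx
    have h : 12 * theta R (e4 R ^ a * e6 R ^ b) - k * (e2 R * (e4 R ^ a * e6 R ^ b)) =
        -((4 * a : ℕ) • (e4 R ^ (a - 1) * e6 R ^ (b + 1))) -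
          (6 * b : ℕ) • (e4 R ^ (a + 2) * e6 R ^ (b - 1)) := by
      rw [← hab, Derivation.leibniz, Derivation.leibniz_pow, Derivation.leibniz_pow]
      simp only [smul_eq_mul, nsmul_eq_mul]
      push_cast
      rcases a with _ | a <;> rcases b with _ | b <;>
        simp only [Nat.cast_zero, Nat.cast_succ, Nat.add_sub_cancel, pow_zero, pow_succ] <;>
      grind [theta_e4 R, theta_e6 R]
    rw [h]
    refine sub_mem (neg_mem ?_) ?_
    · rcases a with _ | a
      · simp
      · exact nsmul_mem (monomial_mem_modForms _ _ (by push_cast at *; linarith)) _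
    · rcases b with _ | b
      · simp
      · exact nsmul_mem (monomial_mem_modForms _ _ (by push_cast at *; linarith)) _

lemma modForms_eq_bot {k : ℤ} (h : ∀ a b : ℕ, (4 * a + 6 * b : ℤ) ≠ k) {f : PowerSeries R}
    (hf : f ∈ modForms R k) : f = 0 := by
  have : {f : PowerSeries R | ∃ a b : ℕ, 4 * a + 6 * b = k ∧ f = e4 R ^ a * e6 R ^ b} = ∅ := by
    ext f
    simp only [Set.mem_ofPred_eq, Set.mem_empty_iff_false, iff_false]
    rintro ⟨a, b, hab, -⟩
    exact h a b hab
  rw [modForms, this, Submodule.span_empty] at hf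
  simpa using hf

lemma exists_discr_mul_of_monomials (a b a' b' : ℕ) {k : ℤ} (h : 4 * a + 6 * b = k)
    (h' : 4 * a' + 6 * b' = k) :
    ∃ g ∈ modForms R (k - 12), e4 R ^ a * e6 R ^ b - e4 R ^ a' * e6 R ^ b' = discr R * g := by
  wlog hle : a' ≤ a generalizing a b a' b'
  · obtain ⟨g, hg, hh⟩ := this a' b' a b h' h (by omega)
    exact ⟨-g, neg_mem hg, by linear_combination -hh⟩
  obtain ⟨t, rfl⟩ : ∃ t, a = a' + 3 * t := ⟨(a - a') / 3, by omega⟩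
  obtain rfl : b' = b + 2 * t := by omega
  refine ⟨e4 R ^ a' * e6 R ^ b * ∑ i ∈ range t, (e4 R ^ 3) ^ i * (e6 R ^ 2) ^ (t - 1 - i), ?_, ?_⟩
  · rw [mul_sum]
    refine sum_mem fun i hi => ?_
    rw [mem_range] at hi
    rw [show e4 R ^ a' * e6 R ^ b * ((e4 R ^ 3) ^ i * (e6 R ^ 2) ^ (t - 1 - i)) =
      e4 R ^ (a' + 3 * i) * e6 R ^ (b + 2 * (t - 1 - i)) by ring]
    apply monomial_mem_modForms
    push_cast at *
    omega
  · have := Commute.geom_sum₂_mul (Commute.all (e4 R ^ 3) (e6 R ^ 2)) t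
    rw [discr]
    linear_combination (-(e4 R ^ a' * e6 R ^ b)) * this

lemma exists_discr_mul {k : ℤ} {f : PowerSeries R} (hf : f ∈ modForms R k) (a b : ℕ)
    (h : 4 * a + 6 * b = k) :
    ∃ g ∈ modForms R (k - 12), f = C (constantCoeff f) * (e4 R ^ a * e6 R ^ b) + discr R * g := by
  induction hf using Submodule.span_induction with
  | zero => exact ⟨0, zero_mem _, by simp⟩
  | add x y _ _ hx hy =>
    obtain ⟨g, hg, h1⟩ := hx
    obtain ⟨g', hg', h2⟩ := hy
    exact ⟨g + g', add_mem hg hg', by rw [map_add, map_add]; linear_combination h1 + h2⟩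
  | smul c x _ hx =>
    obtain ⟨g, hg, h1⟩ := hx
    refine ⟨c • g, Submodule.smul_mem _ _ hg, ?_⟩
    rw [smul_eq_C_mul, smul_eq_C_mul, map_mul, map_mul, constantCoeff_C]
    linear_combination C c * h1
  | mem x hx =>
    obtain ⟨a', b', hab, rfl⟩ := hx
    obtain ⟨g, hg, hh⟩ := exists_discr_mul_of_monomials (R := R) a' b' a b hab h
    exact ⟨g, hg, by simp; linear_combination hh⟩

lemma exists_discr_mul_of_constantCoeff {k : ℤ} {f : PowerSeries R} (hf : f ∈ modForms R k)
    (h0 : constantCoeff f = 0) : ∃ g ∈ modForms R (k - 12), f = discr R * g := by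
  by_cases h : ∃ a b : ℕ, (4 * a + 6 * b : ℤ) = k
  · obtain ⟨a, b, h⟩ := h
    simpa [h0] using exists_discr_mul hf a b h
  · push Not at h
    exact ⟨0, zero_mem _, by simpa using modForms_eq_bot h hf⟩

lemma exists_e4_mul {k : ℤ} {f : PowerSeries R} (hf : f ∈ modForms R k) :
    ∃ g ∈ modForms R (k - 4), ∃ c : R, ∃ b : ℕ, (6 * b = k ∨ c = 0) ∧
      f = e4 R * g + C c * e6 R ^ b := by
  induction hf using Submodule.span_induction with
  | zero => exact ⟨0, zero_mem _, 0, 0, by simp⟩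
  | add x y _ _ hx hy =>
    obtain ⟨g, hg, c, b, hb, rfl⟩ := hx
    obtain ⟨g', hg', c', b', hb', rfl⟩ := hy
    rcases hb with hb | rfl
    · rcases hb' with hb' | rfl
      · obtain rfl : b = b' := by omega
        exact ⟨g + g', add_mem hg hg', c + c', b, Or.inl hb, by rw [map_add]; ring⟩
      · exact ⟨g + g', add_mem hg hg', c, b, Or.inl hb, by rw [map_zero]; ring⟩
    · exact ⟨g + g', add_mem hg hg', c', b', hb', by rw [map_zero]; ring⟩
  | smul c x _ hx =>
    obtain ⟨g, hg, c', b, hb, rfl⟩ := hx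
    refine ⟨c • g, Submodule.smul_mem _ _ hg, c * c', b, hb.imp_right (by simp +contextual), ?_⟩
    rw [smul_eq_C_mul, smul_eq_C_mul, map_mul]
    ring
  | mem x hx =>
    obtain ⟨a, b, hab, rfl⟩ := hx
    rcases a with _ | a
    · exact ⟨0, zero_mem _, 1, b, Or.inl (by simpa using hab), by simp⟩
    · exact ⟨e4 R ^ a * e6 R ^ b, monomial_mem_modForms _ _ (by push_cast at hab; linarith), 0, 0,
        Or.inr rfl, by simp; ring⟩

end ModularRing

section ModularField

open PowerSeries

variable {K : Type*} [Field K]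

lemma discr_ne_zero (h : (1728 : K) ≠ 0) : discr K ≠ 0 := fun h0 => by
  have := coeff_one_discr K
  rw [h0, map_zero] at this
  exact h this.symm

lemma aeval_injective_of_order_one {t : PowerSeries K} (h0 : constantCoeff t = 1) (h1 : t ≠ 1)
    {p : Polynomial K} (hp : Polynomial.aeval t p = 0) : p = 0 := by
  by_contra hne
  obtain ⟨r, hr, hnd⟩ := Polynomial.exists_eq_pow_rootMultiplicity_mul_and_not_dvd p hne 1
  rw [hr, map_mul, map_pow] at hp
  have h2 : Polynomial.aeval t r ≠ 0 := fun h => by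
    apply hnd
    rw [Polynomial.dvd_iff_isRoot, Polynomial.IsRoot]
    have := congrArg (constantCoeff (R := K)) h
    rw [Polynomial.aeval_def, Polynomial.hom_eval₂, h0, map_zero] at this
    rw [← this, Polynomial.eval, show (constantCoeff (R := K)).comp (algebraMap K (PowerSeries K)) =
      RingHom.id K from RingHom.ext fun x => by simp]
  rcases mul_eq_zero.mp hp with h | h
  · apply h1
    have := eq_zero_of_pow_eq_zero h
    simpa [sub_eq_zero] using this
  · exact h2 h

lemma eq_zero_of_e4_mul_eq (h : (1728 : K) ≠ 0) {n : ℕ} {c : K} {w : PowerSeries K}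
    (hw : w ∈ modForms K (6 * n - 4)) (he : e4 K * w = C c * e6 K ^ n) : c = 0 := by
  set t := e4 K ^ 3 * (e6 K ^ 2)⁻¹ with ht
  have hu : e6 K * (e6 K)⁻¹ = 1 := PowerSeries.mul_inv_cancel _ (by simp)
  have hu2 : e6 K ^ 2 * (e6 K ^ 2)⁻¹ = 1 := PowerSeries.mul_inv_cancel _ (by simp)
  have key : ∃ p : Polynomial K, e4 K * w =
      e6 K ^ n * Polynomial.aeval t (Polynomial.X * p) := by
    clear he
    induction hw using Submodule.span_induction with
    | zero => exact ⟨0, by simp⟩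
    | add x y _ _ hx hy =>
      obtain ⟨p, hp⟩ := hx
      obtain ⟨p', hp'⟩ := hy
      exact ⟨p + p', by rw [mul_add, mul_add, map_add, hp, hp']; ring⟩
    | smul a x _ hx =>
      obtain ⟨p, hp⟩ := hx
      refine ⟨a • p, ?_⟩
      rw [mul_smul_comm, mul_smul_comm, hp, map_smul, mul_smul_comm]
    | mem x hx =>
      obtain ⟨a, b, hab, rfl⟩ := hx
      obtain ⟨s, rfl⟩ : ∃ s, a = 3 * s + 2 := ⟨a / 3, by omega⟩
      obtain rfl : n = b + 2 * (s + 1) := by push_cast at hab; omega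
      refine ⟨Polynomial.X ^ s, ?_⟩
      rw [← pow_succ', map_pow, Polynomial.aeval_X, ht, mul_pow, pow_add (e6 K), pow_mul (e6 K)]
      have : (e6 K ^ 2) ^ (s + 1) * ((e6 K ^ 2)⁻¹) ^ (s + 1) = 1 := by
        rw [← mul_pow, hu2, one_pow]
      linear_combination (-(e6 K ^ b * (e4 K ^ 3) ^ (s + 1))) * this
  obtain ⟨p, hp⟩ := key
  have h1 : Polynomial.aeval t (Polynomial.X * p - Polynomial.C c) = 0 := by
    have h6 : e6 K ^ n ≠ 0 := pow_ne_zero _ fun h => by simpa [h] using constantCoeff_e6 K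
    apply mul_left_cancel₀ h6
    rw [map_sub, mul_sub, ← hp, he, Polynomial.aeval_C, PowerSeries.algebraMap_apply]
    simp
    ring
  have h2 := aeval_injective_of_order_one (by simp [ht]) (fun ht1 => discr_ne_zero h (by
    rw [discr]
    linear_combination e6 K ^ 2 * ht1 - e4 K ^ 3 * hu2)) h1
  simpa using congrArg (Polynomial.coeff · 0) h2

lemma e4_dvd_of_e4_mul_eq (h : (1728 : K) ≠ 0) {k : ℤ} {f g : PowerSeries K}
    (hf : f ∈ modForms K (k + 2)) (hg : g ∈ modForms K k) (he : e4 K * f = e6 K * g) :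
    ∃ g' ∈ modForms K (k - 4), g = e4 K * g' := by
  obtain ⟨g', hg', c, b, hb, rfl⟩ := exists_e4_mul hg
  rcases hb with rfl | rfl
  · have : c = 0 := eq_zero_of_e4_mul_eq h (n := b + 1) (w := f - e6 K * g')
      (sub_mem (by convert! hf using 2; push_cast; ring)
        (mul_mem_modForms e6_mem_modForms hg' (by push_cast; ring)))
      (by linear_combination he)
    exact ⟨g', hg', by simp [this]⟩
  · exact ⟨g', hg', by simp⟩

end ModularField

section GradedSeries

open PowerSeries

lemma theta_mul {R : Type*} [CommRing R] (f g : PowerSeries R) :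
    theta R (f * g) = theta R f * g + f * theta R g := by
  rw [Derivation.leibniz, smul_eq_mul, smul_eq_mul]
  ring

lemma theta_pow {R : Type*} [CommRing R] (f : PowerSeries R) (n : ℕ) :
    theta R (f ^ n) = n * (f ^ (n - 1) * theta R f) := by
  rw [Derivation.leibniz_pow, smul_eq_mul, nsmul_eq_mul]

/-- The operator `theta` applied to every coefficient. -/
noncomputable def coeffTheta (F : PowerSeries (PowerSeries ℚ)) : PowerSeries (PowerSeries ℚ) :=
  PowerSeries.mk fun k => theta ℚ (coeff k F)

@[simp] lemma coeff_coeffTheta (k : ℕ) (F : PowerSeries (PowerSeries ℚ)) :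
    coeff k (coeffTheta F) = theta ℚ (coeff k F) := by rw [coeffTheta, coeff_mk]

lemma coeffTheta_mul (F G : PowerSeries (PowerSeries ℚ)) :
    coeffTheta (F * G) = coeffTheta F * G + F * coeffTheta G := by
  ext1 k
  simp only [coeff_coeffTheta, coeff_mul, map_sum, map_add, Derivation.leibniz, smul_eq_mul,
    sum_add_distrib]
  rw [add_comm]
  congr 1
  exact sum_congr rfl fun _ _ => mul_comm _ _

/-- The series `exp (c * e2 * u ^ 2)`. -/
noncomputable def gaussian (c : ℚ) : PowerSeries (PowerSeries ℚ) :=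
  PowerSeries.mk fun k => if Even k then C (c ^ (k / 2) / (k / 2).factorial) * e2 ℚ ^ (k / 2) else 0

lemma coeff_zero_gaussian (c : ℚ) : coeff 0 (gaussian c) = 1 := by simp [gaussian]

lemma coeff_one_gaussian (c : ℚ) : coeff 1 (gaussian c) = 0 := by simp [gaussian]

lemma coeff_gaussian_two_mul (c : ℚ) (n : ℕ) :
    coeff (2 * n) (gaussian c) = C (c ^ n / n.factorial) * e2 ℚ ^ n := by
  rw [gaussian, coeff_mk, if_pos (even_two_mul n), Nat.mul_div_cancel_left _ two_pos]

lemma theta_gaussian (c : ℚ) :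
    theta _ (gaussian c) = C (C (2 * c) * e2 ℚ) * (X ^ 2 * gaussian c) := by
  ext1 k
  rw [coeff_theta, coeff_C_mul]
  rcases k with _ | _ | k
  · simp [pow_two, mul_assoc]
  · simp [coeff_one_gaussian, pow_two, mul_assoc]
  · rw [coeff_X_pow_mul _ 2 k, gaussian, coeff_mk, coeff_mk]
    simp only [Nat.even_add_one, not_not]
    split_ifs with h
    · obtain ⟨m, rfl⟩ := h
      rw [show (m + m + 1 + 1) / 2 = m + 1 by omega, show (m + m) / 2 = m by omega]
      rw [show ((m + m + 1 + 1 : ℕ) : PowerSeries ℚ) = C ((2 * (m + 1) : ℕ) : ℚ) by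
        rw [map_natCast]; push_cast; ring]
      rw [← mul_assoc, ← map_mul, mul_mul_mul_comm, ← map_mul, pow_succ' (e2 ℚ)]
      congr 2
      rw [Nat.factorial_succ]
      push_cast
      field_simp
      ring
    · simp

lemma coeffTheta_gaussian (c : ℚ) :
    coeffTheta (gaussian c) = C (C c * theta ℚ (e2 ℚ)) * (X ^ 2 * gaussian c) := by
  ext1 k
  rw [coeff_coeffTheta, coeff_C_mul]
  rcases k with _ | _ | k
  · simp [coeff_zero_gaussian, pow_two, mul_assoc]
  · simp [coeff_one_gaussian, pow_two, mul_assoc]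
  · rw [coeff_X_pow_mul _ 2 k, gaussian, coeff_mk, coeff_mk]
    simp only [Nat.even_add_one, not_not]
    split_ifs with h
    · obtain ⟨m, rfl⟩ := h
      rw [show (m + m + 1 + 1) / 2 = m + 1 by omega, show (m + m) / 2 = m by omega]
      rw [theta_C_mul, Derivation.leibniz_pow, Nat.add_sub_cancel, smul_eq_mul, nsmul_eq_mul]
      rw [show (C (c ^ (m + 1) / ((m + 1).factorial : ℚ)) : PowerSeries ℚ) *
        (((m + 1 : ℕ) : PowerSeries ℚ) * (e2 ℚ ^ m * theta ℚ (e2 ℚ))) =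
        (C (c ^ (m + 1) / ((m + 1).factorial : ℚ)) * C ((m + 1 : ℕ) : ℚ)) *
          (e2 ℚ ^ m * theta ℚ (e2 ℚ)) by rw [map_natCast]; ring]
      rw [← map_mul, show (c ^ (m + 1) / ((m + 1).factorial : ℚ)) * ((m + 1 : ℕ) : ℚ) =
        c * (c ^ m / m.factorial) by
          rw [Nat.factorial_succ]; push_cast; field_simp; ring]
      rw [map_mul]
      ring
    · simp

lemma eq_one_of_theta_eq_zero {F : PowerSeries (PowerSeries ℚ)} (h0 : coeff 0 F = 1)
    (h : theta _ F = 0) : F = 1 := by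
  ext1 k
  rcases k with _ | k
  · rw [h0]; simp
  · have := congrArg (coeff (k + 1)) h
    rw [coeff_theta, map_zero] at this
    have hc : CharZero (PowerSeries ℚ) := algebraRat.charZero _
    rw [(mul_eq_zero.mp this).resolve_left (Nat.cast_ne_zero.mpr k.succ_ne_zero), coeff_one,
      if_neg k.succ_ne_zero]

lemma gaussian_pow_three_mul : gaussian (-1 / 6) ^ 3 * gaussian (1 / 2) = 1 := by
  apply eq_one_of_theta_eq_zero
  · rw [coeff_zero_mul_eq, coeff_zero_pow_eq, coeff_zero_gaussian, coeff_zero_gaussian]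
    norm_num
  · rw [theta_mul, theta_pow, theta_gaussian, theta_gaussian]
    have h : 3 * (C (C (2 * (-1 / 6 : ℚ)) * e2 ℚ) : PowerSeries (PowerSeries ℚ)) +
        C (C (2 * (1 / 2 : ℚ)) * e2 ℚ) = 0 := by
      rw [← map_ofNat (C (R := PowerSeries ℚ)), ← map_mul, ← map_add, ← map_ofNat (C (R := ℚ)),
        ← mul_assoc, ← add_mul, ← map_mul, ← map_add]
      norm_num
    push_cast
    linear_combination (gaussian (-1 / 6) ^ 3 * gaussian (1 / 2) * X ^ 2) * h

/-- The coefficient of `u ^ k` is modular of weight `k`. -/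
def IsGraded (F : PowerSeries (PowerSeries ℚ)) : Prop := ∀ k : ℕ, coeff k F ∈ modForms ℚ k

lemma IsGraded.mul {F G : PowerSeries (PowerSeries ℚ)} (hF : IsGraded F) (hG : IsGraded G) :
    IsGraded (F * G) := fun k => by
  rw [coeff_mul]
  refine sum_mem fun p hp => mul_mem_modForms (hF _) (hG _) ?_
  rw [← Nat.cast_add, HasAntidiagonal.mem_antidiagonal.mp hp]

lemma IsGraded.of_mul_eq_one {F G : PowerSeries (PowerSeries ℚ)} (hF : IsGraded F)
    (h0 : coeff 0 F = 1) (h : F * G = 1) : IsGraded G := fun k => by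
  induction k using Nat.strong_induction_on with
  | _ k ih =>
    have hk := congrArg (coeff k) h
    rw [coeff_mul, Finset.Nat.sum_antidiagonal_eq_sum_range_succ_mk, sum_range_succ', h0,
      one_mul, Nat.sub_zero] at hk
    rw [eq_sub_of_add_eq' hk]
    refine sub_mem ?_ (sum_mem fun i hi => ?_)
    · rw [coeff_one]
      split_ifs with h
      · subst h
        exact one_mem_modForms
      · exact zero_mem _
    · rw [mem_range] at hi
      exact mul_mem_modForms (hF _) (ih _ (by omega)) (by push_cast [Nat.cast_sub hi]; ring)

lemma mem_modForms_of_C_mul {k : ℤ} {c : ℚ} (hc : c ≠ 0) {f : PowerSeries ℚ}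
    (h : C c * f ∈ modForms ℚ k) : f ∈ modForms ℚ k := by
  have := C_mul_mem_modForms c⁻¹ h
  rwa [← mul_assoc, ← map_mul, inv_mul_cancel₀ hc, map_one, one_mul] at this

/-- The modular normalization of `psiSeries`. -/
noncomputable def psiMod : PowerSeries (PowerSeries ℚ) := psiSeries * gaussian (-1 / 6)

lemma heat_psiSeries' : theta _ (theta _ psiSeries) + theta _ psiSeries =
    X ^ 2 * (8 * coeffTheta psiSeries + C (e2 ℚ) * psiSeries) := by
  ext1 k
  rw [map_add, coeff_theta, coeff_theta, pow_two, mul_assoc]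
  rcases k with _ | _ | k
  · simp
  · simp [coeff_psiSeries_of_odd odd_one]
  · rw [coeff_succ_X_mul, coeff_succ_X_mul, map_add, ← map_ofNat (C (R := PowerSeries ℚ)),
      coeff_C_mul, coeff_C_mul, coeff_coeffTheta, e2_rat, heat_psiSeries]
    rw [map_mul, map_add, map_add, map_natCast, map_ofNat, map_ofNat]
    push_cast
    ring

lemma psiMod_eq : 9 * (theta _ (theta _ psiMod) + theta _ psiMod) =
    X ^ 2 * (72 * coeffTheta psiMod - 6 * (C (e2 ℚ) * theta _ psiMod)) -
      X ^ 4 * (C (e4 ℚ) * psiMod) := by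
  have h := heat_psiSeries'
  have hg := theta_gaussian (-1 / 6)
  have hgt := coeffTheta_gaussian (-1 / 6)
  have h12 := congrArg (C (R := PowerSeries ℚ)) (theta_e2 ℚ)
  have c1 : 3 * C (C (2 * (-1 / 6 : ℚ)) * e2 ℚ) = -C (e2 ℚ) := by
    rw [← map_ofNat (C (R := PowerSeries ℚ)), ← map_mul, ← map_ofNat (C (R := ℚ)), ← mul_assoc,
      ← map_mul, ← map_neg]
    norm_num
  have c2 : 6 * C (C (-1 / 6 : ℚ) * theta ℚ (e2 ℚ)) = -C (theta ℚ (e2 ℚ)) := by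
    rw [← map_ofNat (C (R := PowerSeries ℚ)), ← map_mul, ← map_ofNat (C (R := ℚ)), ← mul_assoc,
      ← map_mul, ← map_neg]
    norm_num
  have d1 : theta _ psiMod = theta _ psiSeries * gaussian (-1 / 6) +
      C (C (2 * (-1 / 6 : ℚ)) * e2 ℚ) * (X ^ 2 * psiMod) := by
    rw [psiMod, theta_mul, hg]
    ring
  have d2 : theta _ (theta _ psiMod) = theta _ (theta _ psiSeries) * gaussian (-1 / 6) +
      C (C (2 * (-1 / 6 : ℚ)) * e2 ℚ) * (X ^ 2 * (theta _ psiSeries * gaussian (-1 / 6))) +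
      C (C (2 * (-1 / 6 : ℚ)) * e2 ℚ) * (2 * X ^ 2 * psiMod + X ^ 2 * theta _ psiMod) := by
    conv_lhs => rw [d1]
    rw [map_add, theta_mul, hg, theta_C_mul, theta_mul, theta_X_pow]
    push_cast
    ring
  have d3 : coeffTheta psiMod = coeffTheta psiSeries * gaussian (-1 / 6) +
      C (C (-1 / 6 : ℚ) * theta ℚ (e2 ℚ)) * (X ^ 2 * psiMod) := by
    rw [psiMod, coeffTheta_mul, hgt]
    ring
  have hP : psiMod = psiSeries * gaussian (-1 / 6) := rfl
  simp only [map_mul, map_sub, map_pow, map_ofNat] at h12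
  linear_combination 9 * d2 + (9 + 9 * C (C (2 * (-1 / 6 : ℚ)) * e2 ℚ) * X ^ 2 +
    6 * X ^ 2 * C (e2 ℚ)) * d1 - 72 * X ^ 2 * d3 + 9 * gaussian (-1 / 6) * h +
    (6 * X ^ 2 * (theta _ psiSeries * gaussian (-1 / 6)) + 9 * X ^ 2 * psiMod + X ^ 4 * psiMod *
      (3 * C (C (2 * (-1 / 6 : ℚ)) * e2 ℚ) + C (e2 ℚ))) * c1 - 12 * X ^ 4 * psiMod * c2 +
    X ^ 4 * psiMod * h12 - 9 * X ^ 2 * C (e2 ℚ) * hP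

lemma coeff_zero_psiMod : coeff 0 psiMod = 1 := by
  rw [psiMod, coeff_zero_mul_eq, coeff_psiSeries_zero, coeff_zero_gaussian, one_mul]

lemma coeff_C_ofNat_mul (n k : ℕ) [n.AtLeastTwo] (F : PowerSeries (PowerSeries ℚ)) :
    coeff k (OfNat.ofNat n * F) = OfNat.ofNat n * coeff k F := by
  rw [← map_ofNat (C (R := PowerSeries ℚ)), coeff_C_mul]

lemma isGraded_psiMod : IsGraded psiMod := fun k => by
  induction k using Nat.strong_induction_on with
  | _ k ih =>
    rcases k with _ | _ | k
    · rw [coeff_zero_psiMod]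
      exact one_mem_modForms
    · rw [psiMod, coeff_one_aux _ _ (coeff_psiSeries_of_odd odd_one) (coeff_one_gaussian _)]
      exact zero_mem _
    · have h := congrArg (coeff (k + 2)) psiMod_eq
      rw [map_sub, coeff_C_ofNat_mul, map_add, coeff_theta, coeff_theta, coeff_X_pow_mul _ 2 k,
        map_sub, coeff_C_ofNat_mul, coeff_C_ofNat_mul, coeff_C_mul, coeff_theta,
        coeff_coeffTheta] at h
      have h1 := serre_mem_modForms (ih k (by omega))
      have h2 : coeff (k + 2) (X ^ 4 * (C (e4 ℚ) * psiMod)) ∈ modForms ℚ (k + 2) := by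
        rw [coeff_X_pow_mul']
        split_ifs with hk
        · rw [coeff_C_mul]
          exact mul_mem_modForms e4_mem_modForms (ih _ (by omega)) (by push_cast; omega)
        · exact zero_mem _
      apply mem_modForms_of_C_mul (c := 9 * ((k + 3) * (k + 2))) (by positivity)
      push_cast
      convert! sub_mem (C_mul_mem_modForms 6 h1) h2 using 1
      push_cast at h ⊢
      simp only [map_mul, map_add, map_ofNat, map_natCast]
      linear_combination h

/-- The modular normalization of `psiInvCube`. -/
noncomputable def psiInvMod : PowerSeries (PowerSeries ℚ) := psiInvCube * gaussian (1 / 2)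

lemma isGraded_psiInvMod : IsGraded psiInvMod := by
  refine ((isGraded_psiMod.mul isGraded_psiMod).mul isGraded_psiMod).of_mul_eq_one ?_ ?_
  · simp only [coeff_zero_mul_eq, coeff_zero_psiMod, one_mul]
  · rw [psiMod, psiInvMod]
    linear_combination psiSeries ^ 3 * psiInvCube * gaussian_pow_three_mul + psiInvCube_mul

/-- The solution of the homogeneous equation that matches `crankSeries` to second order. -/
noncomputable def homSeries (A : PowerSeries ℚ) : PowerSeries (PowerSeries ℚ) :=
  PowerSeries.mk fun k => if Even k ∧ 2 ≤ k then C ((1 : ℚ) / (k - 1).factorial) *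
    (euler * ((fun f => f - 24 * theta ℚ f)^[(k - 2) / 2] A)) else 0

lemma homSeries_eq (A : PowerSeries ℚ) : theta _ (theta _ (homSeries A)) + 2 * homSeries A =
    3 * theta _ (homSeries A) +
      X ^ 2 * (C (e2 ℚ) * homSeries A - 24 * coeffTheta (homSeries A)) := by
  ext1 k
  rw [map_add, map_add, coeff_C_ofNat_mul, coeff_C_ofNat_mul, coeff_theta, coeff_theta]
  rcases k with _ | _ | k
  · simp [homSeries]
  · rw [coeff_X_pow_mul', if_neg (by norm_num)]
    simp [homSeries]
  · rw [coeff_X_pow_mul _ 2 k, map_sub, coeff_C_ofNat_mul, coeff_C_mul, coeff_coeffTheta,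
      homSeries, coeff_mk, coeff_mk]
    rcases Nat.even_or_odd k with ⟨m, rfl⟩ | hk
    · rcases m with _ | m
      · simp
        ring
      · rw [if_pos (by grind), if_pos (by grind)]
        rw [show (m + 1 + (m + 1) + 1 + 1 - 2) / 2 = m + 1 by omega,
          show (m + 1 + (m + 1) - 2) / 2 = m by omega, Function.iterate_succ_apply']
        set f := (fun f => f - 24 * theta ℚ f)^[m] A
        rw [show m + 1 + (m + 1) + 1 + 1 - 1 = 2 * m + 3 by omega,
          show m + 1 + (m + 1) - 1 = 2 * m + 1 by omega, theta_C_mul, theta_mul]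
        have he := theta_euler
        rw [← e2_rat] at he
        have hf : (C ((1 : ℚ) / (2 * m + 1).factorial) : PowerSeries ℚ) =
            ((2 * m + 3) * (2 * m + 2)) * C ((1 : ℚ) / (2 * m + 3).factorial) := by
          rw [show (((2 * m + 3) * (2 * m + 2)) : PowerSeries ℚ) =
            C (((2 * m + 3) * (2 * m + 2) : ℕ) : ℚ) by rw [map_natCast]; push_cast; ring,
            ← map_mul]
          congr 1
          rw [Nat.factorial_succ (2 * m + 2), Nat.factorial_succ (2 * m + 1)]
          push_cast
          field_simp
          ring
        rw [hf]
        push_cast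
        linear_combination ((2 * m + 3) * (2 * m + 2)) * C ((1 : ℚ) / (2 * m + 3).factorial) *
          f * he
    · rw [if_neg (by grind), if_neg (by grind)]
      simp

lemma coeff_zero_psiInvCube : coeff 0 psiInvCube = 1 := by
  have := congrArg (coeff 0) psiInvCube_mul
  rw [coeff_zero_mul_eq, coeff_zero_pow_eq, coeff_psiSeries_zero, one_pow, mul_one] at this
  rw [this]
  simp

lemma coeff_one_psiInvCube : coeff 1 psiInvCube = 0 := by
  have h := modForms_eq_bot (by omega) (isGraded_psiInvMod 1)
  rw [psiInvMod, coeff_mul, Finset.Nat.sum_antidiagonal_eq_sum_range_succ_mk] at h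
  simpa [sum_range_succ, coeff_one_gaussian, coeff_zero_gaussian] using h

lemma coeff_one_crankSeries : coeff 1 crankSeries = 0 := by
  have h := congrArg (coeff 1) shc_mul_inv
  rw [coeff_mul, Finset.Nat.sum_antidiagonal_eq_sum_range_succ_mk] at h
  simp only [sum_range_succ, coeff_one_shc, range_one, sum_singleton] at h
  rw [coeff_crankSeries_succ 0, coeff_oddSeries]
  simp only [oddCoeff_of_even Even.zero, map_zero, zero_mul]
  rw [show (PowerSeries.mk fun _ => (0 : PowerSeries ℚ)) = 0 from rfl, map_zero, mul_zero, sub_zero]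
  simp [constantCoeff_shc, coeff_one] at h
  simp [h]

lemma crankSeries_eq : theta _ (theta _ crankSeries) + 2 * crankSeries =
    3 * theta _ crankSeries + 2 * psiInvCube +
      X ^ 2 * (C (e2 ℚ) * crankSeries - 24 * coeffTheta crankSeries) := by
  ext1 k
  rw [map_add, map_add, map_add, coeff_C_ofNat_mul, coeff_C_ofNat_mul, coeff_C_ofNat_mul,
    coeff_theta, coeff_theta]
  rcases k with _ | _ | k
  · rw [coeff_X_pow_mul', if_neg (by norm_num), coeff_zero_psiInvCube, coeff_crankSeries_zero]
    simp
  · rw [coeff_X_pow_mul', if_neg (by norm_num), zero_add, coeff_one_psiInvCube,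
      coeff_one_crankSeries]
    simp
  · have h := crank_pde k
    rw [coeff_X_pow_mul _ 2 k, map_sub, coeff_C_ofNat_mul, coeff_C_mul, coeff_coeffTheta]
    rw [← e2_rat, map_mul, map_add, map_natCast, map_one] at h
    push_cast
    linear_combination -h

/-- The modular normalization of `crankSeries - homSeries A`. -/
noncomputable def crankMod (A : PowerSeries ℚ) : PowerSeries (PowerSeries ℚ) :=
  (crankSeries - homSeries A) * gaussian (1 / 2)

lemma crankMod_eq (A : PowerSeries ℚ) : theta _ (theta _ (crankMod A)) + 2 * crankMod A =
    3 * theta _ (crankMod A) + 2 * psiInvMod - 2 * X ^ 2 * (12 * coeffTheta (crankMod A) -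
      C (e2 ℚ) * theta _ (crankMod A)) - X ^ 4 * (C (e4 ℚ) * crankMod A) := by
  set D := crankSeries - homSeries A with hD
  have h : theta _ (theta _ D) + 2 * D = 3 * theta _ D + 2 * psiInvCube +
      X ^ 2 * (C (e2 ℚ) * D - 24 * coeffTheta D) := by
    have ht : coeffTheta D = coeffTheta crankSeries - coeffTheta (homSeries A) := by
      ext1 k
      simp [hD]
    rw [ht, hD, map_sub, map_sub]
    linear_combination crankSeries_eq - homSeries_eq A
  have hg := theta_gaussian (1 / 2)
  have hgt := coeffTheta_gaussian (1 / 2)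
  have h12 := congrArg (C (R := PowerSeries ℚ)) (theta_e2 ℚ)
  have hP : crankMod A = D * gaussian (1 / 2) := rfl
  have hR : psiInvMod = psiInvCube * gaussian (1 / 2) := rfl
  have c1 : C (C (2 * (1 / 2 : ℚ)) * e2 ℚ) = C (e2 ℚ) := by norm_num
  rw [c1] at hg
  have c2 : 2 * C (C (1 / 2 : ℚ) * theta ℚ (e2 ℚ)) = C (theta ℚ (e2 ℚ)) := by
    rw [← map_ofNat (C (R := PowerSeries ℚ)), ← map_mul, ← map_ofNat (C (R := ℚ)), ← mul_assoc,
      ← map_mul]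
    norm_num
  have d1 : theta _ (crankMod A) = theta _ D * gaussian (1 / 2) +
      C (e2 ℚ) * (X ^ 2 * crankMod A) := by
    rw [hP, theta_mul, hg]
    ring
  have d2 : theta _ (theta _ (crankMod A)) = theta _ (theta _ D) * gaussian (1 / 2) +
      C (e2 ℚ) * (X ^ 2 * (theta _ D * gaussian (1 / 2))) +
      C (e2 ℚ) * (2 * X ^ 2 * crankMod A + X ^ 2 * theta _ (crankMod A)) := by
    conv_lhs => rw [d1]
    rw [map_add, theta_mul, hg, theta_C_mul, theta_mul, theta_X_pow]
    push_cast
    ring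
  have d3 : coeffTheta (crankMod A) = coeffTheta D * gaussian (1 / 2) +
      C (C (1 / 2 : ℚ) * theta ℚ (e2 ℚ)) * (X ^ 2 * crankMod A) := by
    rw [hP, coeffTheta_mul, hgt]
    ring
  simp only [map_mul, map_sub, map_pow, map_ofNat] at h12
  linear_combination d2 - (3 + C (e2 ℚ) * X ^ 2) * d1 + 24 * X ^ 2 * d3 +
    gaussian (1 / 2) * h - 2 * hR + 12 * X ^ 4 * crankMod A * c2 + X ^ 4 * crankMod A * h12 +
    (2 - X ^ 2 * C (e2 ℚ)) * hP

lemma isGraded_crankMod {A : PowerSeries ℚ}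
    (hA : euler * A = coeff 2 crankSeries + C (1 / 2) * e2 ℚ) : IsGraded (crankMod A) := fun k => by
  have hh0 : coeff 0 (homSeries A) = 0 := by simp [homSeries]
  have hh1 : coeff 1 (homSeries A) = 0 := by simp [homSeries]
  have hh2 : coeff 2 (homSeries A) = euler * A := by simp [homSeries]
  induction k using Nat.strong_induction_on with
  | _ k ih =>
    rcases k with _ | _ | _ | k
    · rw [crankMod, coeff_zero_mul_eq, map_sub, hh0, coeff_crankSeries_zero, coeff_zero_gaussian]
      simpa using one_mem_modForms
    · rw [crankMod, coeff_one_aux _ _ (by rw [map_sub, hh1, coeff_one_crankSeries, sub_zero])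
        (coeff_one_gaussian _)]
      exact zero_mem _
    · have h2 := coeff_gaussian_two_mul (1 / 2) 1
      rw [crankMod, zero_add, coeff_two_of_even_aux _ _
        (by rw [map_sub, hh1, coeff_one_crankSeries, sub_zero]), map_sub, map_sub, hh0, hh2, hA, h2,
        coeff_crankSeries_zero, coeff_zero_gaussian]
      convert! zero_mem (modForms ℚ ((0 + 1 + 1 : ℕ) : ℤ)) using 1
      simp
    · have h := congrArg (coeff (k + 1 + 2)) (crankMod_eq A)
      rw [map_add, map_sub, map_sub, map_add, mul_assoc, coeff_C_ofNat_mul, coeff_C_ofNat_mul,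
        coeff_C_ofNat_mul, coeff_C_ofNat_mul, coeff_theta, coeff_theta,
        coeff_X_pow_mul _ 2 (k + 1), map_sub, coeff_C_ofNat_mul, coeff_C_mul, coeff_theta,
        coeff_coeffTheta] at h
      have h1 := serre_mem_modForms (ih (k + 1) (by omega))
      have h2 : coeff (k + 1 + 2) (X ^ 4 * (C (e4 ℚ) * crankMod A)) ∈
          modForms ℚ ((k + 1 : ℕ) + 2) := by
        rw [coeff_X_pow_mul']
        split_ifs with hk
        · rw [coeff_C_mul]
          exact mul_mem_modForms e4_mem_modForms (ih _ (by omega)) (by push_cast; omega)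
        · exact zero_mem _
      have h3 := isGraded_psiInvMod (k + 1 + 2)
      apply mem_modForms_of_C_mul (c := (k + 2) * (k + 1)) (by positivity)
      push_cast at h3 h1 h2 ⊢
      convert! sub_mem (sub_mem (C_mul_mem_modForms 2 h3) (C_mul_mem_modForms 2 h1)) h2 using 1
      push_cast at h ⊢
      simp only [map_mul, map_add, map_ofNat, map_natCast, map_one]
      rw [show k + 1 + 1 + 1 = k + 1 + 2 by ring]
      linear_combination h

end GradedSeries

section Reduction

open PowerSeries

variable (ℓ : ℕ) [Fact ℓ.Prime]

/-- The rationals whose denominators are prime to `ℓ`. -/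
def intAt : Subring ℚ where
  carrier := {x | (x.den : ZMod ℓ) ≠ 0}
  one_mem' := by simp
  zero_mem' := by simp
  mul_mem' {x y} hx hy h := by
    have hd : ((x.den * y.den : ℕ) : ZMod ℓ) = 0 := by
      rw [ZMod.natCast_eq_zero_iff] at h ⊢
      exact h.trans (Rat.mul_den_dvd x y)
    rw [Nat.cast_mul] at hd
    exact (mul_ne_zero hx hy) hd
  add_mem' {x y} hx hy h := by
    have hd : ((x.den * y.den : ℕ) : ZMod ℓ) = 0 := by
      rw [ZMod.natCast_eq_zero_iff] at h ⊢
      exact h.trans (Rat.add_den_dvd x y)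
    rw [Nat.cast_mul] at hd
    exact (mul_ne_zero hx hy) hd
  neg_mem' {x} hx := by simpa using hx

lemma mem_intAt {x : ℚ} : x ∈ intAt ℓ ↔ (x.den : ZMod ℓ) ≠ 0 := Iff.rfl

/-- Reduction modulo `ℓ`. -/
def redHom : intAt ℓ →+* ZMod ℓ where
  toFun x := ((x : ℚ) : ZMod ℓ)
  map_one' := by simp
  map_zero' := by simp
  map_mul' x y := by simpa using Rat.cast_mul_of_ne_zero x.2 y.2
  map_add' x y := by simpa using Rat.cast_add_of_ne_zero x.2 y.2

/-- `g` is the reduction of the `ℓ`-integral series `f`. -/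
def Reduces (f : PowerSeries ℚ) (g : PowerSeries (ZMod ℓ)) : Prop :=
  ∃ F : PowerSeries (intAt ℓ), PowerSeries.map (intAt ℓ).subtype F = f ∧
    PowerSeries.map (redHom ℓ) F = g

variable {ℓ}

namespace Reduces

variable {f f' : PowerSeries ℚ} {g g' : PowerSeries (ZMod ℓ)}

lemma add (h : Reduces ℓ f g) (h' : Reduces ℓ f' g') : Reduces ℓ (f + f') (g + g') := by
  obtain ⟨F, rfl, rfl⟩ := h
  obtain ⟨F', rfl, rfl⟩ := h'
  exact ⟨F + F', map_add _ _ _, map_add _ _ _⟩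

lemma sub (h : Reduces ℓ f g) (h' : Reduces ℓ f' g') : Reduces ℓ (f - f') (g - g') := by
  obtain ⟨F, rfl, rfl⟩ := h
  obtain ⟨F', rfl, rfl⟩ := h'
  exact ⟨F - F', map_sub _ _ _, map_sub _ _ _⟩

lemma mul (h : Reduces ℓ f g) (h' : Reduces ℓ f' g') : Reduces ℓ (f * f') (g * g') := by
  obtain ⟨F, rfl, rfl⟩ := h
  obtain ⟨F', rfl, rfl⟩ := h'
  exact ⟨F * F', map_mul _ _ _, map_mul _ _ _⟩

lemma pow (h : Reduces ℓ f g) (n : ℕ) : Reduces ℓ (f ^ n) (g ^ n) := by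
  obtain ⟨F, rfl, rfl⟩ := h
  exact ⟨F ^ n, map_pow _ _ _, map_pow _ _ _⟩

lemma theta (h : Reduces ℓ f g) : Reduces ℓ (_root_.theta ℚ f) (_root_.theta (ZMod ℓ) g) := by
  obtain ⟨F, rfl, rfl⟩ := h
  exact ⟨_root_.theta _ F, (theta_map _ _).symm, (theta_map _ _).symm⟩

lemma sum {ι : Type*} (s : Finset ι) {f : ι → PowerSeries ℚ} {g : ι → PowerSeries (ZMod ℓ)}
    (h : ∀ i ∈ s, Reduces ℓ (f i) (g i)) : Reduces ℓ (∑ i ∈ s, f i) (∑ i ∈ s, g i) := by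
  classical
  induction s using Finset.induction_on with
  | empty => exact ⟨0, by simp, by simp⟩
  | insert i s hi ih =>
    rw [sum_insert hi, sum_insert hi]
    exact (h i (mem_insert_self _ _)).add (ih fun j hj => h j (mem_insert_of_mem hj))

lemma unique (h : Reduces ℓ f g) (h' : Reduces ℓ f g') : g = g' := by
  obtain ⟨F, rfl, rfl⟩ := h
  obtain ⟨F', h1, rfl⟩ := h'
  rw [PowerSeries.map_injective _ Subtype.val_injective h1]

lemma of_int (F : PowerSeries ℤ) : Reduces ℓ (PowerSeries.map (Int.castRingHom ℚ) F)
    (PowerSeries.map (Int.castRingHom (ZMod ℓ)) F) := by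
  refine ⟨PowerSeries.map (Int.castRingHom (intAt ℓ)) F, ?_, ?_⟩
  · ext n
    simp
  · ext n
    simp

lemma C {x : ℚ} (hx : x ∈ intAt ℓ) :
    Reduces ℓ (PowerSeries.C x) (PowerSeries.C (x : ZMod ℓ)) :=
  ⟨PowerSeries.C ⟨x, hx⟩, by simp, by simp [redHom]⟩

end Reduces

lemma Reduces.e2 : Reduces ℓ (e2 ℚ) (e2 (ZMod ℓ)) := Reduces.of_int _

lemma natCast_inv_mem_intAt {n : ℕ} (h : (n : ZMod ℓ) ≠ 0) : (n : ℚ)⁻¹ ∈ intAt ℓ := by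
  have hn : n ≠ 0 := fun h0 => h (by simp [h0])
  rw [mem_intAt, Rat.inv_natCast_den, if_neg hn]
  exact h

lemma factorial_ne_zero_zmod {n : ℕ} (h : n < ℓ) : ((n.factorial : ℕ) : ZMod ℓ) ≠ 0 := by
  rw [Ne, ZMod.natCast_eq_zero_iff, (Fact.out : ℓ.Prime).dvd_factorial]
  omega

lemma natCast_ne_zero_zmod {n : ℕ} (h0 : 0 < n) (h : n < ℓ) : (n : ZMod ℓ) ≠ 0 := by
  rw [Ne, ZMod.natCast_eq_zero_iff]
  exact Nat.not_dvd_of_pos_of_lt h0 h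

lemma natCast_1728_ne_zero (h5 : 5 ≤ ℓ) : ((1728 : ℕ) : ZMod ℓ) ≠ 0 := by
  rw [Ne, ZMod.natCast_eq_zero_iff, show 1728 = 2 ^ 6 * 3 ^ 3 by norm_num,
    (Fact.out : ℓ.Prime).dvd_mul]
  rintro (h | h)
  · have := Nat.le_of_dvd two_pos ((Fact.out : ℓ.Prime).dvd_of_dvd_pow h)
    omega
  · have := Nat.le_of_dvd three_pos ((Fact.out : ℓ.Prime).dvd_of_dvd_pow h)
    omega

lemma exists_discr_eq_X_mul {S : Type*} [CommRing S] (h : IsUnit (1728 : S)) :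
    ∃ V W : PowerSeries S, V * W = 1 ∧ discr S = X * V := by
  obtain ⟨V, hV⟩ := X_dvd_iff.mpr (constantCoeff_discr S)
  obtain ⟨u, hu⟩ := h
  refine ⟨V, invOfUnit V u, mul_invOfUnit _ _ ?_, hV⟩
  have := coeff_one_discr S
  rw [hV, show 1 = 0 + 1 from rfl, coeff_succ_X_mul, coeff_zero_eq_constantCoeff_apply] at this
  rw [this, hu]

lemma isUnit_1728_intAt (h5 : 5 ≤ ℓ) : IsUnit (1728 : intAt ℓ) := by
  refine IsUnit.of_mul_eq_one ⟨_, natCast_inv_mem_intAt (natCast_1728_ne_zero h5)⟩ ?_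
  ext
  exact mul_inv_cancel₀ (by norm_num)

/-- The reduction of a modular form is a modular form of the same weight. -/
lemma Reduces.mem_modForms (h5 : 5 ≤ ℓ) {k : ℤ} {f : PowerSeries ℚ} {g : PowerSeries (ZMod ℓ)}
    (hf : f ∈ modForms ℚ k) (h : Reduces ℓ f g) : g ∈ modForms (ZMod ℓ) k := by
  induction hn : (k + 1).toNat using Nat.strong_induction_on generalizing k f g with
  | _ n ih =>
    by_cases hk : ∃ a b : ℕ, (4 * a + 6 * b : ℤ) = k
    · obtain ⟨a, b, hab⟩ := hk
      obtain ⟨f', hf', hff⟩ := exists_discr_mul hf a b hab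
      obtain ⟨V, W, hVW, hV⟩ := exists_discr_eq_X_mul (isUnit_1728_intAt h5)
      obtain ⟨F, rfl, rfl⟩ := h
      set c := constantCoeff F with hc
      obtain ⟨F', hF'⟩ := X_dvd_iff.mpr (show constantCoeff
        (F - PowerSeries.C c * (e4 (intAt ℓ) ^ a * e6 (intAt ℓ) ^ b)) = 0 by simp [hc])
      have h1 : F = PowerSeries.C c * (e4 (intAt ℓ) ^ a * e6 (intAt ℓ) ^ b) +
          discr (intAt ℓ) * (W * F') := by
        rw [hV]
        linear_combination hF' - X * F' * hVW
      have hd : ∀ {S : Type} [CommRing S] (φ : intAt ℓ →+* S),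
          PowerSeries.map φ (discr (intAt ℓ)) = discr S := fun φ => by
        rw [discr, map_sub, map_pow, map_pow, map_e4, map_e6, discr]
      have h2 : PowerSeries.map (intAt ℓ).subtype (W * F') = f' := by
        apply mul_left_cancel₀ (discr_ne_zero (K := ℚ) (by norm_num))
        rw [← hd (intAt ℓ).subtype, ← map_mul, hd]
        have h3 := congrArg (PowerSeries.map (intAt ℓ).subtype) h1
        rw [map_add, map_mul, map_mul, map_pow, map_pow, map_e4, map_e6] at h3
        have h4 : constantCoeff (PowerSeries.map (intAt ℓ).subtype F) = (c : ℚ) := by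
          rw [← coeff_zero_eq_constantCoeff_apply, coeff_map, coeff_zero_eq_constantCoeff_apply, hc]
          rfl
        rw [h4] at hff
        rw [h3, PowerSeries.map_C] at hff
        exact add_left_cancel hff
      rw [h1, map_add, map_mul, map_mul, map_mul _ (discr (intAt ℓ)), hd, map_pow, map_pow, map_e4,
        map_e6, PowerSeries.map_C]
      refine add_mem (C_mul_mem_modForms _ (monomial_mem_modForms a b hab)) ?_
      have hdm : discr (ZMod ℓ) ∈ modForms (ZMod ℓ) 12 := by
        rw [discr]
        refine sub_mem ?_ ?_
        · simpa using monomial_mem_modForms (R := ZMod ℓ) 3 0 (k := 12) (by norm_num)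
        · simpa using monomial_mem_modForms (R := ZMod ℓ) 0 2 (k := 12) (by norm_num)
      exact mul_mem_modForms hdm (ih _ (by omega) hf' ⟨W * F', h2, rfl⟩ rfl) (by ring)
    · push Not at hk
      rw [modForms_eq_bot hk hf] at h
      rw [h.unique ⟨0, map_zero _, map_zero _⟩]
      exact zero_mem _

end Reduction

section CrankReduction

open PowerSeries

variable {ℓ : ℕ} [Fact ℓ.Prime]

/-- `y` is the reduction of the `ℓ`-integral rational number `x`. -/
def ReducesNum (ℓ : ℕ) [Fact ℓ.Prime] (x : ℚ) (y : ZMod ℓ) : Prop :=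
  ∃ z : intAt ℓ, (z : ℚ) = x ∧ redHom ℓ z = y

namespace ReducesNum

variable {x x' : ℚ} {y y' : ZMod ℓ}

lemma add (h : ReducesNum ℓ x y) (h' : ReducesNum ℓ x' y') : ReducesNum ℓ (x + x') (y + y') := by
  obtain ⟨z, rfl, rfl⟩ := h
  obtain ⟨z', rfl, rfl⟩ := h'
  exact ⟨z + z', rfl, map_add _ _ _⟩

lemma neg (h : ReducesNum ℓ x y) : ReducesNum ℓ (-x) (-y) := by
  obtain ⟨z, rfl, rfl⟩ := h
  exact ⟨-z, rfl, map_neg _ _⟩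

lemma mul (h : ReducesNum ℓ x y) (h' : ReducesNum ℓ x' y') : ReducesNum ℓ (x * x') (y * y') := by
  obtain ⟨z, rfl, rfl⟩ := h
  obtain ⟨z', rfl, rfl⟩ := h'
  exact ⟨z * z', rfl, map_mul _ _ _⟩

lemma natCast (n : ℕ) : ReducesNum ℓ n n := ⟨n, by simp, map_natCast _ _⟩

lemma zero : ReducesNum ℓ 0 0 := by simpa using ReducesNum.natCast (ℓ := ℓ) 0

lemma one : ReducesNum ℓ 1 1 := by simpa using ReducesNum.natCast (ℓ := ℓ) 1

lemma inv_natCast {n : ℕ} (h : (n : ZMod ℓ) ≠ 0) : ReducesNum ℓ (n : ℚ)⁻¹ (n : ZMod ℓ)⁻¹ := by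
  refine ⟨⟨_, natCast_inv_mem_intAt h⟩, rfl, ?_⟩
  apply mul_left_cancel₀ h
  rw [mul_inv_cancel₀ h, ← map_natCast (redHom ℓ), ← map_mul, ← map_one (redHom ℓ)]
  congr 1
  ext
  exact mul_inv_cancel₀ (by rintro h0; exact h (by simp [Nat.cast_eq_zero.mp h0]))

lemma sum {ι : Type*} (s : Finset ι) {f : ι → ℚ} {g : ι → ZMod ℓ}
    (h : ∀ i ∈ s, ReducesNum ℓ (f i) (g i)) : ReducesNum ℓ (∑ i ∈ s, f i) (∑ i ∈ s, g i) := by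
  classical
  induction s using Finset.induction_on with
  | empty => exact zero
  | insert i s hi ih =>
    rw [sum_insert hi, sum_insert hi]
    exact (h i (mem_insert_self _ _)).add (ih fun j hj => h j (mem_insert_of_mem hj))

lemma factorial_mul (h : ReducesNum ℓ x y) : ReducesNum ℓ (ℓ.factorial * x) 0 := by
  have h1 := (ReducesNum.natCast (ℓ := ℓ) ℓ.factorial).mul h
  have h2 : ((ℓ.factorial : ℕ) : ZMod ℓ) = 0 := by
    rw [ZMod.natCast_eq_zero_iff]
    exact Nat.dvd_factorial (Fact.out : ℓ.Prime).pos le_rfl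
  rwa [h2, zero_mul] at h1

lemma C_mul {f : PowerSeries ℚ} {g : PowerSeries (ZMod ℓ)} (h : ReducesNum ℓ x y)
    (h' : Reduces ℓ f g) : Reduces ℓ (C x * f) (C y * g) := by
  obtain ⟨z, rfl, rfl⟩ := h
  exact Reduces.mul ⟨C z, by simp, by simp⟩ h'

end ReducesNum

lemma exists_reducesNum_shc {m : ℕ} (h : m + 2 ≤ ℓ) : ∃ y, ReducesNum ℓ (coeff m shc) y := by
  rw [shc, coeff_mk]
  split_ifs
  · rw [one_div]
    exact ⟨_, ReducesNum.inv_natCast (factorial_ne_zero_zmod (by omega))⟩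
  · exact ⟨_, ReducesNum.zero⟩

lemma sum_shc_mul_inv (m : ℕ) : coeff (m + 1) shc⁻¹ =
    -∑ i ∈ range (m + 1), coeff (i + 1) shc * coeff (m - i) shc⁻¹ := by
  have h := congrArg (coeff (m + 1)) shc_mul_inv
  rw [coeff_mul, Finset.Nat.sum_antidiagonal_eq_sum_range_succ_mk, sum_range_succ', coeff_one,
    if_neg m.succ_ne_zero, coeff_zero_eq_constantCoeff_apply shc, constantCoeff_shc, one_mul,
    Nat.sub_zero] at h
  rw [eq_neg_of_add_eq_zero_right h]
  congr 1
  refine sum_congr rfl fun i _ => ?_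
  rw [show m + 1 - (i + 1) = m - i by omega]

lemma exists_reducesNum_shc_inv {m : ℕ} (h : m + 2 ≤ ℓ) :
    ∃ y, ReducesNum ℓ (coeff m shc⁻¹) y := by
  induction m using Nat.strong_induction_on with
  | _ m ih =>
    rcases m with _ | m
    · rw [coeff_shc_inv_zero]
      exact ⟨1, ReducesNum.one⟩
    · have h1 : ∀ i, ∃ y, i ∈ range (m + 1) →
          ReducesNum ℓ (coeff (i + 1) shc * coeff (m - i) shc⁻¹) y := fun i => by
        by_cases hi : i ∈ range (m + 1)
        · rw [mem_range] at hi
          obtain ⟨y, hy⟩ := exists_reducesNum_shc (ℓ := ℓ) (m := i + 1) (by omega)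
          obtain ⟨y', hy'⟩ := ih (m - i) (by omega) (by omega)
          exact ⟨y * y', fun _ => hy.mul hy'⟩
        · exact ⟨0, fun h => absurd h hi⟩
      choose y hy using h1
      rw [sum_shc_mul_inv]
      exact ⟨_, (ReducesNum.sum _ hy).neg⟩

lemma coeff_two_shc_inv : coeff 2 shc⁻¹ = -(6 : ℚ)⁻¹ := by
  have h := sum_shc_mul_inv 1
  simp [sum_range_succ, coeff_one_shc, coeff_two_shc, constantCoeff_shc] at h
  exact h

lemma coeff_shc_of_odd {m : ℕ} (h : Odd m) : coeff m shc = 0 := by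
  rw [shc, coeff_mk, if_neg (Nat.not_even_iff_odd.mpr h)]

lemma reducesNum_shc_inv_pred (h5 : 5 ≤ ℓ) :
    ReducesNum ℓ (ℓ.factorial * coeff (ℓ - 1) shc⁻¹) (-1) := by
  obtain ⟨m, rfl⟩ : ∃ m, ℓ = m + 2 := ⟨ℓ - 2, by omega⟩
  have hodd : Odd (m + 2) := (Fact.out : (m + 2).Prime).odd_of_ne_two (by omega)
  rw [show m + 2 - 1 = m + 1 by omega, sum_shc_mul_inv, mul_neg, mul_sum, sum_range_succ]
  apply ReducesNum.neg
  rw [show (1 : ZMod (m + 2)) = ∑ i ∈ range m, 0 + 1 by simp]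
  refine (ReducesNum.sum _ fun i hi => ?_).add ?_
  · rw [mem_range] at hi
    obtain ⟨y, hy⟩ := exists_reducesNum_shc (ℓ := m + 2) (m := i + 1) (by omega)
    obtain ⟨y', hy'⟩ := exists_reducesNum_shc_inv (ℓ := m + 2) (m := m - i) (by omega)
    exact (hy.mul hy').factorial_mul
  · rw [Nat.sub_self, coeff_shc_inv_zero, shc, coeff_mk, if_pos (by grind), mul_one,
      mul_one_div_cancel (by positivity)]
    exact ReducesNum.one

lemma natCast_six_ne_zero (h5 : 5 ≤ ℓ) : ((6 : ℕ) : ZMod ℓ) ≠ 0 := fun h => by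
  apply natCast_1728_ne_zero h5
  rw [show 1728 = 6 * 288 by norm_num, Nat.cast_mul, h, zero_mul]

lemma natCast_two_ne_zero (h5 : 5 ≤ ℓ) : ((2 : ℕ) : ZMod ℓ) ≠ 0 := fun h => by
  apply natCast_six_ne_zero h5
  rw [show 6 = 2 * 3 by norm_num, Nat.cast_mul, h, zero_mul]

lemma reducesNum_shc_inv_succ (h5 : 5 ≤ ℓ) :
    ReducesNum ℓ (ℓ.factorial * coeff (ℓ + 1) shc⁻¹) (-(6 : ZMod ℓ)⁻¹) := by
  have hodd : Odd ℓ := (Fact.out : ℓ.Prime).odd_of_ne_two (by omega)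
  have h6 := natCast_six_ne_zero h5
  have h2 := natCast_two_ne_zero h5
  have hs := ReducesNum.inv_natCast h6
  have h2s := ReducesNum.inv_natCast h2
  push_cast at hs h2s
  have hval : (6 : ZMod ℓ)⁻¹ = ∑ i ∈ range (ℓ + 1), ((if i = 1 then -(6 : ZMod ℓ)⁻¹ else 0) +
      (if i = ℓ - 2 then -(6 : ZMod ℓ)⁻¹ else 0) + (if i = ℓ then (2 : ZMod ℓ)⁻¹ else 0)) := by
    rw [sum_add_distrib, sum_add_distrib, sum_ite_eq', sum_ite_eq', sum_ite_eq',
      if_pos (by rw [mem_range]; omega), if_pos (by rw [mem_range]; omega), if_pos (by simp)]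
    push_cast at h6 h2
    field_simp
    norm_num
  rw [sum_shc_mul_inv, mul_neg, mul_sum, hval]
  refine (ReducesNum.sum _ fun i hi => ?_).neg
  rw [mem_range] at hi
  by_cases h1 : i = 1
  · subst h1
    rw [if_pos rfl, if_neg (by omega), if_neg (by omega), add_zero, add_zero, coeff_two_shc,
      one_div, mul_left_comm]
    simpa using hs.mul (reducesNum_shc_inv_pred h5)
  by_cases h2 : i = ℓ - 2
  · subst h2
    rw [if_neg h1, if_pos rfl, if_neg (by omega), zero_add, add_zero,
      show ℓ - (ℓ - 2) = 2 by omega, coeff_two_shc_inv, shc, coeff_mk, if_pos (by grind),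
      show ℓ - 2 + 1 + 1 = ℓ by omega, ← mul_assoc, mul_one_div_cancel (by positivity), one_mul]
    exact hs.neg
  by_cases h3 : i = ℓ
  · subst h3
    rw [if_neg h1, if_neg h2, if_pos rfl, zero_add, zero_add, Nat.sub_self, coeff_shc_inv_zero,
      shc, coeff_mk, if_pos hodd.add_one, mul_one, Nat.factorial_succ, Nat.factorial_succ]
    have hx : ((i : ℚ) + 1 + 1) ≠ 0 := by positivity
    have hd : (((i + 1 + 1) * (i + 1) : ℕ) : ZMod i) = ((2 : ℕ) : ZMod i) := by
      push_cast
      rw [CharP.cast_eq_zero]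
      norm_num
    have := ReducesNum.inv_natCast (ℓ := i) (n := (i + 1 + 1) * (i + 1)) (by rwa [hd])
    rw [hd] at this
    convert! this using 1
    push_cast
    field_simp
  rw [if_neg h1, if_neg h2, if_neg h3, add_zero, add_zero]
  rcases Nat.even_or_odd i with he | ho
  · rw [coeff_shc_of_odd he.add_one, zero_mul, mul_zero]
    exact ReducesNum.zero
  · have : i ≠ ℓ - 1 := by grind
    obtain ⟨y, hy⟩ := exists_reducesNum_shc (ℓ := ℓ) (m := i + 1) (by omega)
    obtain ⟨y', hy'⟩ := exists_reducesNum_shc_inv (ℓ := ℓ) (m := ℓ - i) (by grind)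
    exact (hy.mul hy').factorial_mul

end CrankReduction

section CrankCongruence

open PowerSeries

/-- The operator `f ↦ f - 24 q f'`. -/
noncomputable def twistOp (R : Type*) [CommRing R] (f : PowerSeries R) : PowerSeries R :=
  f - 24 * theta R f

lemma coeff_twistOp_iterate {R : Type*} [CommRing R] (f : PowerSeries R) (m n : ℕ) :
    coeff n ((twistOp R)^[m] f) = (1 - 24 * n) ^ m * coeff n f := by
  induction m with
  | zero => simp
  | succ m ih =>
    rw [Function.iterate_succ_apply', twistOp, map_sub, ← map_ofNat (C (R := R)), coeff_C_mul,
      coeff_theta, ih, pow_succ]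
    ring

/-- The moment `∑ (2i+1)^j (b_i - 1)` of the partial theta functions. -/
noncomputable def thetaMoment (R : Type*) [CommRing R] (j : ℕ) : PowerSeries R :=
  diagEval (PowerSeries.mk fun i => C ((2 * i + 1 : R) ^ j) *
    -(X ^ 2 * diagEval (PowerSeries.mk fun r => (-1) ^ r * X ^ (3 * r.choose 2 + (i + 4) * r))))

lemma map_thetaMoment {R S : Type*} [CommRing R] [CommRing S] (φ : R →+* S) (j : ℕ) :
    PowerSeries.map φ (thetaMoment R j) = thetaMoment S j := by
  rw [thetaMoment, map_diagEval, thetaMoment]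
  congr 1
  ext1 i
  rw [coeff_map, coeff_mk, coeff_mk, map_mul, map_neg, map_mul, map_diagEval]
  simp only [map_pow, map_add, map_mul, map_ofNat, map_natCast, map_one,
    PowerSeries.map_X]
  congr 5
  ext1 r
  simp

lemma coeff_oddSeries_partialThetaGen {j : ℕ} (hj : Odd j) :
    C (j.factorial : ℚ) * coeff j (oddSeries partialThetaGen) = 2 * thetaMoment ℚ j := by
  have h2 : (2 : PowerSeries ℚ) = diagEval 2 := (map_ofNat (diagEval (B := ℚ)) 2).symm
  have h3 : (C (2 : ℚ) : PowerSeries ℚ) = 2 := map_ofNat _ 2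
  rw [coeff_oddSeries, thetaMoment, ← diagEval_C (C (j.factorial : ℚ)), ← map_mul, h2, ← map_mul]
  congr 1
  ext1 i
  rw [coeff_C_mul, coeff_mk, ← map_ofNat (C (R := PowerSeries ℚ)), coeff_C_mul, coeff_mk,
    partialThetaGen, coeff_mk, partialTheta, ← mul_assoc, ← map_mul, oddCoeff, hj.neg_pow,
    mul_div_cancel₀ _ (by positivity), ← h3, ← mul_assoc, ← map_mul]
  congr 2
  ring

lemma thetaMoment_prime {ℓ : ℕ} [Fact ℓ.Prime] :
    thetaMoment (ZMod ℓ) ℓ = thetaMoment (ZMod ℓ) 1 := by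
  rw [thetaMoment, thetaMoment]
  simp only [ZMod.pow_card, pow_one]

lemma reduces_thetaMoment {ℓ : ℕ} [Fact ℓ.Prime] (j : ℕ) :
    Reduces ℓ (thetaMoment ℚ j) (thetaMoment (ZMod ℓ) j) := by
  have := Reduces.of_int (ℓ := ℓ) (thetaMoment ℤ j)
  rwa [map_thetaMoment, map_thetaMoment] at this

lemma coeff_crankSeries_sub_homSeries (A : PowerSeries ℚ) {j : ℕ} (hj : Odd j) :
    C (j.factorial : ℚ) * coeff (j + 1) (crankSeries - homSeries A) =
      C (j.factorial * coeff (j + 1) shc⁻¹) - 4 * thetaMoment ℚ j -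
        euler * (twistOp ℚ)^[(j - 1) / 2] A := by
  have hf : (C (j.factorial : ℚ) : PowerSeries ℚ) * C ((1 : ℚ) / j.factorial) = 1 := by
    rw [← map_mul, mul_one_div_cancel (by positivity), map_one]
  have h1 : coeff (j + 1) (homSeries A) = C ((1 : ℚ) / j.factorial) *
      (euler * (twistOp ℚ)^[(j - 1) / 2] A) := by
    rw [homSeries, coeff_mk, if_pos ⟨hj.add_one, by have := hj.pos; omega⟩]
    rfl
  rw [map_sub, coeff_crankSeries_succ, h1, map_mul]
  linear_combination (-2) * coeff_oddSeries_partialThetaGen hj -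
    (euler * (twistOp ℚ)^[(j - 1) / 2] A) * hf

variable {ℓ : ℕ} [Fact ℓ.Prime]

lemma Reduces.twistOp_iterate {f : PowerSeries ℚ} {g : PowerSeries (ZMod ℓ)} (h : Reduces ℓ f g)
    (m : ℕ) : Reduces ℓ ((twistOp ℚ)^[m] f) ((twistOp (ZMod ℓ))^[m] g) := by
  induction m with
  | zero => exact h
  | succ m ih =>
    rw [Function.iterate_succ_apply', Function.iterate_succ_apply', twistOp, twistOp]
    refine ih.sub (Reduces.mul ⟨24, map_ofNat _ _, map_ofNat _ _⟩ ih.theta)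

lemma Reduces.congr_left {f f' : PowerSeries ℚ} {g : PowerSeries (ZMod ℓ)} (h : Reduces ℓ f g)
    (hf : f = f') : Reduces ℓ f' g := hf ▸ h

lemma Reduces.congr_right {f : PowerSeries ℚ} {g g' : PowerSeries (ZMod ℓ)} (h : Reduces ℓ f g)
    (hg : g = g') : Reduces ℓ f g' := hg ▸ h

lemma Reduces.four : Reduces ℓ 4 4 := ⟨4, map_ofNat _ _, map_ofNat _ _⟩

lemma exists_reduces_coeff {A : PowerSeries ℚ} {α ε : PowerSeries (ZMod ℓ)}
    (hα : Reduces ℓ A α) (hε : Reduces ℓ euler ε) {j : ℕ} (hj : Odd j) :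
    ∃ y, Reduces ℓ (C (j.factorial : ℚ) * coeff (j + 1) (crankSeries - homSeries A) -
      C (j.factorial * coeff (j + 1) shc⁻¹)) y := by
  rw [coeff_crankSeries_sub_homSeries A hj]
  refine ⟨_, ((Reduces.of_int 0).sub (Reduces.four.mul (reduces_thetaMoment j))).sub
    (hε.mul (hα.twistOp_iterate ((j - 1) / 2))) |>.congr_left ?_⟩
  rw [map_zero]
  ring

lemma natCast_ne_zero_of_factors {i j : ℕ} (h5 : 5 ≤ ℓ) (hi : i < ℓ) (hj : j < ℓ) :
    ((2 ^ i * i.factorial * j.factorial : ℕ) : ZMod ℓ) ≠ 0 := by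
  rw [Nat.cast_mul, Nat.cast_mul, Nat.cast_pow]
  exact mul_ne_zero (mul_ne_zero (pow_ne_zero _ (natCast_two_ne_zero h5))
    (factorial_ne_zero_zmod hi)) (factorial_ne_zero_zmod hj)

/-- The residues of the terms in the expansion of the coefficient of weight `ℓ + 1`. -/
lemma reduces_term (h5 : 5 ≤ ℓ) {A : PowerSeries ℚ} {α ε : PowerSeries (ZMod ℓ)}
    (hα : Reduces ℓ A α) (hε : Reduces ℓ euler ε) {i j : ℕ} (hij : j + 2 * i = ℓ) (hi : 0 < i) :
    ∃ c : ZMod ℓ, Reduces ℓ (C (ℓ.factorial : ℚ) * (coeff (j + 1) (crankSeries - homSeries A) *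
      coeff (2 * i) (gaussian (1 / 2)))) (C c * e2 (ZMod ℓ)) := by
  have hodd : Odd ℓ := (Fact.out : ℓ.Prime).odd_of_ne_two (by omega)
  have hj : Odd j := by
    rcases Nat.even_or_odd j with h | h
    · exfalso
      exact Nat.not_even_iff_odd.mpr hodd (hij ▸ h.add (even_two_mul i))
    · exact h
  obtain ⟨y, hy⟩ := exists_reduces_coeff hα hε hj
  have hne := natCast_ne_zero_of_factors (i := i) (j := j) h5 (by omega) (by omega)
  have hx := (ReducesNum.inv_natCast hne).factorial_mul
  have hj0 : (j.factorial : ℚ) ≠ 0 := by positivity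
  have hi0 : (i.factorial : ℚ) ≠ 0 := by positivity
  have hnum : (ℓ.factorial : ℚ) * ((1 / 2) ^ i / i.factorial) =
      ℓ.factorial * ((2 ^ i * i.factorial * j.factorial : ℕ) : ℚ)⁻¹ * j.factorial := by
    push_cast
    field_simp
    simp
  have key : C (ℓ.factorial : ℚ) * (coeff (j + 1) (crankSeries - homSeries A) *
      coeff (2 * i) (gaussian (1 / 2))) =
      C (ℓ.factorial * coeff (j + 1) shc⁻¹ * ((1 / 2) ^ i / i.factorial)) * e2 ℚ ^ i +
      C (ℓ.factorial * ((2 ^ i * i.factorial * j.factorial : ℕ) : ℚ)⁻¹) *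
        ((C (j.factorial : ℚ) * coeff (j + 1) (crankSeries - homSeries A) -
      C (j.factorial * coeff (j + 1) shc⁻¹)) * e2 ℚ ^ i) := by
    have h := congrArg (C (R := ℚ)) hnum
    rw [map_mul, map_mul _ _ (j.factorial : ℚ)] at h
    rw [coeff_gaussian_two_mul]
    simp only [map_mul (C (R := ℚ)) _ (coeff (j + 1) shc⁻¹), map_mul (C (R :=
        ℚ)) _ ((1 / 2) ^ i / (i.factorial : ℚ))]
    linear_combination (coeff (j + 1) (crankSeries - homSeries A) - C (coeff (j + 1) shc⁻¹)) *
      e2 ℚ ^ i * h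
  rw [key]
  have h2 := hx.C_mul (hy.mul (Reduces.e2.pow i))
  rw [map_zero, zero_mul] at h2
  by_cases h1 : i = 1
  · subst h1
    have h2s := ReducesNum.inv_natCast (natCast_two_ne_zero h5)
    have h3 := ((reducesNum_shc_inv_pred h5).mul h2s).C_mul Reduces.e2
    refine ⟨-1 * ((2 : ℕ) : ZMod ℓ)⁻¹, ?_⟩
    have h4 := h3.add h2
    rw [add_zero, show ℓ - 1 = j + 1 by omega] at h4
    simpa using h4
  · refine ⟨0, ?_⟩
    obtain ⟨z, hz⟩ := exists_reducesNum_shc_inv (ℓ := ℓ) (m := j + 1) (by omega)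
    have h3 := ((hz.mul (((ReducesNum.inv_natCast hne)).mul
      (ReducesNum.natCast j.factorial))).factorial_mul.C_mul (Reduces.e2.pow i)).add h2
    rw [map_zero, zero_mul, add_zero] at h3
    rw [map_zero, zero_mul]
    refine h3.congr_left ?_
    congr 3
    linear_combination -(coeff (j + 1) shc⁻¹) * hnum

lemma reduces_top (h5 : 5 ≤ ℓ) (A : PowerSeries ℚ) {n : ℕ} (hn : 2 * n = ℓ + 1) :
    Reduces ℓ (C (ℓ.factorial : ℚ) * (coeff 0 (crankSeries - homSeries A) *
      coeff (2 * n) (gaussian (1 / 2)))) 0 := by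
  have hne := natCast_ne_zero_of_factors (i := n) (j := 0) h5 (by omega) (by omega)
  have h := (ReducesNum.inv_natCast hne).factorial_mul.C_mul (Reduces.e2.pow n)
  rw [map_zero, zero_mul] at h
  refine h.congr_left ?_
  have h0 : coeff 0 (homSeries A) = 0 := by
    rw [homSeries, coeff_mk, if_neg (by simp)]
  rw [map_sub, coeff_crankSeries_zero, h0, sub_zero, one_mul, coeff_gaussian_two_mul, ← mul_assoc,
    ← map_mul]
  congr 2
  push_cast
  field_simp
  simp

lemma crank_congruence (h5 : 5 ≤ ℓ) {A : PowerSeries ℚ} {α ε : PowerSeries (ZMod ℓ)}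
    (hA : euler * A = coeff 2 crankSeries + C (1 / 2) * e2 ℚ) (hα : Reduces ℓ A α)
    (hε : Reduces ℓ euler ε) : ∃ c : ZMod ℓ,
      ε * (α - (twistOp (ZMod ℓ))^[(ℓ - 1) / 2] α) + C c * e2 (ZMod ℓ) ∈
        modForms (ZMod ℓ) (ℓ + 1) := by
  have hodd : Odd ℓ := (Fact.out : ℓ.Prime).odd_of_ne_two (by omega)
  have h2 := natCast_two_ne_zero h5
  have h2s := ReducesNum.inv_natCast h2
  have h6s := ReducesNum.inv_natCast (natCast_six_ne_zero h5)
  have hone : Reduces ℓ 1 1 := ⟨1, map_one _, map_one _⟩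
  push_cast at h2s h6s
  set β := (twistOp (ZMod ℓ))^[(ℓ - 1) / 2] α with hβ
  have hmom : Reduces ℓ (4 * thetaMoment ℚ ℓ)
      (C (2 : ZMod ℓ)⁻¹ * e2 _ - C (6 : ZMod ℓ)⁻¹ - ε * α) := by
    have h1 : Reduces ℓ (4 * thetaMoment ℚ 1) (4 * thetaMoment (ZMod ℓ) 1) :=
      Reduces.four.mul (reduces_thetaMoment 1)
    have h3 : 4 * thetaMoment ℚ 1 = C ((2 : ℚ)⁻¹) * e2 ℚ - C ((6 : ℚ)⁻¹) * 1 - euler * A := by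
      have h := coeff_oddSeries_partialThetaGen odd_one
      rw [hA, coeff_crankSeries_succ 1, coeff_two_shc_inv, map_neg, one_div]
      simp at h
      linear_combination -2 * h
    have h4 : 4 * thetaMoment (ZMod ℓ) 1 =
        C (2 : ZMod ℓ)⁻¹ * e2 _ - C (6 : ZMod ℓ)⁻¹ - ε * α := by
      rw [h3] at h1
      simpa using h1.unique (((h2s.C_mul Reduces.e2).sub (h6s.C_mul hone)).sub (hε.mul hα))
    rw [← h4, ← thetaMoment_prime]
    exact Reduces.four.mul (reduces_thetaMoment ℓ)
  have hbot : Reduces ℓ (C (ℓ.factorial : ℚ) * (coeff (ℓ + 1) (crankSeries - homSeries A) *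
      coeff 0 (gaussian (1 / 2)))) (ε * α - ε * β - C (2 : ZMod ℓ)⁻¹ * e2 _) := by
    rw [coeff_zero_gaussian, mul_one, coeff_crankSeries_sub_homSeries A hodd]
    have h := (((reducesNum_shc_inv_succ h5).C_mul hone).sub hmom).sub
      (hε.mul (hα.twistOp_iterate ((ℓ - 1) / 2)))
    rw [mul_one, mul_one, map_neg] at h
    convert! h using 1
    ring
  obtain ⟨n, hn⟩ : ∃ n, 2 * n = ℓ + 1 := by
    obtain ⟨m, hm⟩ := hodd
    exact ⟨m + 1, by omega⟩
  have hterm : ∀ k ∈ range (ℓ + 2), ∃ c : ZMod ℓ, Reduces ℓ (C (ℓ.factorial : ℚ) *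
      (coeff k (gaussian (1 / 2)) * coeff (ℓ + 1 - k) (crankSeries - homSeries A)))
      (C c * e2 (ZMod ℓ) + if k = 0 then ε * α - ε * β else 0) := by
    intro k hk
    rw [mul_comm (coeff k _)]
    by_cases h0 : k = 0
    · subst h0
      refine ⟨-(2 : ZMod ℓ)⁻¹, ?_⟩
      rw [if_pos rfl]
      convert! hbot using 1
      rw [map_neg]
      ring
    rw [if_neg h0]
    simp only [add_zero]
    rcases Nat.even_or_odd' k with ⟨i, rfl | rfl⟩
    · by_cases hi : i = n
      · subst hi
        refine ⟨0, ?_⟩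
        rw [hn, Nat.sub_self, map_zero, zero_mul, ← hn]
        exact reduces_top h5 A hn
      · have hk' := mem_range.mp hk
        obtain ⟨c, hc⟩ := reduces_term h5 hα hε (i := i) (j := ℓ - 2 * i) (by omega) (by omega)
        refine ⟨c, ?_⟩
        rwa [show ℓ + 1 - 2 * i = ℓ - 2 * i + 1 by omega]
    · refine ⟨0, ?_⟩
      rw [gaussian, coeff_mk, if_neg (by simp), mul_zero, mul_zero, map_zero, zero_mul]
      exact (Reduces.of_int 0).congr_left (by simp) |>.congr_right (by simp)
  choose! c hc using hterm
  refine ⟨∑ k ∈ range (ℓ + 2), c k, ?_⟩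
  have hmem : C (ℓ.factorial : ℚ) * coeff (ℓ + 1) (crankMod A) ∈ modForms ℚ (ℓ + 1) := by
    exact_mod_cast C_mul_mem_modForms _ (isGraded_crankMod hA (ℓ + 1))
  refine Reduces.mem_modForms h5 hmem ?_
  rw [crankMod, mul_comm _ (gaussian _), coeff_mul,
    Finset.Nat.sum_antidiagonal_eq_sum_range_succ_mk, mul_sum]
  refine (Reduces.sum _ hc).congr_right ?_
  rw [sum_add_distrib, ← sum_mul, ← map_sum, sum_ite_eq' (range (ℓ + 2)) 0, if_pos (by simp)]
  ring

end CrankCongruence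

section EisensteinTwo

open PowerSeries

lemma euler_eq_pentagonalSeries : euler = pentagonalSeries ℚ := by
  ext n
  obtain ⟨s, hs⟩ := Filter.eventually_atTop.mp (coeff_prod_one_sub_X_pow_eventually_eq ℚ n)
  have h1 := hs (range (max n (s.sup id + 1))) ?_
  · rw [← h1, ← sub_eq_zero, ← map_sub]
    exact X_pow_dvd_iff.mp (euler_sub_qfac_dvd _) n (by omega)
  · intro i hi
    have := Finset.le_sup (f := id) hi
    simp only [id] at this
    exact mem_range.mpr (by omega)

/-- Euler's product with integral coefficients. -/
noncomputable def eulerInt : PowerSeries ℤ := pentagonalSeries ℤ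

lemma map_pentagonalSeries {R : Type*} [CommRing R] :
    PowerSeries.map (Int.castRingHom R) eulerInt = pentagonalSeries R := by
  ext n
  rw [coeff_map, eulerInt]
  by_cases h : n ∈ Set.range pentagonal
  · obtain ⟨k, rfl⟩ := h
    simp
  · rw [coeff_pentagonalSeries_eq_zero _ h, coeff_pentagonalSeries_eq_zero _ h, map_zero]

lemma reduces_euler {ℓ : ℕ} [Fact ℓ.Prime] : Reduces ℓ euler (pentagonalSeries (ZMod ℓ)) := by
  have := Reduces.of_int (ℓ := ℓ) eulerInt
  rwa [map_pentagonalSeries, map_pentagonalSeries, ← euler_eq_pentagonalSeries] at this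

/-- The operator `f ↦ f + 24 q f'`. -/
noncomputable def squareOp (R : Type*) [CommRing R] (f : PowerSeries R) : PowerSeries R :=
  f + 24 * theta R f

lemma coeff_squareOp_iterate {R : Type*} [CommRing R] (f : PowerSeries R) (m n : ℕ) :
    coeff n ((squareOp R)^[m] f) = (1 + 24 * n) ^ m * coeff n f := by
  induction m with
  | zero => simp
  | succ m ih =>
    rw [Function.iterate_succ_apply', squareOp, map_add, ← map_ofNat (C (R := R)), coeff_C_mul,
      coeff_theta, ih, pow_succ]
    ring

lemma one_add_mul_pentagonal (k : ℤ) : (1 + 24 * pentagonal k : ℤ) = (6 * k - 1) ^ 2 := by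
  linear_combination 12 * two_mul_natCast_pentagonal k

lemma squareOp_iterate_pentagonalSeries {ℓ : ℕ} [Fact ℓ.Prime] {n : ℕ} (hn : 2 * n = ℓ + 1) :
    (squareOp (ZMod ℓ))^[n] (pentagonalSeries (ZMod ℓ)) =
      squareOp (ZMod ℓ) (pentagonalSeries (ZMod ℓ)) := by
  ext i
  have h1 := coeff_squareOp_iterate (pentagonalSeries (ZMod ℓ)) 1 i
  rw [Function.iterate_one] at h1
  rw [h1, coeff_squareOp_iterate]
  by_cases h : i ∈ Set.range pentagonal
  · obtain ⟨k, rfl⟩ := h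
    have h2 := congrArg (Int.cast (R := ZMod ℓ)) (one_add_mul_pentagonal k)
    push_cast at h2
    rw [h2, ← pow_mul, hn, pow_succ, ZMod.pow_card, pow_one, sq]
  · rw [coeff_pentagonalSeries_eq_zero _ h, mul_zero, mul_zero]

/-- The series `v_m` with `(1 + 24 q d/dq)^m E = E v_m`, for `E` Euler's product. -/
noncomputable def eulerQuot (R : Type*) [CommRing R] : ℕ → PowerSeries R
  | 0 => 1
  | m + 1 => e2 R * eulerQuot R m + 24 * theta R (eulerQuot R m)

lemma squareOp_iterate_eq {R : Type*} [CommRing R] {f : PowerSeries R}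
    (hf : 24 * theta R f = f * (e2 R - 1)) (m : ℕ) :
    (squareOp R)^[m] f = f * eulerQuot R m := by
  induction m with
  | zero => simp [eulerQuot]
  | succ m ih =>
    rw [Function.iterate_succ_apply', ih, squareOp, theta_mul, eulerQuot]
    linear_combination eulerQuot R m * hf

/-- The modular part of `v_m`. -/
noncomputable def eulerMod (R : Type*) [CommRing R] : ℕ → PowerSeries R
  | 0 => 1
  | 1 => 0
  | m + 2 => 24 * theta R (eulerMod R (m + 1)) - C (4 * (m + 1) : R) * (e2 R * eulerMod R (m + 1)) -
      C ((2 * m + 2) * (2 * m + 1) : R) * (e4 R * eulerMod R m)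

lemma eulerMod_mem (R : Type*) [CommRing R] (m : ℕ) : eulerMod R m ∈ modForms R (2 * m) := by
  induction m using Nat.twoStepInduction with
  | zero => simpa [eulerMod] using one_mem_modForms
  | one => exact zero_mem _
  | more m ih1 ih2 =>
    have h1 := C_mul_mem_modForms 2 (serre_mem_modForms ih2)
    have h2 := C_mul_mem_modForms ((2 * m + 2) * (2 * m + 1) : R)
      (mul_mem_modForms e4_mem_modForms ih1 rfl)
    rw [show (2 * ((m + 1 : ℕ) : ℤ) + 2 : ℤ) = 2 * ((m + 2 : ℕ) : ℤ) by push_cast; ring] at h1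
    rw [show (4 + 2 * (m : ℤ)) = 2 * ((m + 2 : ℕ) : ℤ) by push_cast; ring] at h2
    rw [eulerMod]
    convert! sub_mem h1 h2 using 2
    rw [map_ofNat]
    simp only [map_mul, map_add, map_ofNat, map_natCast, map_one]
    push_cast
    ring

lemma theta_eulerMod (k : ℕ) : 24 * theta ℚ (eulerMod ℚ k) = eulerMod ℚ (k + 1) +
    4 * k * e2 ℚ * eulerMod ℚ k + 2 * k * (2 * k - 1) * e4 ℚ * eulerMod ℚ (k - 1) := by
  rcases k with _ | k
  · simp [eulerMod]
  · rw [eulerMod, Nat.add_sub_cancel]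
    simp only [map_mul, map_add, map_ofNat, map_natCast, map_one]
    push_cast
    ring

/-- The number of ways to choose `i` disjoint pairs from `2 i + 2 k` elements. -/
noncomputable def pairings (i k : ℕ) : ℚ :=
  (2 * i + 2 * k).factorial / ((2 * k).factorial * (2 ^ i * i.factorial))

lemma pairings_mul (i k : ℕ) :
    pairings (i + 1) k * (2 * (i + 1)) = pairings i (k + 1) * ((2 * k + 2) * (2 * k + 1)) := by
  rw [pairings, pairings, show 2 * (i + 1) + 2 * k = 2 * i + 2 * (k + 1) by ring,
    show 2 * (k + 1) = (2 * k + 1) + 1 by ring, Nat.factorial_succ (2 * k + 1),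
    Nat.factorial_succ (2 * k), Nat.factorial_succ i]
  push_cast
  field_simp
  ring

lemma pairings_zero (k : ℕ) : pairings 0 k = 1 := by
  rw [pairings]
  simp [Nat.factorial_ne_zero]

lemma pairings_succ_zero (i : ℕ) : pairings (i + 1) 0 = pairings i 0 * (2 * i + 1) := by
  rw [pairings, pairings, show 2 * (i + 1) + 2 * 0 = 2 * i + 1 + 1 by ring, Nat.factorial_succ,
    Nat.factorial_succ, Nat.factorial_succ i, mul_zero, add_zero]
  push_cast
  field_simp
  ring

lemma pairings_succ_succ (i k : ℕ) : pairings (i + 1) (k + 1) =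
    pairings (i + 1) k + pairings i (k + 1) * (2 * i + 4 * (k + 1) + 1) := by
  rw [pairings, pairings, pairings, show 2 * (i + 1) + 2 * (k + 1) = 2 * i + 2 * k + 3 + 1 by ring,
    show 2 * (i + 1) + 2 * k = 2 * i + 2 * k + 1 + 1 by ring,
    show 2 * i + 2 * (k + 1) = 2 * i + 2 * k + 1 + 1 by ring,
    show 2 * (k + 1) = 2 * k + 1 + 1 by ring, Nat.factorial_succ (2 * i + 2 * k + 3),
    Nat.factorial_succ (2 * i + 2 * k + 2), Nat.factorial_succ (2 * k + 1),
    Nat.factorial_succ (2 * k), Nat.factorial_succ i]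
  push_cast
  field_simp
  ring

lemma eulerQuot_eq (m : ℕ) : eulerQuot ℚ m =
    ∑ p ∈ antidiagonal m, C (pairings p.1 p.2) * (e2 ℚ ^ p.1 * eulerMod ℚ p.2) := by
  induction m with
  | zero => simp [eulerQuot, eulerMod, pairings_zero]
  | succ m ih =>
    have hθ : ∀ p : ℕ × ℕ, e2 ℚ * (C (pairings p.1 p.2) * (e2 ℚ ^ p.1 * eulerMod ℚ p.2)) +
        24 * theta ℚ (C (pairings p.1 p.2) * (e2 ℚ ^ p.1 * eulerMod ℚ p.2)) =
        (C (pairings p.1 p.2 * (2 * p.1 + 4 * p.2 + 1)) * (e2 ℚ ^ (p.1 + 1) * eulerMod ℚ p.2) +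
        C (pairings p.1 p.2) * (e2 ℚ ^ p.1 * eulerMod ℚ (p.2 + 1))) +
        (C (pairings p.1 p.2 * (2 * p.2 * (2 * p.2 - 1))) *
          (e4 ℚ * (e2 ℚ ^ p.1 * eulerMod ℚ (p.2 - 1))) -
        C (pairings p.1 p.2 * (2 * p.1)) * (e4 ℚ * (e2 ℚ ^ (p.1 - 1) * eulerMod ℚ p.2))) := by
      rintro ⟨i, k⟩
      have h2 : 12 * theta ℚ (e2 ℚ) = e2 ℚ ^ 2 - e4 ℚ := theta_e2 ℚ
      have hi : (i : PowerSeries ℚ) * e2 ℚ ^ (i - 1) * e2 ℚ = i * e2 ℚ ^ i := by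
        rcases i with _ | i
        · simp
        · rw [Nat.add_sub_cancel, pow_succ]; ring
      have h3 := theta_eulerMod k
      have hp := theta_pow (e2 ℚ) i
      rw [theta_C_mul, theta_mul, hp]
      simp only [map_mul, map_add, map_sub, map_ofNat, map_natCast, map_one]
      linear_combination C (pairings i k) * e2 ℚ ^ i * h3 +
        2 * C (pairings i k) * i * e2 ℚ ^ (i - 1) * eulerMod ℚ k * h2 +
        2 * C (pairings i k) * eulerMod ℚ k * e2 ℚ * hi
    have hzero : ∑ p ∈ antidiagonal m, (C (pairings p.1 p.2 * (2 * p.2 * (2 * p.2 - 1))) *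
        (e4 ℚ * (e2 ℚ ^ p.1 * eulerMod ℚ (p.2 - 1)))) = ∑ p ∈ antidiagonal m,
        C (pairings p.1 p.2 * (2 * p.1)) * (e4 ℚ * (e2 ℚ ^ (p.1 - 1) * eulerMod ℚ p.2)) := by
      rcases m with _ | m
      · simp
      · rw [Finset.Nat.sum_antidiagonal_succ', Finset.Nat.sum_antidiagonal_succ]
        simp only [Nat.cast_zero, mul_zero, zero_mul, map_zero, zero_add]
        refine sum_congr rfl fun p _ => ?_
        rw [Nat.add_sub_cancel, Nat.add_sub_cancel]
        congr 2
        push_cast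
        linear_combination -pairings_mul p.1 p.2
    let P : ℕ × ℕ → PowerSeries ℚ := fun p =>
      if p.2 = 0 then 0 else C (pairings p.1 (p.2 - 1)) * (e2 ℚ ^ p.1 * eulerMod ℚ p.2)
    let Q : ℕ × ℕ → PowerSeries ℚ := fun p => if p.1 = 0 then 0 else
      C (pairings (p.1 - 1) p.2 * (2 * (p.1 - 1 : ℕ) + 4 * p.2 + 1)) *
        (e2 ℚ ^ p.1 * eulerMod ℚ p.2)
    have hPQ : ∀ p ∈ antidiagonal (m + 1), C (pairings p.1 p.2) *
        (e2 ℚ ^ p.1 * eulerMod ℚ p.2) = P p + Q p := by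
      rintro ⟨i, k⟩ hp
      rw [HasAntidiagonal.mem_antidiagonal] at hp
      rcases i with _ | i <;> rcases k with _ | k
      · simp at hp
      · simp [P, Q, pairings_zero]
      · simp [P, Q, pairings_succ_zero]
      · simp only [P, Q, pairings_succ_succ, map_add, if_neg (Nat.succ_ne_zero _),
          Nat.add_sub_cancel]
        push_cast
        ring
    rw [eulerQuot, ih, map_sum, mul_sum, mul_sum, ← sum_add_distrib, sum_congr rfl fun p _ => hθ p,
      sum_add_distrib, sum_sub_distrib, hzero, sub_self, add_zero, sum_congr rfl hPQ,
      sum_add_distrib, sum_add_distrib, Finset.Nat.sum_antidiagonal_succ' (f := P),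
      Finset.Nat.sum_antidiagonal_succ (f := Q)]
    simp only [P, Q, if_true, zero_add, if_neg (Nat.succ_ne_zero _), Nat.add_sub_cancel]
    exact add_comm _ _

variable {ℓ : ℕ} [Fact ℓ.Prime]

lemma reduces_eulerMod (k : ℕ) : Reduces ℓ (eulerMod ℚ k) (eulerMod (ZMod ℓ) k) := by
  have h (R : Type) [CommRing R] (k : ℕ) :
      PowerSeries.map (Int.castRingHom R) (eulerMod ℤ k) = eulerMod R k := by
    induction k using Nat.twoStepInduction with
    | zero => simp [eulerMod]
    | one => simp [eulerMod]
    | more m ih1 ih2 =>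
      simp only [eulerMod, map_sub, map_mul, ← theta_map, map_e2, map_e4, ih1, ih2, map_ofNat,
        map_add, map_natCast, map_one]
  have := Reduces.of_int (ℓ := ℓ) (eulerMod ℤ k)
  rwa [h, h] at this

lemma reduces_eulerQuot (k : ℕ) : Reduces ℓ (eulerQuot ℚ k) (eulerQuot (ZMod ℓ) k) := by
  induction k with
  | zero => exact ⟨1, map_one _, map_one _⟩
  | succ k ih =>
    exact (Reduces.e2.mul ih).add (Reduces.mul ⟨24, map_ofNat _ _, map_ofNat _ _⟩ ih.theta)

lemma theta_pentagonalSeries : 24 * theta (ZMod ℓ) (pentagonalSeries (ZMod ℓ)) =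
    pentagonalSeries (ZMod ℓ) * (e2 (ZMod ℓ) - 1) := by
  have h1 : Reduces ℓ (24 * theta ℚ euler) _ :=
    Reduces.mul ⟨24, map_ofNat _ _, map_ofNat _ _⟩ reduces_euler.theta
  have h2 : Reduces ℓ (euler * (e2 ℚ - 1)) _ :=
    reduces_euler.mul (Reduces.e2.sub ⟨1, map_one _, map_one _⟩)
  rw [e2_rat, ← theta_euler] at h2
  exact h1.unique h2

lemma pentagonalSeries_ne_zero : pentagonalSeries (ZMod ℓ) ≠ 0 := fun h => by
  have := congrArg (coeff (pentagonal 0)) h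
  simp at this

/-- Modulo `ℓ`, the Eisenstein series of weight two is modular of weight `ℓ + 1`. -/
lemma e2_mem_modForms (h5 : 5 ≤ ℓ) : e2 (ZMod ℓ) ∈ modForms (ZMod ℓ) (ℓ + 1) := by
  obtain ⟨n, hn⟩ : ∃ n, 2 * n = ℓ + 1 := by
    obtain ⟨m, hm⟩ := (Fact.out : ℓ.Prime).odd_of_ne_two (by omega)
    exact ⟨m + 1, by omega⟩
  have h1 : eulerQuot (ZMod ℓ) n = e2 (ZMod ℓ) := by
    have h := squareOp_iterate_pentagonalSeries hn
    rw [squareOp_iterate_eq theta_pentagonalSeries, squareOp] at h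
    apply mul_left_cancel₀ pentagonalSeries_ne_zero
    rw [h]
    linear_combination theta_pentagonalSeries (ℓ := ℓ)
  have h2 : Reduces ℓ (eulerQuot ℚ n) (eulerMod (ZMod ℓ) n) := by
    rw [eulerQuot_eq]
    have : eulerMod (ZMod ℓ) n =
        ∑ p ∈ antidiagonal n, if p = (0, n) then eulerMod (ZMod ℓ) n else 0 := by
      rw [sum_ite_eq', if_pos (by simp)]
    rw [this]
    refine Reduces.sum _ ?_
    rintro ⟨i, k⟩ hp
    rw [HasAntidiagonal.mem_antidiagonal] at hp
    simp only at hp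
    rcases Nat.eq_zero_or_pos i with rfl | hi
    · rw [zero_add] at hp
      subst hp
      rw [if_pos rfl, pairings_zero, map_one, one_mul, pow_zero, one_mul]
      exact reduces_eulerMod k
    · rw [if_neg (by simp; omega)]
      have hne := natCast_ne_zero_of_factors (i := i) (j := 2 * k) h5 (by omega) (by omega)
      have hx := ((ReducesNum.natCast (ℓ + 1)).mul (ReducesNum.inv_natCast hne)).factorial_mul
      have h3 := hx.C_mul ((Reduces.e2.pow i).mul (reduces_eulerMod k))
      rw [map_zero, zero_mul] at h3
      refine h3.congr_left ?_
      congr 2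
      rw [pairings, show 2 * i + 2 * k = ℓ + 1 by omega, Nat.factorial_succ]
      push_cast
      field_simp
  rw [← (reduces_eulerQuot n).unique h2 |>.symm.trans h1]
  have := eulerMod_mem (ZMod ℓ) n
  rwa [show (2 * (n : ℤ)) = ℓ + 1 by exact_mod_cast hn] at this

end EisensteinTwo

section SptIdentity

open PowerSeries

/-- The series `1 / (1 - q ^ d)`. -/
noncomputable def geomSeries (d : ℕ) : PowerSeries ℚ := 1 + lambert d

lemma one_sub_X_pow_mul_geomSeries {d : ℕ} (hd : d ≠ 0) : (1 - X ^ d) * geomSeries d = 1 := by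
  rw [geomSeries]
  linear_combination one_sub_X_pow_mul_lambert hd

lemma natCast_mul_geomSeries_sq {d : ℕ} (hd : d ≠ 0) :
    (d : PowerSeries ℚ) * (X ^ d * geomSeries d ^ 2) = theta ℚ (lambert d) := by
  have h := congrArg (theta ℚ) (one_sub_X_pow_mul_geomSeries hd)
  rw [theta_mul, map_sub, Derivation.map_one_eq_zero, theta_X_pow, geomSeries, map_add,
    Derivation.map_one_eq_zero, ← geomSeries] at h
  linear_combination -geomSeries d * h +
    theta ℚ (lambert d) * one_sub_X_pow_mul_geomSeries hd

lemma coeff_geomSeries_sq {d : ℕ} (hd : d ≠ 0) (n : ℕ) :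
    coeff n (X ^ d * geomSeries d ^ 2) = if d ∣ n then (n / d : ℚ) else 0 := by
  have h := congrArg (coeff n) (natCast_mul_geomSeries_sq hd)
  have hd' : (d : ℚ) ≠ 0 := by exact_mod_cast hd
  rw [← map_natCast (C (R := ℚ)), coeff_C_mul, coeff_theta, lambert, coeff_mk] at h
  apply mul_left_cancel₀ hd'
  rw [h]
  by_cases hn : n = 0
  · simp [hn]
  · by_cases h' : d ∣ n
    · simp only [h', hn, ne_eq, not_false_eq_true, and_self, if_true]
      field_simp
    · simp [h']

lemma sum_geomSeries_sq_dvd (n : ℕ) : X ^ (n + 1) ∣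
    24 * ∑ i ∈ range n, X ^ (i + 1) * geomSeries (i + 1) ^ 2 - (1 - eis2) := by
  rw [X_pow_dvd_iff]
  intro m hm
  rw [map_sub, map_sub, ← map_ofNat (C (R := ℚ)), coeff_C_mul, map_sum, sub_eq_zero]
  rcases Nat.eq_zero_or_pos m with rfl | hm0
  · simp [eis2]
  · have : ∑ i ∈ range n, coeff m (X ^ (i + 1) * geomSeries (i + 1) ^ 2) =
        (ArithmeticFunction.sigma 1 m : ℚ) := by
      have hd : m.divisors = (Finset.Ioc 0 n).filter (· ∣ m) := by
        ext d
        simp only [Nat.mem_divisors, mem_filter, mem_Ioc]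
        constructor
        · rintro ⟨h1, h2⟩
          have := Nat.le_of_dvd hm0 h1
          exact ⟨⟨Nat.pos_of_dvd_of_pos h1 hm0, by omega⟩, h1⟩
        · rintro ⟨_, h1⟩
          exact ⟨h1, hm0.ne'⟩
      rw [ArithmeticFunction.sigma_one_apply, ← Nat.sum_div_divisors m (fun d => d), Nat.cast_sum,
        hd, Finset.sum_filter, Finset.range_eq_Ico,
        Finset.sum_Ico_add' (fun d => coeff m (X ^ d * geomSeries d ^ 2)) 0 n 1]
      refine Finset.sum_congr (by ext; simp; omega) (fun d hd' => ?_)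
      have hd0 : d ≠ 0 := by have := mem_Ioc.mp hd'; omega
      rw [coeff_geomSeries_sq hd0]
      split_ifs with h
      · rw [Nat.cast_div h (by exact_mod_cast hd0)]
      · rfl
    rw [this]
    simp [eis2, hm0.ne', coeff_one]

/-- The series `1 / (q; q)_{n-r}`, which is zero for `n < r`. -/
noncomputable def qfacInvSub (n r : ℕ) : PowerSeries ℚ := if r ≤ n then (qfac (n - r))⁻¹ else 0

lemma qfacInvSub_succ {n r d : ℕ} (h : n = r + d) :
    qfacInvSub n (r + 1) = (1 - X ^ d) * qfacInvSub n r := by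
  subst h
  rcases d with _ | d
  · simp [qfacInvSub]
  · rw [qfacInvSub, qfacInvSub, if_pos (by omega), if_pos (by omega),
      show r + (d + 1) - (r + 1) = d by omega, show r + (d + 1) - r = d + 1 by omega, qfac_inv_eq]

lemma qfacInvSub_succ_succ (n r : ℕ) : qfacInvSub (n + 1) (r + 1) = qfacInvSub n r := by
  simp [qfacInvSub]

/-- The terms in the finite expansion of `1 / (q; q)_n`. -/
noncomputable def expTerm (n r : ℕ) : PowerSeries ℚ :=
  (-1) ^ r * X ^ (3 * r.choose 2 + r) * (1 + X ^ r) * (qfacInvSub n r * (qfac (n + r))⁻¹)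

lemma choose_two_succ (r : ℕ) : (r + 1).choose 2 = r.choose 2 + r := by
  rw [Nat.choose_succ_succ' r 1, Nat.choose_one_right, add_comm]

lemma expTerm_telescope (n r : ℕ) :
    (1 - X ^ (n + 1)) * expTerm (n + 1) (r + 1) - expTerm n (r + 1) = X ^ (n + 1) *
      ((-1) ^ (r + 1) * X ^ (3 * (r + 2).choose 2) *
        (qfacInvSub n (r + 1) * (qfac (n + 1 + (r + 1)))⁻¹) -
      (-1) ^ r * X ^ (3 * (r + 1).choose 2) * (qfacInvSub n r * (qfac (n + 1 + r))⁻¹)) := by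
  by_cases h : r ≤ n
  · obtain ⟨d, rfl⟩ := Nat.exists_eq_add_of_le h
    have h1 : qfacInvSub (r + d) (r + 1) = _ := qfacInvSub_succ rfl
    have h2 := qfac_inv_eq (r + d + 1 + r)
    rw [expTerm, expTerm, qfacInvSub_succ_succ, h1, show r + d + (r + 1) = r + d + 1 + r by ring,
        h2,
      show r + d + 1 + (r + 1) = r + d + 1 + r + 1 by ring, choose_two_succ (r + 1)]
    ring
  · have h1 : ∀ m s, m < s → qfacInvSub m s = 0 := fun m s h => if_neg (by omega)
    simp [expTerm, h1 n r (by omega), h1 n (r + 1) (by omega), h1 (n + 1) (r + 1) (by omega)]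

/-- A finite form of the partial fraction expansion of the rank-crank type. -/
lemma qfac_inv_expansion (n : ℕ) :
    (qfac n)⁻¹ ^ 2 + ∑ r ∈ range n, expTerm n (r + 1) = (qfac n)⁻¹ := by
  induction n with
  | zero => simp [qfac_zero]
  | succ n ih =>
    have h0 : (1 - X ^ (n + 1) : PowerSeries ℚ) ≠ 0 := by
      intro h
      simpa using congrArg constantCoeff h
    apply mul_left_cancel₀ h0
    rw [← qfac_inv_eq, ← ih, mul_add]
    have h1 : expTerm n (n + 1) = 0 := by simp [expTerm, qfacInvSub]
    have h2 : ∑ r ∈ range n, expTerm n (r + 1) = ∑ r ∈ range (n + 1), expTerm n (r + 1) := by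
      rw [sum_range_succ, h1, add_zero]
    have h3 := sum_congr rfl fun r (_ : r ∈ range (n + 1)) => expTerm_telescope n r
    rw [sum_sub_distrib, ← mul_sum, ← mul_sum, sum_range_sub (fun r => (-1) ^ r * X ^ (3 * (r +
        1).choose 2) *
      (qfacInvSub n r * (qfac (n + 1 + r))⁻¹))] at h3
    have h4 : qfacInvSub n (n + 1) = 0 := by simp [qfacInvSub]
    have h5 : qfacInvSub n 0 = (qfac n)⁻¹ := by simp [qfacInvSub]
    rw [h4, h5] at h3
    simp only [pow_zero, zero_add, Nat.choose_succ_self, mul_zero, zero_mul, add_zero, one_mul,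
        zero_sub] at h3
    rw [h2]
    have h6 := qfac_inv_eq n
    linear_combination h3 - ((qfac n)⁻¹ + (qfac (n + 1))⁻¹) * h6

/-- The partial sums of a telescoping `q`-series. -/
lemma sum_telescope (N r : ℕ) : (1 - X ^ (r + 1)) ^ 2 * ∑ n ∈ range N, X ^ (n + 1) * (qfac n ^ 2 *
    (qfacInvSub (n + 1) (r + 1) * (qfac (n + 1 + (r + 1)))⁻¹)) =
      X ^ (r + 1) * (qfac N ^ 2 * (qfacInvSub N (r + 1) * (qfac (N + (r + 1)))⁻¹)) := by
  induction N with
  | zero => simp [qfacInvSub]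
  | succ N ih =>
    rw [sum_range_succ, mul_add, ih]
    by_cases h : r ≤ N
    · obtain ⟨d, rfl⟩ := Nat.exists_eq_add_of_le h
      have h1 : qfacInvSub (r + d) (r + 1) = _ := qfacInvSub_succ rfl
      have h2 := qfac_inv_eq (r + d + (r + 1))
      rw [qfacInvSub_succ_succ, h1, h2, qfac_succ (r + d),
        show r + d + 1 + (r + 1) = r + d + (r + 1) + 1 by ring]
      generalize (qfac (r + d + (r + 1) + 1))⁻¹ = I
      ring
    · have h1 : ∀ m s, m < s → qfacInvSub m s = 0 := fun m s h => if_neg (by omega)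
      simp [h1 N (r + 1) (by omega), h1 (N + 1) (r + 1) (by omega)]

lemma sum_telescope_dvd (N r : ℕ) : X ^ (N + 1) ∣ ∑ n ∈ range N, X ^ (n + 1) * (qfac n ^ 2 *
    (qfacInvSub (n + 1) (r + 1) * (qfac (n + 1 + (r + 1)))⁻¹)) -
      X ^ (r + 1) * geomSeries (r + 1) ^ 2 := by
  have h := sum_telescope N r
  have hg : (1 - X ^ (r + 1)) * geomSeries (r + 1) = 1 :=
      one_sub_X_pow_mul_geomSeries r.succ_ne_zero
  suffices h' : X ^ (N + 1) ∣ X ^ (r + 1) * (qfac N ^ 2 *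
      (qfacInvSub N (r + 1) * (qfac (N + (r + 1)))⁻¹)) - X ^ (r + 1) by
    obtain ⟨c, hc⟩ := h'
    refine ⟨geomSeries (r + 1) ^ 2 * c, ?_⟩
    rw [← h] at hc
    set S := ∑ n ∈ range N, X ^ (n + 1) * (qfac n ^ 2 *
      (qfacInvSub (n + 1) (r + 1) * (qfac (n + 1 + (r + 1)))⁻¹))
    linear_combination geomSeries (r + 1) ^ 2 * hc -
      S * ((1 - X ^ (r + 1)) * geomSeries (r + 1) + 1) * hg
  by_cases hr : r + 1 ≤ N
  · obtain ⟨d, rfl⟩ := Nat.exists_eq_add_of_le hr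
    rw [qfacInvSub, if_pos hr, Nat.add_sub_cancel_left]
    have h1 := euler_sub_qfac_dvd d
    have h2 := (pow_dvd_pow X (by omega)).trans (euler_sub_qfac_dvd (r + 1 + d))
      (a := X ^ (d + 1))
    have h3 := (pow_dvd_pow X (by omega)).trans (euler_sub_qfac_dvd (r + 1 + d + (r + 1)))
      (a := X ^ (d + 1))
    obtain ⟨a, ha⟩ := h1
    obtain ⟨b, hb⟩ := h2
    obtain ⟨c, hc⟩ := h3
    have hi1 := qfac_mul_inv d
    have hi2 := qfac_mul_inv (r + 1 + d + (r + 1))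
    set u := qfac d
    set v := qfac (r + 1 + d)
    set w := qfac (r + 1 + d + (r + 1))
    refine ⟨u⁻¹ * w⁻¹ * (u * (c - b) + v * (a - b)), ?_⟩
    rw [show r + 1 + d + 1 = (r + 1) + (d + 1) by ring, pow_add]
    linear_combination X ^ (r + 1) * u⁻¹ * w⁻¹ * (u * (hc - hb) + v * (ha - hb)) +
      X ^ (r + 1) * w * w⁻¹ * hi1 + X ^ (r + 1) * hi2
  · rw [qfacInvSub, if_neg hr]
    simp only [zero_mul, mul_zero, zero_sub]
    exact (pow_dvd_pow X (by omega)).neg_right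

lemma sum_odd_mul_pow {R : Type*} [CommRing R] (x : R) (n : ℕ) : (1 - x) ^ 2 *
    ∑ i ∈ range n, (2 * i + 1 : R) * x ^ i =
      1 + x - (2 * n + 1) * x ^ n + (2 * n - 1) * x ^ (n + 1) := by
  induction n with
  | zero => simp
  | succ n ih =>
    rw [sum_range_succ, mul_add, ih]
    push_cast
    ring

lemma thetaMoment_sub_dvd (N : ℕ) : X ^ N ∣ thetaMoment ℚ 1 - ∑ r ∈ range N,
    (-1) ^ (r + 1) * X ^ (3 * (r + 1).choose 2 + (r + 1)) * (1 + X ^ (r + 1)) *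
      (X ^ (r + 1) * geomSeries (r + 1) ^ 2) := by
  have h1 := diagEval_sub_sum_dvd (PowerSeries.mk fun i => C ((2 * i + 1 : ℚ) ^ 1) *
    -(X ^ 2 * diagEval (PowerSeries.mk fun r => (-1) ^ r * X ^ (3 * r.choose 2 + (i + 4) * r)))) N
  have h2 : ∀ i : ℕ, X ^ N ∣ diagEval (PowerSeries.mk fun r =>
      (-1 : PowerSeries ℚ) ^ r * X ^ (3 * r.choose 2 + (i + 4) * r)) -
      ∑ r ∈ range N, X ^ r * ((-1) ^ r * X ^ (3 * r.choose 2 + (i + 4) * r)) := by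
    intro i
    simpa only [coeff_mk] using diagEval_sub_sum_dvd (PowerSeries.mk fun r =>
      (-1 : PowerSeries ℚ) ^ r * X ^ (3 * r.choose 2 + (i + 4) * r)) N
  have h3 : X ^ N ∣ ∑ i ∈ range N, X ^ i * (C ((2 * i + 1 : ℚ) ^ 1) *
      -(X ^ 2 * diagEval (PowerSeries.mk fun r =>
        (-1) ^ r * X ^ (3 * r.choose 2 + (i + 4) * r)))) -
      ∑ i ∈ range N, X ^ i * (C ((2 * i + 1 : ℚ) ^ 1) *
      -(X ^ 2 * ∑ r ∈ range N, X ^ r * ((-1) ^ r * X ^ (3 * r.choose 2 + (i + 4) * r)))) := by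
    rw [← sum_sub_distrib]
    refine dvd_sum fun i _ => ?_
    obtain ⟨c, hc⟩ := h2 i
    refine ⟨-(X ^ i * C ((2 * i + 1 : ℚ) ^ 1) * X ^ 2) * c, ?_⟩
    linear_combination -(X ^ i * C ((2 * i + 1 : ℚ) ^ 1) * X ^ 2) * hc
  have h4 : ∑ i ∈ range N, X ^ i * (C ((2 * i + 1 : ℚ) ^ 1) *
      -(X ^ 2 * ∑ r ∈ range N, X ^ r * ((-1) ^ r * X ^ (3 * r.choose 2 + (i + 4) * r)))) =
      ∑ r ∈ range N, (-1) ^ (r + 1) * X ^ (3 * (r + 1).choose 2 + 2 * (r + 1)) *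
        ∑ i ∈ range N, (2 * (i : PowerSeries ℚ) + 1) * (X ^ (r + 1)) ^ i := by
    simp only [mul_sum, ← sum_neg_distrib]
    rw [sum_comm]
    refine sum_congr rfl fun r _ => sum_congr rfl fun i _ => ?_
    rw [choose_two_succ]
    simp only [map_mul, map_add, map_ofNat, map_natCast, map_one, pow_one]
    ring
  have h5 : X ^ N ∣ ∑ r ∈ range N, (-1) ^ (r + 1) * X ^ (3 * (r + 1).choose 2 + 2 * (r + 1)) *
        ∑ i ∈ range N, (2 * (i : PowerSeries ℚ) + 1) * (X ^ (r + 1)) ^ i -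
      ∑ r ∈ range N, (-1) ^ (r + 1) * X ^ (3 * (r + 1).choose 2 + (r + 1)) * (1 + X ^ (r + 1)) *
      (X ^ (r + 1) * geomSeries (r + 1) ^ 2) := by
    rw [← sum_sub_distrib]
    refine dvd_sum fun r _ => ?_
    have hg : (1 - X ^ (r + 1)) * geomSeries (r + 1) = 1 :=
      one_sub_X_pow_mul_geomSeries r.succ_ne_zero
    have hs := sum_odd_mul_pow (X ^ (r + 1) : PowerSeries ℚ) N
    set S := ∑ i ∈ range N, (2 * (i : PowerSeries ℚ) + 1) * (X ^ (r + 1)) ^ i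
    have hx : S - (1 + X ^ (r + 1)) * geomSeries (r + 1) ^ 2 = geomSeries (r + 1) ^ 2 *
        (-(2 * (N : PowerSeries ℚ) + 1) + (2 * (N : PowerSeries ℚ) - 1) * X ^ (r + 1)) *
            (X ^ r) ^ N * X ^ N := by
      have e1 : (X ^ (r + 1) : PowerSeries ℚ) ^ N = (X ^ r) ^ N * X ^ N := by
        rw [pow_succ, mul_pow]
      rw [pow_succ _ N, e1] at hs
      linear_combination geomSeries (r + 1) ^ 2 * hs -
        S * ((1 - X ^ (r + 1)) * geomSeries (r + 1) + 1) * hg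
    refine ⟨(-1) ^ (r + 1) * X ^ (3 * (r + 1).choose 2 + 2 * (r + 1)) * (geomSeries (r + 1) ^ 2 *
        (-(2 * (N : PowerSeries ℚ) + 1) + (2 * (N : PowerSeries ℚ) - 1) * X ^ (r + 1)) *
            (X ^ r) ^ N), ?_⟩
    linear_combination (-1) ^ (r + 1) * X ^ (3 * (r + 1).choose 2 + 2 * (r + 1)) * hx
  have h6 := (h1.add (h4 ▸ h3)).add h5
  simp only [coeff_mk] at h6
  rw [thetaMoment]
  convert! h6 using 1
  ring

/-- The identity behind the generating function for `spt`. -/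
lemma sum_spt_dvd (N : ℕ) : X ^ N ∣ 24 * ∑ n ∈ range N, X ^ (n + 1) *
    (qfac n ^ 2 * (qfac (n + 1))⁻¹) - (1 - eis2 + 24 * thetaMoment ℚ 1) := by
  have h1 : ∀ n ∈ range N, X ^ (n + 1) * (qfac n ^ 2 * (qfac (n + 1))⁻¹) =
      X ^ (n + 1) * geomSeries (n + 1) ^ 2 + ∑ r ∈ range N,
        (-1) ^ (r + 1) * X ^ (3 * (r + 1).choose 2 + (r + 1)) * (1 + X ^ (r + 1)) *
        (X ^ (n + 1) * (qfac n ^ 2 *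
          (qfacInvSub (n + 1) (r + 1) * (qfac (n + 1 + (r + 1)))⁻¹))) := by
    intro n hn
    have e1 : ∑ r ∈ range (n + 1), expTerm (n + 1) (r + 1) =
        ∑ r ∈ range N, expTerm (n + 1) (r + 1) := by
      refine sum_subset (range_subset_range.mpr (by have := mem_range.mp hn; omega)) ?_
      intro r _ hr
      rw [mem_range] at hr
      rw [expTerm, qfacInvSub, if_neg (by omega)]
      ring
    have e2 := qfac_inv_expansion (n + 1)
    have e3 : qfac n * (qfac (n + 1))⁻¹ = geomSeries (n + 1) := by
      have h2 := qfac_mul_inv (n + 1)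
      have h3 : (1 - X ^ (n + 1)) * geomSeries (n + 1) = 1 :=
        one_sub_X_pow_mul_geomSeries n.succ_ne_zero
      have h4 := qfac_succ n
      generalize (qfac (n + 1))⁻¹ = I at h2 ⊢
      rw [h4] at h2
      linear_combination geomSeries (n + 1) * h2 - qfac n * I * h3
    rw [e1] at e2
    rw [← e3]
    generalize hI : (qfac (n + 1))⁻¹ = I at e2 ⊢
    conv_lhs => rw [← e2]
    simp only [mul_add, mul_sum, expTerm]
    congr 1
    · ring
    · refine sum_congr rfl fun r _ => ?_
      ring
  rw [sum_congr rfl h1, sum_add_distrib, sum_comm]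
  simp only [← mul_sum]
  obtain ⟨a, ha⟩ := sum_geomSeries_sq_dvd N
  obtain ⟨b, hb⟩ := thetaMoment_sub_dvd N
  have h2 : X ^ N ∣ ∑ r ∈ range N, (-1) ^ (r + 1) * X ^ (3 * (r + 1).choose 2 + (r + 1)) *
      (1 + X ^ (r + 1)) * ∑ n ∈ range N, (X ^ (n + 1) * (qfac n ^ 2 *
          (qfacInvSub (n + 1) (r + 1) * (qfac (n + 1 + (r + 1)))⁻¹))) -
      ∑ r ∈ range N, (-1) ^ (r + 1) * X ^ (3 * (r + 1).choose 2 + (r + 1)) * (1 + X ^ (r + 1)) *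
      (X ^ (r + 1) * geomSeries (r + 1) ^ 2) := by
    rw [← sum_sub_distrib]
    refine dvd_sum fun r _ => ?_
    rw [← mul_sub]
    exact ((pow_dvd_pow X (Nat.le_succ N)).trans (sum_telescope_dvd N r)).mul_left _
  obtain ⟨c, hc⟩ := h2
  exact ⟨X * a + 24 * c - 24 * b, by linear_combination ha + 24 * hc - 24 * hb⟩

end SptIdentity

section SptGeneratingFunction

open PowerSeries

/-- The generating function of a statistic on partitions. -/
noncomputable def partSeries (f : Multiset ℕ → ℚ) : PowerSeries ℚ :=
  PowerSeries.mk fun n => ∑ p : n.Partition, f p.parts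

lemma partSeries_sub (f g : Multiset ℕ → ℚ) :
    partSeries (fun s => f s - g s) = partSeries f - partSeries g := by
  ext n
  simp [partSeries]

lemma partSeries_add (f g : Multiset ℕ → ℚ) :
    partSeries (fun s => f s + g s) = partSeries f + partSeries g := by
  ext n
  simp [partSeries, sum_add_distrib]

lemma partSeries_eq_X_pow_mul {a : ℕ} (ha : 1 ≤ a) {f : Multiset ℕ → ℚ}
    (hf : ∀ s, a ∉ s → f s = 0) : partSeries f = X ^ a * partSeries fun s => f (a ::ₘ s) := by
  ext n
  rw [coeff_X_pow_mul', partSeries, coeff_mk]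
  split_ifs with h
  · rw [partSeries, coeff_mk, ← sum_filter_of_ne (p := fun p : n.Partition => a ∈ p.parts)
      fun p _ hp => by_contra fun h' => hp (hf _ h'),
      sum_subtype _ (p := fun p : n.Partition => a ∈ p.parts) (fun p => by simp)]
    refine Fintype.sum_equiv (Nat.Partition.partitionWithPartEquiv ha h) _ _ fun p => ?_
    rw [Nat.Partition.partitionWithPartEquiv_apply_parts, Multiset.cons_erase p.2]
  · refine sum_eq_zero fun p _ => hf _ fun hp => h (Nat.Partition.le_of_mem_parts hp)

/-- The indicator function of multisets whose elements are all at least `j`. -/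
def minInd (j : ℕ) (s : Multiset ℕ) : ℚ := if ∀ i ∈ s, j ≤ i then 1 else 0

/-- The multiplicity of `j` in multisets whose elements are all at least `j`. -/
def minCount (j : ℕ) (s : Multiset ℕ) : ℚ := if ∀ i ∈ s, j ≤ i then s.count j else 0

lemma partSeries_minInd_succ {j : ℕ} (hj : 1 ≤ j) :
    partSeries (minInd (j + 1)) = (1 - X ^ j) * partSeries (minInd j) := by
  have h : partSeries (fun s => minInd j s - minInd (j + 1) s) = X ^ j * partSeries (minInd j) := by
    rw [partSeries_eq_X_pow_mul hj]
    · congr 2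
      funext s
      have : ¬ ∀ i ∈ j ::ₘ s, j + 1 ≤ i := fun h => by
        have := h j (Multiset.mem_cons_self j s)
        omega
      rw [minInd, minInd, if_neg this, minInd]
      simp
    · intro s hs
      have : (∀ i ∈ s, j ≤ i) ↔ ∀ i ∈ s, j + 1 ≤ i :=
        forall₂_congr fun i hi => ⟨fun h => lt_of_le_of_ne h fun h' => hs (h' ▸ hi),
            fun h => by omega⟩
      rw [minInd, minInd, if_congr this rfl rfl, sub_self]
  rw [partSeries_sub] at h
  linear_combination -h

lemma partSeries_minCount {j : ℕ} (hj : 1 ≤ j) :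
    (1 - X ^ j) * partSeries (minCount j) = X ^ j * partSeries (minInd j) := by
  have h : partSeries (minCount j) = X ^ j * partSeries (fun s => minCount j s + minInd j s) := by
    rw [partSeries_eq_X_pow_mul hj]
    · congr 2
      funext s
      simp only [minCount, minInd, Multiset.forall_mem_cons, le_refl, true_and,
        Multiset.count_cons_self]
      split_ifs <;> simp
    · intro s hs
      simp [minCount, Multiset.count_eq_zero_of_notMem hs]
  rw [partSeries_add] at h
  linear_combination h

lemma partSeries_minInd (n : ℕ) : partSeries (minInd (n + 1)) = qfac n * partSeries (minInd 1) := by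
  induction n with
  | zero => simp [qfac_zero]
  | succ n ih => rw [partSeries_minInd_succ (by omega), ih, qfac_succ]; ring

lemma partSeries_minInd_sub_one_dvd (n : ℕ) : X ^ (n + 1) ∣ partSeries (minInd (n + 1)) - 1 := by
  rw [X_pow_dvd_iff]
  intro m hm
  rw [map_sub, coeff_one, partSeries, coeff_mk, sub_eq_zero]
  split_ifs with h
  · subst h
    simp [minInd]
  · refine sum_eq_zero fun p _ => if_neg fun hp => ?_
    have : p.parts ≠ 0 := fun h' => h (by simpa [h'] using p.parts_sum.symm)
    obtain ⟨i, hi⟩ := Multiset.exists_mem_of_ne_zero this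
    have := hp i hi
    have := Nat.Partition.le_of_mem_parts hi
    omega

lemma partSeries_minInd_one : partSeries (minInd 1) = partGen := by
  have h : partSeries (minInd 1) * euler - 1 = 0 := by
    refine eq_zero_of_forall_X_pow_dvd fun n => (pow_dvd_pow X n.le_succ).trans ?_
    have h1 := (euler_sub_qfac_dvd n).mul_left (partSeries (minInd 1))
    have h2 := partSeries_minInd_sub_one_dvd n
    rw [partSeries_minInd] at h2
    convert! h1.add h2 using 1
    ring
  linear_combination partGen * h - partSeries (minInd 1) * partGen_mul_euler

lemma coeff_partGen (n : ℕ) : coeff n partGen = Fintype.card n.Partition := by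
  have : ∀ p : n.Partition, minInd 1 p.parts = 1 := fun p => if_pos fun i hi => p.parts_pos hi
  rw [← partSeries_minInd_one, partSeries, coeff_mk, sum_congr rfl fun p _ => this p]
  simp

lemma spt_eq {n N : ℕ} (h : n ≤ N) :
    (spt n : ℚ) = ∑ j ∈ range N, ∑ p : n.Partition, minCount (j + 1) p.parts := by
  rw [sum_comm, spt, Nat.cast_sum]
  refine sum_congr rfl fun p _ => ?_
  rw [← Multiset.sum_count_eq_card (s := Finset.Ico 1 (N + 1)), Finset.range_eq_Ico,
    Finset.sum_Ico_add' (fun j => minCount j p.parts) 0 N 1, Nat.cast_sum]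
  · refine sum_congr (by simp) fun j _ => ?_
    rw [Multiset.count_filter, minCount, Nat.cast_ite, Nat.cast_zero]
  · intro a ha
    have ha' := Multiset.mem_of_mem_filter ha
    have := p.parts_pos ha'
    have := Nat.Partition.le_of_mem_parts ha'
    rw [mem_Ico]
    omega

lemma qfac_mul_inv_succ (n : ℕ) : qfac n * (qfac (n + 1))⁻¹ = geomSeries (n + 1) := by
  have h2 := qfac_mul_inv (n + 1)
  have h3 : (1 - X ^ (n + 1)) * geomSeries (n + 1) = 1 :=
    one_sub_X_pow_mul_geomSeries n.succ_ne_zero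
  have h4 := qfac_succ n
  generalize (qfac (n + 1))⁻¹ = I at h2 ⊢
  rw [h4] at h2
  linear_combination geomSeries (n + 1) * h2 - qfac n * I * h3

/-- The generating function of `spt`. -/
theorem euler_mul_spt : 24 * (euler * PowerSeries.mk fun n => (spt n : ℚ)) =
    1 - eis2 + 24 * thetaMoment ℚ 1 := by
  rw [← sub_eq_zero]
  refine eq_zero_of_forall_X_pow_dvd fun N => ?_
  have h1 : X ^ N ∣ (PowerSeries.mk fun n => (spt n : ℚ)) -
      ∑ j ∈ range N, partSeries (minCount (j + 1)) := by
    rw [X_pow_dvd_iff]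
    intro m hm
    rw [map_sub, map_sum, coeff_mk, spt_eq hm.le, sub_eq_zero]
    simp only [partSeries, coeff_mk]
  have h2 : ∀ j ∈ range N, euler * partSeries (minCount (j + 1)) =
      X ^ (j + 1) * (qfac j ^ 2 * (qfac (j + 1))⁻¹) := by
    intro j _
    have h3 := partSeries_minCount (j := j + 1) (by omega)
    have h4 := qfac_mul_inv_succ j
    have h5 : (1 - X ^ (j + 1)) * geomSeries (j + 1) = 1 :=
      one_sub_X_pow_mul_geomSeries j.succ_ne_zero
    rw [partSeries_minInd, partSeries_minInd_one] at h3
    generalize (qfac (j + 1))⁻¹ = I at h4 ⊢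
    linear_combination geomSeries (j + 1) * euler * h3 -
      euler * partSeries (minCount (j + 1)) * h5 +
      geomSeries (j + 1) * X ^ (j + 1) * qfac j * partGen_mul_euler - X ^ (j + 1) * qfac j * h4
  have h3 := sum_congr rfl h2
  rw [← mul_sum] at h3
  have h4 := (h1.mul_left (24 * euler)).add (h3 ▸ sum_spt_dvd N)
  convert! h4 using 1
  ring

/-- The integers `12 spt(n) + (24 n - 1) p(n)`. -/
def sptCoeff (n : ℕ) : ℤ := 12 * spt n + (24 * n - 1) * Fintype.card n.Partition

/-- The generating function of `sptCoeff`. -/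
noncomputable def sptSeries : PowerSeries ℚ := PowerSeries.mk fun n => (sptCoeff n : ℚ)

theorem euler_mul_sptSeries : 2 * (euler * sptSeries) = 1 - 3 * eis2 + 24 * thetaMoment ℚ 1 := by
  have h1 : sptSeries = 12 * (PowerSeries.mk fun n => (spt n : ℚ)) +
      (24 * theta ℚ partGen - partGen) := by
    ext n
    rw [show (12 : PowerSeries ℚ) = C 12 from (map_ofNat _ 12).symm,
      show (24 : PowerSeries ℚ) = C 24 from (map_ofNat _ 24).symm]
    rw [sptSeries, map_add, map_sub, coeff_C_mul, coeff_C_mul, coeff_theta, coeff_partGen]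
    simp only [coeff_mk, sptCoeff]
    push_cast
    ring
  have h2 := congrArg (theta ℚ) partGen_mul_euler
  rw [theta_mul, Derivation.map_one_eq_zero] at h2
  rw [h1]
  linear_combination euler_mul_spt + 48 * h2 - 2 * partGen * theta_euler - 2 * eis2 *
      partGen_mul_euler

/-- The second moment of the crank is determined by `spt`. -/
lemma euler_mul_sptSeries' : euler * (C (-1 / 3) * sptSeries) =
    coeff 2 crankSeries + C (1 / 2) * e2 ℚ := by
  rw [coeff_crankSeries_succ, coeff_two_shc_inv]
  have h1 := coeff_oddSeries_partialThetaGen odd_one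
  rw [Nat.factorial_one, Nat.cast_one, map_one, one_mul] at h1
  have h2 : (C (-(6 : ℚ)⁻¹) : PowerSeries ℚ) * 6 = -1 := by
    rw [show (6 : PowerSeries ℚ) = C 6 from (map_ofNat _ 6).symm, ← map_mul]
    norm_num
  have h3 : (C (-1 / 3 : ℚ) : PowerSeries ℚ) = C (-(6 : ℚ)⁻¹) * 2 := by
    rw [show (2 : PowerSeries ℚ) = C 2 from (map_ofNat _ 2).symm, ← map_mul]
    norm_num
  have h4 : (C (1 / 2 : ℚ) : PowerSeries ℚ) = C (-(6 : ℚ)⁻¹) * -3 := by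
    rw [show (3 : PowerSeries ℚ) = C 3 from (map_ofNat _ 3).symm, ← map_neg, ← map_mul]
    norm_num
  rw [h1, h3, h4, e2_rat]
  linear_combination C (-(6 : ℚ)⁻¹) * euler_mul_sptSeries + 4 * thetaMoment ℚ 1 * h2

end SptGeneratingFunction

section Filtration

open PowerSeries

variable {ℓ : ℕ} [Fact ℓ.Prime]

lemma pow_mem_modForms {R : Type*} [CommRing R] {k : ℤ} {f : PowerSeries R}
    (hf : f ∈ modForms R k) (n : ℕ) : f ^ n ∈ modForms R (n * k) := by
  induction n with
  | zero => simpa using one_mem_modForms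
  | succ n ih =>
    rw [pow_succ]
    exact mul_mem_modForms ih hf (by push_cast; ring)

lemma eq_zero_of_neg_weight {R : Type*} [CommRing R] {k : ℤ} (hk : k < 0) {f : PowerSeries R}
    (hf : f ∈ modForms R k) : f = 0 :=
  modForms_eq_bot (fun a b => by omega) hf

lemma cast_1728_ne_zero (h5 : 5 ≤ ℓ) : (1728 : ZMod ℓ) ≠ 0 := by
  exact_mod_cast natCast_1728_ne_zero h5

lemma e4_ne_zero : e4 (ZMod ℓ) ≠ 0 := fun h => by
  simpa using congrArg constantCoeff h

lemma e4_mem_modForms_add (h5 : 5 ≤ ℓ) : e4 (ZMod ℓ) ∈ modForms (ZMod ℓ) (ℓ + 3) := by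
  have h1 := serre_mem_modForms (e2_mem_modForms h5)
  have h2 : 12 * theta (ZMod ℓ) (e2 (ZMod ℓ)) - ((ℓ + 1 : ℤ) : PowerSeries (ZMod ℓ)) *
      (e2 (ZMod ℓ) * e2 (ZMod ℓ)) = -e4 (ZMod ℓ) := by
    have : ((ℓ : ℕ) : PowerSeries (ZMod ℓ)) = 0 := by
      rw [← map_natCast (C (R := ZMod ℓ)), CharP.cast_eq_zero, map_zero]
    push_cast
    rw [this, theta_e2]
    ring
  rw [h2] at h1
  convert! neg_mem h1 using 1
  rw [neg_neg]

lemma e6_mem_modForms_add (h5 : 5 ≤ ℓ) : e6 (ZMod ℓ) ∈ modForms (ZMod ℓ) (ℓ + 5) := by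
  have h1 := serre_mem_modForms (e4_mem_modForms_add h5)
  have h3 := mul_mem_modForms (e2_mem_modForms h5) (e4_mem_modForms (R := ZMod ℓ))
    (l := ℓ + 5) (by ring)
  have h2 : 12 * theta (ZMod ℓ) (e4 (ZMod ℓ)) - ((ℓ + 3 : ℤ) : PowerSeries (ZMod ℓ)) *
      (e2 (ZMod ℓ) * e4 (ZMod ℓ)) = e2 (ZMod ℓ) * e4 (ZMod ℓ) - 4 * e6 (ZMod ℓ) := by
    have : ((ℓ : ℕ) : PowerSeries (ZMod ℓ)) = 0 := by
      rw [← map_natCast (C (R := ZMod ℓ)), CharP.cast_eq_zero, map_zero]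
    push_cast
    rw [this]
    linear_combination 4 * theta_e4 (ZMod ℓ)
  rw [h2, show (ℓ + 3 + 2 : ℤ) = ℓ + 5 by ring] at h1
  have h4 : (4 : ZMod ℓ) ≠ 0 := by
    exact_mod_cast natCast_ne_zero_zmod (ℓ := ℓ) (n := 4) (by norm_num) (by omega)
  have h6 := C_mul_mem_modForms (4⁻¹ : ZMod ℓ) (sub_mem h3 h1)
  convert! h6 using 1
  have : (C (4⁻¹ : ZMod ℓ)) * 4 = 1 := by
    rw [show (4 : PowerSeries (ZMod ℓ)) = C 4 from (map_ofNat _ 4).symm, ← map_mul,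
      inv_mul_cancel₀ h4, map_one]
  linear_combination -e6 (ZMod ℓ) * this

lemma one_mem_modForms_sub_one (h5 : 5 ≤ ℓ) : 1 ∈ modForms (ZMod ℓ) (ℓ - 1) := by
  obtain ⟨g, hg, h⟩ := e4_dvd_of_e4_mul_eq (cast_1728_ne_zero h5) (k := ℓ + 3)
    (by convert! e6_mem_modForms_add h5 using 2) (e4_mem_modForms_add h5) (mul_comm _ _)
  have : 1 = g := mul_left_cancel₀ e4_ne_zero (by rw [← h, mul_one])
  rw [this]
  convert! hg using 2
  ring

lemma mem_modForms_add (h5 : 5 ≤ ℓ) {k l : ℤ} {f : PowerSeries (ZMod ℓ)}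
    (hf : f ∈ modForms (ZMod ℓ) k) (h : l = k + (ℓ - 1)) : f ∈ modForms (ZMod ℓ) l := by
  simpa using mul_mem_modForms hf (one_mem_modForms_sub_one h5) h.symm

/-- Multiplication by the quasi-modular series `e2` raises the filtration maximally. -/
theorem mem_modForms_of_e2_mul_mem (h5 : 5 ≤ ℓ) {w : ℤ} {f : PowerSeries (ZMod ℓ)}
    (hf : f ∈ modForms (ZMod ℓ) w) (he : e2 (ZMod ℓ) * f ∈ modForms (ZMod ℓ) (w + 2)) :
    f ∈ modForms (ZMod ℓ) (w - (ℓ - 1)) := by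
  induction hn : w.toNat using Nat.strong_induction_on generalizing w f with
  | _ n ih =>
  rcases lt_or_ge w 0 with hw | hw
  · rw [eq_zero_of_neg_weight hw hf]
    exact zero_mem _
  have hd := discr_ne_zero (cast_1728_ne_zero h5)
  have key {u : ℤ} {g : PowerSeries (ZMod ℓ)} (hg : g ∈ modForms (ZMod ℓ) u)
      (hge : e2 (ZMod ℓ) * g ∈ modForms (ZMod ℓ) (u + 2)) (h0 : constantCoeff g = 0) :
      ∃ g' ∈ modForms (ZMod ℓ) (u - 12), g = discr (ZMod ℓ) * g' ∧
        e2 (ZMod ℓ) * g' ∈ modForms (ZMod ℓ) (u - 12 + 2) := by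
    obtain ⟨g', hg', h1⟩ := exists_discr_mul_of_constantCoeff hg h0
    obtain ⟨g'', hg'', h2⟩ := exists_discr_mul_of_constantCoeff hge (by rw [map_mul, h0, mul_zero])
    refine ⟨g', hg', h1, ?_⟩
    have : e2 (ZMod ℓ) * g' = g'' := mul_left_cancel₀ hd (by rw [← h2, h1]; ring)
    rw [this]
    convert! hg'' using 2
    ring
  have zero_case {g : PowerSeries (ZMod ℓ)} (hg : g ∈ modForms (ZMod ℓ) w)
      (hge : e2 (ZMod ℓ) * g ∈ modForms (ZMod ℓ) (w + 2)) (h0 : constantCoeff g = 0) :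
      g ∈ modForms (ZMod ℓ) (w - (ℓ - 1)) := by
    obtain ⟨g', hg', h1, h2⟩ := key hg hge h0
    rw [h1]
    rcases lt_or_ge (w - 12) 0 with hw' | hw'
    · rw [eq_zero_of_neg_weight hw' hg', mul_zero]
      exact zero_mem _
    · refine mul_mem_modForms (j := 12) ?_ (ih _ (by omega) hg' h2 rfl) (by ring)
      rw [discr]
      refine sub_mem ?_ ?_
      · simpa using monomial_mem_modForms (R := ZMod ℓ) 3 0 (k := 12) (by norm_num)
      · simpa using monomial_mem_modForms (R := ZMod ℓ) 0 2 (k := 12) (by norm_num)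
  by_cases hab : ∃ a b : ℕ, (4 * a + 6 * b : ℤ) = w - (ℓ - 1)
  · obtain ⟨a, b, hab⟩ := hab
    have hm := C_mul_mem_modForms (constantCoeff f)
      (monomial_mem_modForms (R := ZMod ℓ) a b hab)
    have := zero_case (sub_mem hf (mem_modForms_add h5 hm (by ring)))
      (by
        rw [mul_sub]
        exact sub_mem he (mul_mem_modForms (e2_mem_modForms h5) hm (by ring))) (by simp)
    simpa using add_mem this hm
  · by_cases h0 : constantCoeff f = 0
    · exact zero_case hf he h0
    suffices f = 0 by
      rw [this]
      exact zero_mem _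
    have hweven : ∃ v, w = 2 * v := by
      by_contra h
      exact h0 (by rw [modForms_eq_bot (fun a b h' => h ⟨2 * a + 3 * b, by omega⟩) hf, map_zero])
    have hlodd : ∃ v : ℕ, ℓ = 2 * v + 1 := (Fact.out : ℓ.Prime).odd_of_ne_two (by omega)
    have hwl : w < ℓ - 1 ∨ w = ℓ + 1 := by
      by_contra! h
      obtain ⟨v, rfl⟩ := hweven
      obtain ⟨v', rfl⟩ := hlodd
      apply hab
      rcases Int.even_or_odd' (v - v') with ⟨t, ht | ht⟩
      · exact ⟨t.toNat, 0, by omega⟩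
      · exact ⟨(t - 1).toNat, 1, by omega⟩
    have hw1 : ((w + 1 : ℤ) : ZMod ℓ) ≠ 0 := by
      rw [Ne, ZMod.intCast_zmod_eq_zero_iff_dvd]
      rintro ⟨t, ht⟩
      rcases hwl with h | h
      · have : t < 1 := by nlinarith
        have : 0 < t := by nlinarith
        omega
      · have : t < 2 := by nlinarith
        have : 1 < t := by nlinarith
        omega
    set F := 12 * theta (ZMod ℓ) f - ((w + 1 : ℤ) : PowerSeries (ZMod ℓ)) * (e2 (ZMod ℓ) * f)
      with hF
    have hFm : F ∈ modForms (ZMod ℓ) (w + 2) := by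
      convert! sub_mem (serre_mem_modForms hf) he using 1
      rw [hF]
      push_cast
      ring
    have hFe : e2 (ZMod ℓ) * F ∈ modForms (ZMod ℓ) (w + 2 + 2) := by
      convert! add_mem (serre_mem_modForms he)
        (mul_mem_modForms (e4_mem_modForms (R := ZMod ℓ)) hf (l := w + 2 + 2) (by ring)) using 1
      rw [hF, theta_mul]
      push_cast
      linear_combination -f * theta_e2 (ZMod ℓ)
    have hX : e4 (ZMod ℓ) * F + ((w + 1 : ℤ) : PowerSeries (ZMod ℓ)) * (e6 (ZMod ℓ) * f) = 0 := by
      have hc : ((w + 1 : ℤ) : PowerSeries (ZMod ℓ)) = C ((w + 1 : ℤ) : ZMod ℓ) :=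
        (map_intCast _ _).symm
      obtain ⟨g', hg', h1, h2⟩ := key (u := w + 6)
        (g := e4 (ZMod ℓ) * F + C ((w + 1 : ℤ) : ZMod ℓ) * (e6 (ZMod ℓ) * f))
        (add_mem (mul_mem_modForms e4_mem_modForms hFm (by ring))
          (C_mul_mem_modForms _ (mul_mem_modForms e6_mem_modForms hf (by ring))))
        (by
          convert! add_mem (mul_mem_modForms (e4_mem_modForms (R := ZMod ℓ)) hFe
            (l := w + 6 + 2) (by ring))
            (C_mul_mem_modForms ((w + 1 : ℤ) : ZMod ℓ) (mul_mem_modForms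
              (e6_mem_modForms (R := ZMod ℓ)) he (l := w + 6 + 2) (by ring))) using 1
          ring)
        (by
          rw [hF, hc]
          simp [constantCoeff_theta, constantCoeff_e2, constantCoeff_e4, constantCoeff_e6])
      have : g' = 0 := by
        rcases lt_or_ge (w - 6) 0 with hw' | hw'
        · exact eq_zero_of_neg_weight (by omega) hg'
        · exact eq_zero_of_neg_weight (by omega) (ih _ (by omega) hg' h2 rfl)
      rw [hc, h1, this, mul_zero]
    have hcu : C (((w + 1 : ℤ) : ZMod ℓ)⁻¹) * ((w + 1 : ℤ) : PowerSeries (ZMod ℓ)) = 1 := by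
      rw [← map_intCast (C (R := ZMod ℓ)), ← map_mul, inv_mul_cancel₀ hw1, map_one]
    obtain ⟨g, hg, hfg⟩ := e4_dvd_of_e4_mul_eq (cast_1728_ne_zero h5)
      (C_mul_mem_modForms (-((w + 1 : ℤ) : ZMod ℓ)⁻¹) hFm) hf (by
        rw [map_neg]
        linear_combination -C (((w + 1 : ℤ) : ZMod ℓ)⁻¹) * hX + e6 (ZMod ℓ) * f * hcu)
    obtain ⟨h, hh, hfh⟩ := e4_dvd_of_e4_mul_eq (cast_1728_ne_zero h5)
      (C_mul_mem_modForms (-((w + 1 : ℤ) : ZMod ℓ)⁻¹) hFe) he (by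
        rw [map_neg]
        linear_combination -C (((w + 1 : ℤ) : ZMod ℓ)⁻¹) * e2 (ZMod ℓ) * hX +
          e2 (ZMod ℓ) * e6 (ZMod ℓ) * f * hcu)
    have hgh : e2 (ZMod ℓ) * g = h := mul_left_cancel₀ e4_ne_zero (by rw [← hfh, hfg]; ring)
    have : g = 0 := by
      rcases lt_or_ge (w - 4) 0 with hw' | hw'
      · exact eq_zero_of_neg_weight (by omega) hg
      · refine eq_zero_of_neg_weight (by omega) (ih _ (by omega) hg ?_ rfl)
        rw [hgh]
        convert! hh using 2
        ring
    rw [hfg, this, mul_zero]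

/-- The operator `f ↦ e2 f - 24 q f'`, conjugate to `twistOp` by `(q; q)_∞`. -/
noncomputable def twistForm (f : PowerSeries (ZMod ℓ)) : PowerSeries (ZMod ℓ) :=
  e2 (ZMod ℓ) * f - 24 * theta (ZMod ℓ) f

lemma twistForm_iterate (f : PowerSeries (ZMod ℓ)) (m : ℕ) :
    pentagonalSeries (ZMod ℓ) * (twistOp (ZMod ℓ))^[m] f =
      twistForm^[m] (pentagonalSeries (ZMod ℓ) * f) := by
  induction m with
  | zero => rfl
  | succ m ih =>
    rw [Function.iterate_succ_apply', Function.iterate_succ_apply', ← ih, twistOp, twistForm,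
      theta_mul]
    linear_combination (twistOp (ZMod ℓ))^[m] f * theta_pentagonalSeries (ℓ := ℓ)

lemma natCast_powerSeries_eq_zero : ((ℓ : ℕ) : PowerSeries (ZMod ℓ)) = 0 := by
  rw [← map_natCast (C (R := ZMod ℓ)), CharP.cast_eq_zero, map_zero]

lemma twistForm_iterate_mem (h5 : 5 ≤ ℓ) {g : PowerSeries (ZMod ℓ)}
    (hg : g ∈ modForms (ZMod ℓ) (ℓ + 1)) {i : ℕ} (hi : 2 * i < ℓ) :
    ∃ c : ZMod ℓ, c ≠ 0 ∧ twistForm^[i] g - C c * (e2 (ZMod ℓ) ^ i * g) ∈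
      modForms (ZMod ℓ) ((i + 1) * (ℓ + 1) - (ℓ - 1)) := by
  induction i with
  | zero => exact ⟨1, one_ne_zero, by simp⟩
  | succ i ih =>
    obtain ⟨c, hc, hm⟩ := ih (by omega)
    set n := twistForm^[i] g - C c * (e2 (ZMod ℓ) ^ i * g) with hn
    have hl : ((ℓ : ℕ) : PowerSeries (ZMod ℓ)) = 0 := natCast_powerSeries_eq_zero
    refine ⟨-(((2 * i + 1 : ℕ) : ZMod ℓ) * c), neg_ne_zero.mpr (mul_ne_zero
      (natCast_ne_zero_zmod (by omega) (by omega)) hc), ?_⟩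
    have hw : ((i + 1 : ℕ) + 1 : ℤ) * (ℓ + 1) - (ℓ - 1) = (i + 1) * (ℓ + 1) + 2 := by
      push_cast
      ring
    rw [hw]
    have h1 : twistForm^[i] g = n + C c * (e2 (ZMod ℓ) ^ i * g) := by rw [hn]; ring
    have h2 := serre_mem_modForms hg
    have h3 := serre_mem_modForms hm
    have h4 := mul_mem_modForms (e2_mem_modForms h5) hm (l := (i + 1) * (ℓ + 1) + 2) (by ring)
    have h5' := mul_mem_modForms (pow_mem_modForms (e2_mem_modForms h5) i) h2
      (l := (i + 1) * (ℓ + 1) + 2) (by ring)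
    have h6 : (i : PowerSeries (ZMod ℓ)) * (e2 (ZMod ℓ) ^ (i - 1) * e4 (ZMod ℓ) * g) ∈
        modForms (ZMod ℓ) ((i + 1) * (ℓ + 1) + 2) := by
      rcases i with _ | i
      · simp
      · rw [← map_natCast (C (R := ZMod ℓ))]
        refine C_mul_mem_modForms _ (mem_modForms_add h5 (mul_mem_modForms (mul_mem_modForms
          (pow_mem_modForms (e2_mem_modForms h5) i) e4_mem_modForms rfl) hg rfl) ?_)
        push_cast
        ring
    have h7 := mem_modForms_add h5 h3 (l := (i + 1) * (ℓ + 1) + 2) (by ring)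
    set u : ℤ := (i + 1) * (ℓ + 1) - (ℓ - 1) with hu
    have h8 := add_mem (sub_mem (C_mul_mem_modForms ((1 - 2 * u : ℤ) :
        ZMod ℓ) h4) (C_mul_mem_modForms 2 h7))
      (C_mul_mem_modForms (2 * c) (sub_mem h6 h5'))
    convert! h8 using 1
    have hp : (i : PowerSeries (ZMod ℓ)) * (e2 (ZMod ℓ) ^ (i - 1) * e2 (ZMod ℓ)) =
        i * e2 (ZMod ℓ) ^ i := by
      rcases i with _ | i
      · simp
      · rw [pow_succ, Nat.add_sub_cancel]
    rw [Function.iterate_succ_apply', twistForm, h1, map_add, theta_mul, theta_C, theta_mul,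
      theta_pow]
    simp only [map_neg, map_mul, map_intCast, map_natCast, map_ofNat]
    push_cast
    rw [hl]
    linear_combination -(2 * C c * i * e2 (ZMod ℓ) ^ (i - 1) * g) * theta_e2 (ZMod ℓ) -
      2 * C c * g * e2 (ZMod ℓ) * hp

/-- A modular form fixed up to sign by the twist vanishes. -/
theorem eq_zero_of_twistForm_iterate (h5 : 5 ≤ ℓ) {g : PowerSeries (ZMod ℓ)}
    (hg : g ∈ modForms (ZMod ℓ) (ℓ + 1)) (h : twistForm^[(ℓ - 1) / 2] g = -g) : g = 0 := by
  obtain ⟨j, hj⟩ := (Fact.out : ℓ.Prime).odd_of_ne_two (by omega)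
  rw [show (ℓ - 1) / 2 = j by omega] at h
  obtain ⟨c, hc, hm⟩ := twistForm_iterate_mem h5 hg (i := j) (by omega)
  have hj' : (ℓ : ℤ) = 2 * j + 1 := by exact_mod_cast hj
  have h1 (m : ℕ) {k : ℤ} {f : PowerSeries (ZMod ℓ)} (hf : f ∈ modForms (ZMod ℓ) k) :
      f ∈ modForms (ZMod ℓ) (k + m * (ℓ - 1)) := by
    induction m with
    | zero => simpa using hf
    | succ m ih => exact mem_modForms_add h5 ih (by push_cast; ring)
  have h2 : e2 (ZMod ℓ) ^ j * g ∈ modForms (ZMod ℓ) ((j + 1) * (ℓ + 1) - (ℓ - 1)) := by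
    have h3 : g ∈ modForms (ZMod ℓ) ((j + 1) * (ℓ + 1) - (ℓ - 1)) := by
      convert! h1 j hg using 2
      rw [hj']
      ring
    rw [h] at hm
    have h4 := C_mul_mem_modForms (-c⁻¹) (add_mem hm h3)
    convert! h4 using 1
    have : C c⁻¹ * C c = (1 : PowerSeries (ZMod ℓ)) := by
      rw [← map_mul, inv_mul_cancel₀ hc, map_one]
    rw [map_neg]
    linear_combination -(e2 (ZMod ℓ) ^ j * g) * this
  have h3 : ∀ m : ℕ, e2 (ZMod ℓ) ^ m * g ∈ modForms (ZMod ℓ) ((m + 1) * (ℓ + 1) - (ℓ - 1)) →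
      g ∈ modForms (ZMod ℓ) 2 := by
    intro m
    induction m with
    | zero =>
      intro hm
      rw [pow_zero, one_mul] at hm
      convert! hm using 2
      push_cast
      ring
    | succ m ih =>
      intro hm
      apply ih
      refine mem_modForms_of_e2_mul_mem h5
        (mul_mem_modForms (pow_mem_modForms (e2_mem_modForms h5) m) hg (by ring)) ?_
      rw [← mul_assoc, ← pow_succ']
      convert! hm using 2
      push_cast
      ring
  exact modForms_eq_bot (fun a b => by omega) (h3 j h2)

variable (ℓ) in
/-- The reduction of `sptSeries` modulo `ℓ`. -/
noncomputable def sptMod : PowerSeries (ZMod ℓ) := PowerSeries.mk fun n => (sptCoeff n : ZMod ℓ)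

lemma reduces_sptSeries : Reduces ℓ sptSeries (sptMod ℓ) := by
  convert! Reduces.of_int (ℓ := ℓ) (PowerSeries.mk sptCoeff) using 1

variable (ℓ) in
/-- The part of `sptMod` supported on indices where `1 - 24 n` is not a quadratic residue. -/
noncomputable def sptNonres : PowerSeries (ZMod ℓ) :=
  sptMod ℓ - (twistOp (ZMod ℓ))^[(ℓ - 1) / 2] (sptMod ℓ)

theorem pentagonalSeries_mul_sptNonres_mem (h5 : 5 ≤ ℓ) :
    pentagonalSeries (ZMod ℓ) * sptNonres ℓ ∈ modForms (ZMod ℓ) (ℓ + 1) := by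
  have h3 : ((3 : ℕ) : ZMod ℓ) ≠ 0 := natCast_ne_zero_zmod (by norm_num) (by omega)
  have hx : (-1 / 3 : ℚ) ∈ intAt ℓ := by
    rw [show (-1 / 3 : ℚ) = -((3 : ℕ) : ℚ)⁻¹ by norm_num]
    exact neg_mem (natCast_inv_mem_intAt h3)
  have hx' : ((-1 / 3 : ℚ) : ZMod ℓ) ≠ 0 := by
    rw [Rat.cast_def, show (-1 / 3 : ℚ).num = -1 by norm_num, show (-1 / 3 : ℚ).den = 3 by norm_num]
    simpa using h3
  obtain ⟨c, hc⟩ := crank_congruence h5 euler_mul_sptSeries' ((Reduces.C hx).mul reduces_sptSeries)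
    reduces_euler
  have h1 := sub_mem hc (C_mul_mem_modForms c (e2_mem_modForms h5))
  rw [add_sub_cancel_right] at h1
  set d := ((-1 / 3 : ℚ) : ZMod ℓ)
  have h2 : (twistOp (ZMod ℓ))^[(ℓ - 1) / 2] (C d * sptMod ℓ) =
      C d * (twistOp (ZMod ℓ))^[(ℓ - 1) / 2] (sptMod ℓ) := by
    ext n
    rw [coeff_twistOp_iterate, coeff_C_mul, coeff_C_mul, coeff_twistOp_iterate]
    ring
  rw [h2] at h1
  have h4 := C_mul_mem_modForms d⁻¹ h1
  convert! h4 using 1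
  have : C d⁻¹ * C d = (1 : PowerSeries (ZMod ℓ)) := by
    rw [← map_mul, inv_mul_cancel₀ hx', map_one]
  rw [sptNonres]
  linear_combination -(pentagonalSeries (ZMod ℓ) * (sptMod ℓ -
    (twistOp (ZMod ℓ))^[(ℓ - 1) / 2] (sptMod ℓ))) * this

lemma coeff_sptNonres (n : ℕ) : coeff n (sptNonres ℓ) =
    (1 - (1 - 24 * n) ^ ((ℓ - 1) / 2)) * sptCoeff n := by
  rw [sptNonres, map_sub, coeff_twistOp_iterate, sptMod, coeff_mk]
  ring

lemma sptNonres_eq_zero_of_forall (h5 : 5 ≤ ℓ)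
    (h : ∀ n : ℕ, 24 ∣ ℓ * n + 1 → ℓ ∣ spt ((ℓ * n + 1) / 24)) : sptNonres ℓ = 0 := by
  have h1 : (twistOp (ZMod ℓ))^[(ℓ - 1) / 2] (sptNonres ℓ) = -sptNonres ℓ := by
    ext n
    rw [coeff_twistOp_iterate, map_neg, coeff_sptNonres]
    by_cases hn : (1 - 24 * n : ZMod ℓ) = 0
    · have h2 : (sptCoeff n : ZMod ℓ) = 0 := by
        have h3 : (ℓ : ℤ) ∣ 24 * n - 1 := by
          rw [← ZMod.intCast_zmod_eq_zero_iff_dvd]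
          push_cast
          linear_combination -hn
        obtain ⟨m, hm⟩ := h3
        have hm0 : 0 ≤ m := by
          by_contra! h'
          nlinarith
        lift m to ℕ using hm0
        have h4 : 24 * n = ℓ * m + 1 := by omega
        have h5 := h m ⟨n, h4.symm⟩
        rw [← h4, Nat.mul_div_cancel_left _ (by norm_num)] at h5
        rw [ZMod.intCast_zmod_eq_zero_iff_dvd, sptCoeff, hm]
        exact dvd_add ((Int.natCast_dvd_natCast.mpr h5).mul_left 12) (dvd_mul_of_dvd_left
            (dvd_mul_right _ _) _)
      rw [h2]
      ring
    · have h3 : ((1 - 24 * n : ZMod ℓ) ^ ((ℓ - 1) / 2)) ^ 2 = 1 := by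
        rw [← pow_mul, Nat.div_mul_cancel, ZMod.pow_card_sub_one_eq_one hn]
        obtain ⟨k, hk⟩ := (Fact.out : ℓ.Prime).odd_of_ne_two (by omega)
        exact ⟨k, by omega⟩
      linear_combination -(sptCoeff n : ZMod ℓ) * h3
  have h2 := twistForm_iterate (sptNonres ℓ) ((ℓ - 1) / 2)
  rw [h1, mul_neg] at h2
  have h3 := eq_zero_of_twistForm_iterate h5 (pentagonalSeries_mul_sptNonres_mem h5) h2.symm
  exact (mul_eq_zero.mp h3).resolve_left pentagonalSeries_ne_zero

/-- A nonresidue index at which `sptCoeff` is a unit rules out a congruence. -/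
theorem not_forall_of_sptCoeff (h5 : 5 ≤ ℓ) {n : ℕ}
    (hn : (1 - 24 * n : ZMod ℓ) ^ ((ℓ - 1) / 2) = -1) (ha : (sptCoeff n : ZMod ℓ) ≠ 0) :
    ¬ ∀ n : ℕ, 24 ∣ ℓ * n + 1 → ℓ ∣ spt ((ℓ * n + 1) / 24) := by
  intro h
  have h1 := congrArg (coeff n) (sptNonres_eq_zero_of_forall h5 h)
  rw [coeff_sptNonres, hn, map_zero, sub_neg_eq_add, one_add_one_eq_two] at h1
  exact mul_ne_zero (by exact_mod_cast natCast_two_ne_zero h5) ha h1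

/-- The congruences for small primes. -/
theorem spt_congruence_of_weight (h5 : 5 ≤ ℓ) (hw : ∀ a b : ℕ, (4 * a + 6 * b : ℤ) ≠ ℓ +
    1 - 12) (n : ℕ)
    (hn : 24 ∣ ℓ * n + 1) : ℓ ∣ spt ((ℓ * n + 1) / 24) := by
  obtain ⟨m, hm⟩ := hn
  rw [hm, Nat.mul_div_cancel_left _ (by norm_num)]
  have h0 : sptNonres ℓ = 0 := by
    obtain ⟨g, hg, h⟩ := exists_discr_mul_of_constantCoeff (pentagonalSeries_mul_sptNonres_mem h5)
      (by
        rw [map_mul, ← coeff_zero_eq_constantCoeff_apply (sptNonres ℓ), coeff_sptNonres]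
        simp)
    rw [modForms_eq_bot hw hg, mul_zero] at h
    exact (mul_eq_zero.mp h).resolve_left pentagonalSeries_ne_zero
  have h1 : (1 - 24 * m : ZMod ℓ) = 0 := by
    have := congrArg (Nat.cast (R := ZMod ℓ)) hm
    push_cast [CharP.cast_eq_zero] at this
    linear_combination this
  have h2 := congrArg (coeff m) h0
  rw [coeff_sptNonres, h1, zero_pow (by omega), sptCoeff] at h2
  push_cast at h2
  have h3 : ((12 * spt m : ℕ) : ZMod ℓ) = 0 := by
    push_cast
    rw [map_zero] at h2
    linear_combination h2 + (Fintype.card m.Partition : ZMod ℓ) * h1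
  rw [ZMod.natCast_eq_zero_iff, (Fact.out : ℓ.Prime).dvd_mul] at h3
  refine h3.resolve_left fun h => ?_
  rw [show 12 = 2 * 2 * 3 by norm_num, (Fact.out : ℓ.Prime).dvd_mul,
    (Fact.out : ℓ.Prime).dvd_mul] at h
  rcases h with (h | h) | h <;> have := Nat.le_of_dvd (by norm_num) h <;> omega

end Filtration

section Values

open PowerSeries

/-- The coefficients of the pentagonal series. -/
def pentagonalCoeff (n : ℕ) : ℤ :=
  ∑ k ∈ range (n + 1), ((if k * (3 * k + 1) = 2 * n then (-1) ^ k else 0) +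
    if (k + 1) * (3 * k + 2) = 2 * n then (-1) ^ (k + 1) else 0)

lemma coeff_euler (n : ℕ) : coeff n euler = (pentagonalCoeff n : ℚ) := by
  have hp : ∀ k : ℕ, k * (3 * k + 1) = 2 * pentagonal (-k) := fun k => by
    have h := two_mul_natCast_pentagonal_neg (k : ℤ)
    exact_mod_cast h.symm
  have hq : ∀ k : ℕ, (k + 1) * (3 * k + 2) = 2 * pentagonal (k + 1) := fun k => by
    have h := two_mul_natCast_pentagonal (k + 1 : ℤ)
    have h2 : ((k + 1 : ℕ) : ℤ) * ((3 * k + 2 : ℕ) : ℤ) = 2 * pentagonal (k + 1) := by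
      rw [h]; push_cast; ring
    exact_mod_cast h2
  have h4 : ∀ k : ℕ, (((k : ℤ).negOnePow : ℤ) : ℚ) = (-1) ^ k := fun k => by
    rw [Int.negOnePow_def, zpow_natCast]
    simp
  rw [euler_eq_pentagonalSeries, pentagonalCoeff]
  simp only [hp, hq, Nat.mul_left_cancel_iff two_pos]
  push_cast
  by_cases hn : n ∈ Set.range pentagonal
  · obtain ⟨m, rfl⟩ := hn
    rw [coeff_pentagonalSeries_pentagonal]
    simp only [pentagonal_inj]
    rcases m with m | m
    · rcases m with _ | m
      · rw [sum_eq_single 0]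
        · simp
        · intro k _ hk
          have h1 : ¬ (-(k : ℤ) = Int.ofNat 0) := by simpa using hk
          have h2 : ¬ ((k : ℤ) + 1 = Int.ofNat 0) := by
            simp only [Int.ofNat_eq_natCast]; omega
          rw [if_neg h1, if_neg h2, add_zero]
        · simp
      · rw [sum_eq_single m]
        · have h1 : ¬ (-(m : ℤ) = Int.ofNat (m + 1)) := by
            simp only [Int.ofNat_eq_natCast]; omega
          have h2 : ((m : ℤ) + 1 = Int.ofNat (m + 1)) := by simp
          rw [if_neg h1, if_pos h2, zero_add]
          rw [Int.ofNat_eq_natCast, h4]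
        · intro k _ hk
          have h1 : ¬ (-(k : ℤ) = Int.ofNat (m + 1)) := by
            simp only [Int.ofNat_eq_natCast]; omega
          have h2 : ¬ ((k : ℤ) + 1 = Int.ofNat (m + 1)) := by
            simp only [Int.ofNat_eq_natCast]; omega
          rw [if_neg h1, if_neg h2, add_zero]
        · intro h
          refine absurd ?_ h
          have h3 := hq m
          rw [mem_range]
          rw [Int.ofNat_eq_natCast]
          push_cast
          nlinarith
    · rw [sum_eq_single (m + 1)]
      · have h1 : (-((m + 1 : ℕ) : ℤ) = Int.negSucc m) := rfl
        have h2 : ¬ (((m + 1 : ℕ) : ℤ) + 1 = Int.negSucc m) := by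
          rw [← h1]; omega
        rw [if_pos h1, if_neg h2, add_zero, ← h1]
        rw [Int.negOnePow_neg, h4]
      · intro k _ hk
        have h0 : (-((m + 1 : ℕ) : ℤ) = Int.negSucc m) := rfl
        have h1 : ¬ (-(k : ℤ) = Int.negSucc m) := by
          rw [← h0]; omega
        have h2 : ¬ ((k : ℤ) + 1 = Int.negSucc m) := by
          rw [← h0]; omega
        rw [if_neg h1, if_neg h2, add_zero]
      · intro h
        refine absurd ?_ h
        have h3 := hp (m + 1)
        have h0 : (-((m + 1 : ℕ) : ℤ) = Int.negSucc m) := rfl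
        rw [mem_range, ← h0]
        nlinarith
  · rw [coeff_pentagonalSeries_eq_zero _ hn, sum_eq_zero]
    intro k _
    rw [if_neg fun h => hn ⟨_, h⟩, if_neg fun h => hn ⟨_, h⟩, add_zero]

/-- The coefficients of `X ^ (3 choose(d,2) + d) (1 + X ^ d) (X ^ d / (1 - X ^ d) ^ 2)`. -/
def momentTerm (d n : ℕ) : ℤ :=
  (if 3 * d.choose 2 + d ≤ n ∧ d ∣ n - (3 * d.choose 2 + d) then
    ((n - (3 * d.choose 2 + d)) / d : ℕ) else 0) +
  if 3 * d.choose 2 + 2 * d ≤ n ∧ d ∣ n - (3 * d.choose 2 + 2 * d) then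
    ((n - (3 * d.choose 2 + 2 * d)) / d : ℕ) else 0

lemma coeff_thetaMoment_one (n : ℕ) : coeff n (thetaMoment ℚ 1) =
    ((∑ r ∈ range (n + 1), (-1) ^ (r + 1) * momentTerm (r + 1) n : ℤ) : ℚ) := by
  have h := X_pow_dvd_iff.mp (thetaMoment_sub_dvd (n + 1)) n (Nat.lt_succ_self n)
  rw [map_sub, sub_eq_zero] at h
  rw [h, map_sum]
  push_cast
  refine sum_congr rfl fun r _ => ?_
  have h1 : ((-1) ^ (r + 1) * X ^ (3 * (r + 1).choose 2 + (r + 1)) * (1 + X ^ (r + 1)) *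
      (X ^ (r + 1) * geomSeries (r + 1) ^ 2) : PowerSeries ℚ) = C ((-1) ^ (r + 1)) *
      (X ^ (3 * (r + 1).choose 2 + (r + 1)) * (X ^ (r + 1) * geomSeries (r + 1) ^ 2) +
      X ^ (3 * (r + 1).choose 2 + 2 * (r + 1)) * (X ^ (r + 1) * geomSeries (r + 1) ^ 2)) := by
    rw [map_pow, map_neg, map_one]
    ring
  have h2 : ∀ e : ℕ, coeff n (X ^ e * (X ^ (r + 1) * geomSeries (r + 1) ^ 2)) =
      (((if e ≤ n ∧ (r + 1) ∣ n - e then ((n - e) / (r + 1) : ℕ) else 0 : ℤ)) : ℚ) := by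
    intro e
    rw [coeff_X_pow_mul']
    split_ifs with h3 h4 h5
    · rw [coeff_geomSeries_sq r.succ_ne_zero, if_pos h4.2, Int.cast_natCast, Nat.cast_div h4.2]
      exact_mod_cast r.succ_ne_zero
    · rw [coeff_geomSeries_sq r.succ_ne_zero, if_neg fun h => h4 ⟨h3, h⟩, Int.cast_zero]
    · exact absurd h5.1 h3
    · simp
  rw [h1, coeff_C_mul, map_add, h2, h2, momentTerm]
  push_cast
  ring

/-- The coefficients of `euler * sptSeries`. -/
def sptNumerator (n : ℕ) : ℤ :=
  (if n = 0 then -1 else 36 * ∑ d ∈ range (n + 1), if d ∣ n then (d : ℤ) else 0) +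
    12 * ∑ r ∈ range (n + 1), (-1) ^ (r + 1) * momentTerm (r + 1) n

lemma sum_pentagonalCoeff_mul_sptCoeff (n : ℕ) :
    ∑ i ∈ range (n + 1), pentagonalCoeff i * sptCoeff (n - i) = sptNumerator n := by
  have h := congrArg (coeff n) euler_mul_sptSeries
  rw [show (2 : PowerSeries ℚ) = C 2 from (map_ofNat _ 2).symm,
    show (3 : PowerSeries ℚ) = C 3 from (map_ofNat _ 3).symm,
    show (24 : PowerSeries ℚ) = C 24 from (map_ofNat _ 24).symm, map_add, map_sub, coeff_C_mul,
    coeff_C_mul, coeff_C_mul, coeff_mul, coeff_thetaMoment_one,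
    Nat.sum_antidiagonal_eq_sum_range_succ_mk] at h
  simp only [coeff_euler, sptSeries, coeff_mk, eis2, coeff_one] at h
  have h1 : (2 * ∑ i ∈ range (n + 1), pentagonalCoeff i * sptCoeff (n - i) : ℚ) =
      2 * (sptNumerator n : ℚ) := by
    rw [Int.cast_sum]
    simp only [Int.cast_mul]
    rw [h, sptNumerator]
    have h2 : n ≠ 0 → ((∑ d ∈ range (n + 1), if d ∣ n then (d : ℤ) else 0 : ℤ) : ℚ) =
        (ArithmeticFunction.sigma 1 n : ℚ) := by
      intro hn
      rw [ArithmeticFunction.sigma_one_apply, ← sum_filter]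
      push_cast
      refine (sum_subset_zero_on_sdiff ?_ ?_ fun _ _ => rfl).symm
      · intro d hd
        have h3 := Nat.mem_divisors.mp hd
        exact mem_filter.mpr ⟨mem_range.mpr (Nat.lt_succ_of_le (Nat.le_of_dvd
          (Nat.pos_of_ne_zero hn) h3.1)), h3.1⟩
      · intro d hd
        have h3 := mem_sdiff.mp hd
        exact absurd (Nat.mem_divisors.mpr ⟨(mem_filter.mp h3.1).2, hn⟩) h3.2
    split_ifs with hn
    · push_cast
      ring
    · rw [Int.cast_add, Int.cast_mul 36, h2 hn]
      push_cast
      ring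
  exact_mod_cast mul_left_cancel₀ two_ne_zero h1

/-- The first values of `sptCoeff`. -/
def sptValues : List ℤ :=
  [-1, 35, 130, 273, 595, 1001, 1885, 2925, 4886, 7410, 11466, 16660, 24955, 35191, 50505, 70252,
  98085, 133455, 182819, 244790, 329121, 435420, 576030, 752609, 984165, 1271998, 1643460, 2105450,
  2693522, 3420235, 4338552, 5466370, 6878235, 8607417, 10752170, 13367913, 16593395, 20506655,
  25300933, 31100055, 38161158, 46667205, 56976010, 69346095, 84265025, 102112010, 123535230,
  149077810, 179624211, 215921095, 259162358]

lemma sum_pentagonalCoeff_mul_sptValues : ∀ n < 51,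
    ∑ i ∈ range (n + 1), pentagonalCoeff i * sptValues.getD (n - i) 0 = sptNumerator n := by
  decide +kernel

lemma sptCoeff_eq_sptValues {n : ℕ} (hn : n < 51) : sptCoeff n = sptValues.getD n 0 := by
  induction n using Nat.strong_induction_on with
  | _ n ih =>
    have h1 := sum_pentagonalCoeff_mul_sptCoeff n
    rw [← sum_pentagonalCoeff_mul_sptValues n hn, sum_range_succ', sum_range_succ'] at h1
    have h2 : ∑ i ∈ range n, pentagonalCoeff (i + 1) * sptCoeff (n - (i + 1)) =
        ∑ i ∈ range n, pentagonalCoeff (i + 1) * sptValues.getD (n - (i + 1)) 0 :=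
      sum_congr rfl fun i hi => by
        have := mem_range.mp hi
        rw [ih (n - (i + 1)) (by omega) (by omega)]
    have h3 : pentagonalCoeff 0 = 1 := by decide
    rwa [h2, add_right_inj, h3, one_mul, one_mul, Nat.sub_zero] at h1

end Values

section Sieve

/-- The Legendre symbol of `a` modulo an odd prime `p`, by Euler's criterion. -/
def eulerSymbol (a p : ℕ) : ℤ :=
  let x := (a % p) ^ (p / 2) % p
  if x = 1 then 1 else if x = p - 1 then -1 else 0

/-- The product of Euler symbols over a list of primes. -/
def eulerSymbolProd (a : ℕ) (l : List ℕ) : ℤ := (l.map (eulerSymbol a)).prod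

lemma jacobiSym_eq_eulerSymbol {a p : ℕ} (hp : p.Prime) (h2 : p ≠ 2) :
    jacobiSym a p = eulerSymbol a p := by
  have := Fact.mk hp
  have h3 : 2 < p := lt_of_le_of_ne hp.two_le (Ne.symm h2)
  rw [← jacobiSym.legendreSym.to_jacobiSym]
  have h := legendreSym.eq_pow p (a : ℤ)
  have hx : ((((a % p) ^ (p / 2) % p : ℕ)) : ZMod p) = ((a : ℤ) : ZMod p) ^ (p / 2) := by
    simp
  have hlt := Nat.mod_lt ((a % p) ^ (p / 2)) hp.pos
  have hc : ∀ c : ℕ, c < p → ((((a % p) ^ (p / 2) % p : ℕ)) : ZMod p) = c →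
      (a % p) ^ (p / 2) % p = c := fun c hc h =>
    Nat.ModEq.eq_of_lt_of_lt ((ZMod.natCast_eq_natCast_iff _ _ _).mp h) hlt hc
  rw [← hx] at h
  simp only [eulerSymbol]
  rcases quadraticChar_isQuadratic (ZMod p) ((a : ℤ) : ZMod p) with h0 | h0 | h0 <;>
    rw [legendreSym] at h ⊢ <;> rw [h0] at h ⊢
  · have h1 := hc 0 hp.pos (by rw [← h]; simp)
    rw [h1, if_neg (by omega), if_neg (by omega)]
  · have h1 := hc 1 hp.one_lt (by rw [← h]; simp)
    rw [h1, if_pos rfl]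
  · have h1 := hc (p - 1) (by omega) (by rw [← h, Nat.cast_sub (by omega)]; simp)
    rw [h1, if_neg (by omega), if_pos rfl]

lemma jacobiSym_eq_eulerSymbolProd (a : ℕ) {l : List ℕ} (hl : ∀ p ∈ l, p.Prime ∧ p ≠ 2) :
    jacobiSym a l.prod = eulerSymbolProd a l := by
  rw [jacobiSym.list_prod_right fun p hp => (hl p hp).1.ne_zero, eulerSymbolProd]
  congr 1
  exact List.map_congr_left fun p hp => jacobiSym_eq_eulerSymbol (hl p hp).1 (hl p hp).2

/-- A primality test by trial division. -/
def trialDivision (p b : ℕ) : Bool := p < b * b && 2 ≤ p && (List.range b).all fun m =>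
  m < 2 || p ≤ m || p % m != 0

lemma prime_of_trialDivision {p b : ℕ} (h : trialDivision p b = true) : p.Prime := by
  simp only [trialDivision, Bool.and_eq_true, decide_eq_true_eq, List.all_eq_true, List.mem_range,
    Bool.or_eq_true, bne_iff_ne] at h
  refine Nat.prime_def_le_sqrt.mpr ⟨h.1.2, fun m hm hm' hd => ?_⟩
  have h1 := Nat.le_sqrt.mp hm'
  have h2 : m < b := by nlinarith [h.1.1]
  rcases h.2 m h2 with (h3 | h3) | h3
  · omega
  · nlinarith
  · exact h3 (Nat.mod_eq_zero_of_dvd hd)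

lemma neg_one_of_jacobiSym {l n : ℕ} [Fact l.Prime] (h5 : 5 ≤ l) (hn : 1 ≤ n)
    (h : jacobiSym l (24 * n - 1 : ℕ) = -1) :
    (1 - 24 * n : ZMod l) ^ ((l - 1) / 2) = -1 := by
  have hp : l.Prime := Fact.out
  have hodd : Odd l := hp.odd_of_ne_two (by omega)
  have hj : jacobiSym (-((24 * n - 1 : ℕ) : ℤ)) l = -1 := by
    rw [jacobiSym.neg _ hodd, ← h]
    have hd : (24 * n - 1) % 4 = 3 := by omega
    have hm : l % 4 = 1 ∨ l % 4 = 3 := by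
      have := Nat.odd_iff.mp hodd
      omega
    rcases hm with h1 | h1
    · rw [ZMod.χ₄_nat_one_mod_four h1, one_mul,
        jacobiSym.quadratic_reciprocity_one_mod_four h1 (Nat.odd_iff.mpr (by omega))]
    · rw [ZMod.χ₄_nat_three_mod_four h1,
        jacobiSym.quadratic_reciprocity_three_mod_four h1 hd, neg_one_mul]
  rw [← jacobiSym.legendreSym.to_jacobiSym] at hj
  have h1 := legendreSym.eq_pow l (-((24 * n - 1 : ℕ) : ℤ))
  rw [hj] at h1
  have h2 : l / 2 = (l - 1) / 2 := by
    have := Nat.odd_iff.mp hodd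
    omega
  rw [← h2]
  push_cast [Nat.cast_sub (show 1 ≤ 24 * n by omega)] at h1
  rw [h1]
  congr 1
  ring

end Sieve

section SieveSoundness

/-- The residue patterns used by the sieve with modulus `25944`. An entry consists of a product of
numbers `d = 24 * n - 1`, the inverse of the modulus with respect to it, and for every `d` its prime
factors, a repetition exponent and the bits `a` for which the symbol of `25944 *
    a` modulo `d` is not
`-1`. -/
def sievePatterns : List (ℕ × ℕ × List (List ℕ × ℕ × ℕ)) := [
  (802655, 357179, [([71], 17,
      20052041432995567487),
    ([5, 19], 16,
      1590178093841385041380097919),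
    ([7, 17], 16,
      5645416481361230964713515589818367)]),
  (23881, 3357, [([11, 13], 15,
      10790598395601609768754237390266215144008737),
    ([167], 15,
      181013339435974694075741208770661415061423339512865)]),
  (41065, 7634, [([191], 15,
      3112298630885954003521118275047601051204654059307840063617),
    ([5, 43], 15,
      1705522432987375904163071819152398144534270279590612565570740223)]),
  (62857, 23489, [([239], 15,
      7065734077645836540429506696338911894775431419613439055992324412120959),
    ([263], 14,
      14226546458069176198032023042718467021541494184028799270590340036974068396246177)]),
  (89257, 13703, [([7, 41], 14,
      10100777301833383193121883817754735278604173089822275049287864973517401169329516409823),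
    ([311], 14,
      4169771355238024536771101352735269027225169714025923732780009673058977075058505978888254523393)]),
  (120265, 116589, [([5, 67], 14,
      2292542065569185142230537532307535779523370547828025639691758912992055320057121368870324974712125439),
    ([359], 14,
      9391834287692405165492180054900361765386595247965792520142962916125580600202553120975239595516285280558975)]),
  (155881, 118527, [([383], 14,
      19053457925199104785513892977946039222724200816858106034475661493314514649819983438342530680894012800537878426856481),
    ([11, 37], 14,
      317263179109494384756221743656939453732057795033478547034818636228918741233146961762155439710333428665069137504584621673633)]),
  (196105, 56774, [([431], 14,
      5500955984088266535370172625950018165057784445240411469396868114572918086871106329997061759426587556397911309052291183063720943745),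
    ([5, 7, 13], 14,
      3790521344900948032566059460108132511727860912568498060845240272882874542754509864019348967833547236123656614214971381676138144743815167)]),
  (240937, 179189, [([479], 14,
      1560668826085719080872671957516165044701077517438456910681683808690490638547508886920798101513537146575482821496784958510279770979570828932947969),
    ([503], 13,
      844994985568571667440562543406537094080144098202956764147377973172358888088074059224281109304427589952591781576089734772390626259503015827344732814303)]),
  (290377, 287411, [([17, 31], 13,
      17688887926945344661477724982931473077279265315336934566201515369032016345392536591288374092437051178865804289490474954177809596712692536384642886609176304479),
    ([19, 29], 13,
      7366463342235761736903342890199321778893129552341146814237663454485522562200930655780661247164612470745301556074836366890888899331242307582539640369238094626477975553)]),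
  (373177, 27948, [([599], 13,
      2057407296584237642148867629600229050649541643149429326084862473604153312758372739429349875458638195564748708198813735659087466757997743965283947790142803653405540223299135763138689),
    ([7, 89], 13,
      1397212664071336642910430600591610957612188050651687559010904850611183549626343253641642028216236954774954227455544817846139233243138694298506440693026949387704567544588415473144820497375)]),
  (434137, 359823, [([647], 13,
      19124922423402806105064951100626340162304496465447802781704735126812572615179065433520222638408234935521805514794355385377870733399084321717472372912426094926194571954802680105201105019135816671),
    ([11, 61], 13,
      9796550598449958318361640323343773582676550532584796399947271435521678476928975877837784631741838818977181945489820168541559215969570547395860822413581478076588020599729696273408122887488334523571644417)]),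
  (499705, 304149, [([5, 139], 13,
      163064540343138500712025477347480641576857916822886676537994496531950305221656058119135992150680233008219393927130152279542374330513340804649007670665776331865323427965735551230415284830671876754859648844620961),
    ([719], 13,
      1373882239183223975535720625773154409366209235678526194298482570695944562685856946007012257547213290906928705655221621788646081583243521713995545062077314520198844961807244620587631604935682783731711569839953147903)]),
  (569881, 190817, [([743], 13,
      1862857389265132419327109154072322598337114064194467632067123403159927464282693161077311897572424779972727086299469572495280049227534853928993680520555071884281826921526780408599950804395319784112783288950528567344280443743),
    ([13, 59], 13,
      745104605846780306443609134363360434440052624372003633707053481307938808481338076557299431017684127549039040152269963635131381094948171741115514074832605461847730684539034891351923676037809178258992562893395445038805738494537295009)]),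
  (644665, 611244, [([7, 113], 13,
      13021874133660437890489325690889242833845952360475309325433596787901709698082592550802631258391548832664202671424348909813220170594764814392351960452185215470768087501723490800201344965856333430450009266506817927513157866908205799853547649),
    ([5, 163], 13,
      218390339325916861233323693489252428100965246602534808449194540068593894797140752896927496478986089880304671357490358509490092500891756872551127993130900742334195032211515384290570395850079744649010188865775784201691021604325828548486677724171297)]),
  (724057, 296025, [([839], 13,
      2266319846334533109887144488448749638259721076431537999735381938156164971002329867424369245140979653199511148292542739718913616381078246840084599656394232633821736263596894368116573002860003929602555724509407955220939102970348045960414067197407516671),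
    ([863], 13,
      2505744925186665614503220636802228848588577559188685264906384702644480007144363293716289994433407247774033632326394608440648905129105845324457622759762693308826527886751216830397033139646787686081603306841442303992316311850283534215859551078982474168076800863)]),
  (808057, 267577, [([887], 13,
      998532603525633525773690550961934263265856236276186331829276242638485620892770551165006484114971312570068425137131847320614530451918982563618300323120256951508251795944940157358423412729476895563760606152146020393088559701740700755870375945667340792506184559095874593),
    ([911], 13,
      17166257938795078002298665041023824041714584580681674743095773593237379847141222337635899276403355781953472699769866897474491832441392639475173765862533356859676990788769016005591738129812406907972535741603802776830515633616229262684386225450563091722625364556639866382862465)]),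
  (896665, 510094, [([5, 11, 17], 13,
      288145561915739527126293591245696591409042057685812087960055605620794364590422550787581899462401476984979548225323945587048637681006351570091099651225895728693509275740600453898363205860158999248820857636445678901834365402464592892357422314120127709055876840030707534640688131656865),
    ([7, 137], 13,
      4872609946177620242334580700215192565950037066487943467938939862475167133196446145041309739732387757261525896871218022423603592323983367217112511842659154914740076292670115639469650108554993449327657631261433396081133763203955827433332504205411671993326740655605646817647290293121576484993)]),
  (989881, 665682, [([983], 13,
      2687622633402675864212649590860732973065859110568590078805251737550922214811600430195507736805781837071320228058180314267867966605875496566022886936955011417456223138171690569097621422835778109600691770142189983489529607506865888791981074983206835947395468633498654809214818203409856330663285727),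
    ([19, 53], 13,
      1327120512310888966551003099988495056986019266565741816188683852605550004444551491123593838790301776647705190775560641793565836370201683601119534851330452404588844365800614597398699960587842537450721216632233334553291658480919730184465653183757663203645295830344219177313027873824967823277308777697158177)]),
  (1087705, 670089, [([1031], 13,
      181404277170426907260523510537981454619044778000332008129910844125915097842530294338606135063803966150701254385983434944036062212708707167974100313218471926978479600232581222984898652201323200986907756799101409494038364877209625034627199539061248794056134888226903668648650719337621254654941140749710263697279),
    ([5, 211], 13,
      386004529021755643040765259147434545901281550120253215586619871049061763693801842909607683585074331635479158885977179326159903135568215153931580685544600895360982654975103806215874296709970245897725682917926824950695423730613999292999152468206298867155223972846607290557693005248046090027482163752539134138315892106273)]),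
  (1190137, 950082, [([13, 83], 13,
      54953806521773797053242684338933337678439589935959500792290947681759667628173462007965302095271056420404634251750011533317710902784199950358226588471653666862013680210748071702575667566352453398467985520350642665257124601491746221211058136536356216120016113609385213409039584724077423128968842749843839552687672494133327743),
    ([1103], 13,
      4427462423306132277865500163112306171880210553568257002545360951277435416107026781672895503866669474592626683726982476510000403895392503501343667571379190176335229447378611767585014745433763401345602032423154569292327444755247088597960249111779735308202976973057205087610171735306028502167618035285181820069352520249986244789343071)]),
  (1380049, 372726, [([1151], 13,
      30582134273340189066289127487283240163270108378432510480848660489216703285234959841596596166390351765570819872091163971976719182945785073299132179820642667515542825895798086276184869807596783828151194527135359515426617225644401827241655755075185006517601261235392927391752347506172465040935044430713457289957278014145342009601679181930592901668865),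
    ([11, 109], 13,
      71996115540939583561153496098257115122296795626692198766908890266748616573796090917271883338679487717686666487478710069975068391031198365088432156679553578426169350611997625453018067663242740514920286853695356974262729423520577022223734435634163127660786547295792010563965022271300571666539308841280849936826529694061155268904765071892228862778904196092510079)])]

/-- The periodic repetition of a bit pattern. -/
def repeatBits (d p : ℕ) : ℕ → ℕ
  | 0 => p
  | i + 1 => repeatBits d p i ||| (repeatBits d p i <<< (d * 2 ^ i))

/-- The bit masks of the sieve. -/
def sieveMasks : List (ℕ × ℕ × ℕ) := sievePatterns.map fun g =>
  (g.1, g.2.1, g.2.2.foldr (fun q m => m &&& repeatBits q.1.prod q.2.2 q.2.1)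
    (2 ^ (3854456 + g.1) - 1))

/-- Intersect `acc` with the shifted masks for the residue class of `r`, and test the result. All
bits are displaced by `1380049`. -/
def sieve (final : ℕ → Bool) (r : ℕ) : List (ℕ × ℕ × ℕ) → ℕ → Bool
  | [], acc => final acc
  | m :: l, acc => Nat.beq acc 0 || sieve final r l 
    (acc &&& (m.2.2 <<< (1380049 - r * m.2.1 % m.1)))

/-- The residue class modulo `25944` with prescribed residues modulo `24`, `23` and `47`. -/
def sieveClass (i j k : ℕ) : ℕ := (1081 * i + 1128 * j + 23736 * k) % 25944

/-- The bit of the square of `x + 25944 * s` in the class of `r`, relative to `25944 * (s * s)`. -/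
def squareBit (r s x : ℕ) : ℕ :=
  let b := (x * x - r) / 25944 + 2 * x * s
  bif Nat.beq (r + 25944 * (25944 * (s * s) + b)) ((x + 25944 * s) * (x + 25944 *
      s)) then 2 ^ b else 0

/-- The bits of the squares of `x + 25944 * s` for `x` in a list. -/
def squareBlock (r s : ℕ) : List ℕ → ℕ
  | [] => 0
  | x :: l => squareBit r s x ||| squareBlock r s l

/-- A set of squares, and the composite number `74978068165`, in the class of `r`. -/
def squareBits (r : ℕ) (l : List ℕ) : ℕ → ℕ
  | 0 => bif Nat.beq (r + 25944 * (74978068165 / 25944)) 74978068165 then 2 ^ (74978068165 /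
      25944) else 0
  | s + 1 => squareBits r l s ||| (squareBlock r s l <<< (25944 * (s * s)))

/-- Square roots modulo `25944` of the class with residues `j ^ 2`, `k ^ 2` modulo `23`, `47`. -/
def sieveRoots (j k : ℕ) : List ℕ :=
  [1, 5, 7, 11, 13, 17, 19, 23].flatMap fun u =>
    [sieveClass u j k, sieveClass u (23 - j) k, sieveClass u j (47 - k),
      sieveClass u (23 - j) (47 - k)]

/-- Every number in the given class that survives the sieve is composite. -/
def sieveCheck (i j k : ℕ) : Bool :=
  sieve (fun acc => Nat.beq
      (acc ||| (squareBits (sieveClass i (j * j) (k * k)) (sieveRoots j k) 13 <<< 1380049))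
      (squareBits (sieveClass i (j * j) (k * k)) (sieveRoots j k) 13 <<< 1380049))
    (sieveClass i (j * j) (k * k)) sieveMasks ((2 ^ 3854456 - 1) <<< 1380049)

/-- The validity of an entry of `sievePatterns`. -/
def patternValid (g : ℕ × ℕ × List (List ℕ × ℕ × ℕ)) : Bool :=
  0 < g.1 && g.1 ≤ 1380049 && 25944 * g.2.1 % g.1 == 1 % g.1 && g.2.2.all fun q =>
    (q.1.all fun p => trialDivision p 35 && p != 2) && g.1 % q.1.prod == 0 &&
    3854456 + g.1 ≤ q.1.prod * 2 ^ q.2.1 && (q.1.prod + 1) % 24 == 0 && q.1.prod ≤ 1199 &&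
    (List.range q.1.prod).all fun a => q.2.2.testBit a || eulerSymbolProd (25944 * a) q.1 == -1

set_option maxRecDepth 10000 in
lemma patternValid_of_mem : ∀ g ∈ sievePatterns, patternValid g = true := by
  decide +kernel

lemma testBit_repeatBits {d p : ℕ} (i : ℕ) {n : ℕ} (h : p.testBit (n % d) = true)
    (hn : n < d * 2 ^ i) : (repeatBits d p i).testBit n = true := by
  induction i generalizing n with
  | zero =>
    rw [pow_zero, mul_one] at hn
    rwa [Nat.mod_eq_of_lt hn] at h
  | succ i ih =>
    rw [repeatBits, Nat.testBit_or, Bool.or_eq_true]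
    by_cases h1 : n < d * 2 ^ i
    · exact Or.inl (ih h h1)
    · rw [not_lt] at h1
      rw [pow_succ, ← mul_assoc] at hn
      have h2 : p.testBit ((n - d * 2 ^ i) % d) = true := by rwa [Nat.sub_mul_mod h1]
      rw [Nat.testBit_shiftLeft, ih h2 (by omega)]
      exact Or.inr (by simpa using h1)

lemma exists_testBit_of_sieve {final : ℕ → Bool} {r t : ℕ} (l : List (ℕ × ℕ × ℕ)) {acc : ℕ}
    (h : sieve final r l acc = true) (ha : acc.testBit (1380049 + t) = true)
    (hl : ∀ m ∈ l, r * m.2.1 % m.1 ≤ 1380049 ∧ m.2.2.testBit (t + r * m.2.1 % m.1) = true) :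
    ∃ b : ℕ, b.testBit (1380049 + t) = true ∧ final b = true := by
  induction l generalizing acc with
  | nil => exact ⟨acc, ha, h⟩
  | cons m l ih =>
    rw [sieve, Bool.or_eq_true] at h
    rcases h with h | h
    · rw [Nat.eq_of_beq_eq_true h] at ha
      simp at ha
    · refine ih h ?_ fun m' hm => hl m' (List.mem_cons_of_mem _ hm)
      obtain ⟨h1, h2⟩ := hl m List.mem_cons_self
      rw [Nat.testBit_and, ha, Nat.testBit_shiftLeft,
        show 1380049 + t - (1380049 - r * m.2.1 % m.1) = t + r * m.2.1 % m.1 by omega, h2]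
      simp only [Bool.true_and, Bool.and_true, ge_iff_le, decide_eq_true_eq]
      omega

lemma of_testBit_squareBlock {r s : ℕ} (l : List ℕ) {t : ℕ}
    (h : (squareBlock r s l).testBit t = true) : ∃ y, y * y = r + 25944 * (25944 * (s * s) + t) :=
        by
  induction l with
  | nil => simp [squareBlock] at h
  | cons x l ih =>
    rw [squareBlock, Nat.testBit_or, Bool.or_eq_true] at h
    rcases h with h | h
    · simp only [squareBit, cond_eq_ite] at h
      split_ifs at h with h1
      · rw [Nat.testBit_two_pow, decide_eq_true_eq] at h
        rw [h] at h1
        exact ⟨_, (Nat.eq_of_beq_eq_true h1).symm⟩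
      · simp at h
    · exact ih h

lemma of_testBit_squareBits {r : ℕ} {l : List ℕ} (s : ℕ) {t : ℕ}
    (h : (squareBits r l s).testBit t = true) :
    (∃ y, y * y = r + 25944 * t) ∨ r + 25944 * t = 74978068165 := by
  induction s with
  | zero =>
    rw [squareBits] at h
    rcases Bool.eq_false_or_eq_true (Nat.beq (r + 25944 *
        (74978068165 / 25944)) 74978068165) with h1 | h1 <;>
      rw [h1] at h
    · rw [cond_true, Nat.testBit_two_pow, decide_eq_true_eq] at h
      rw [h] at h1
      exact Or.inr (Nat.eq_of_beq_eq_true h1)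
    · rw [cond_false, Nat.zero_testBit] at h
      cases h
  | succ s ih =>
    rw [squareBits, Nat.testBit_or, Bool.or_eq_true] at h
    rcases h with h | h
    · exact ih h
    · rw [Nat.testBit_shiftLeft, Bool.and_eq_true, decide_eq_true_eq] at h
      obtain ⟨y, hy⟩ := of_testBit_squareBlock l h.2
      rw [Nat.add_sub_cancel' h.1] at hy
      exact Or.inl ⟨y, hy⟩

lemma testBit_sieveMasks {r t : ℕ} (ht : t < 3854456)
    (h : ∀ n : ℕ, 1 ≤ n → n ≤ 50 → jacobiSym (r + 25944 * t : ℕ) (24 * n - 1 : ℕ) ≠ -1) :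
    ∀ m ∈ sieveMasks, r * m.2.1 % m.1 ≤ 1380049 ∧ m.2.2.testBit (t + r * m.2.1 % m.1) = true := by
  intro m hm
  obtain ⟨g, hg, rfl⟩ := List.mem_map.mp hm
  have hv := patternValid_of_mem g hg
  simp only [patternValid, Bool.and_eq_true, decide_eq_true_eq, beq_iff_eq, List.all_eq_true,
    bne_iff_ne, Bool.or_eq_true, List.mem_range] at hv
  obtain ⟨⟨⟨h0, hQ⟩, h1⟩, h2⟩ := hv
  have ho := Nat.mod_lt (r * g.2.1) h0
  have key : ∀ q ∈ g.2.2,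
      (repeatBits q.1.prod q.2.2 q.2.1).testBit (t + r * g.2.1 % g.1) = true := by
    intro q hq
    obtain ⟨⟨⟨⟨⟨hp, hd⟩, hT⟩, h24⟩, h50⟩, hb⟩ := h2 q hq
    have hd' := Nat.dvd_of_mod_eq_zero hd
    have hpos := Nat.pos_of_dvd_of_pos hd' h0
    refine testBit_repeatBits _ ?_ (by omega)
    rcases hb _ (Nat.mod_lt (t + r * g.2.1 % g.1) hpos) with h3 | h3
    · exact h3
    · refine absurd ?_ (h ((q.1.prod + 1) / 24) (by omega) (by omega))
      rw [show 24 * ((q.1.prod + 1) / 24) - 1 = q.1.prod by omega, ← h3,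
        ← jacobiSym_eq_eulerSymbolProd _ fun p hpq =>
          ⟨prime_of_trialDivision (hp p hpq).1, (hp p hpq).2⟩]
      refine jacobiSym.mod_left' ((Int.natCast_modEq_iff).mpr ?_)
      have e1 : 25944 * (r * g.2.1 % g.1) ≡ r [MOD g.1] :=
        ((Nat.mod_modEq _ _).mul_left _).trans (by
          have := Nat.ModEq.mul_left r (show 25944 * g.2.1 ≡ 1 [MOD g.1] from h1)
          rwa [mul_one, mul_left_comm] at this)
      have e2 : 25944 * ((t + r * g.2.1 % g.1) % q.1.prod) ≡ 25944 * t + r [MOD q.1.prod] :=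
        ((Nat.mod_modEq _ _).mul_left _).trans (by
          rw [mul_add]
          exact (e1.of_dvd hd').add_left _)
      rw [add_comm r]
      exact e2.symm
  have base : (2 ^ (3854456 + g.1) - 1).testBit (t + r * g.2.1 % g.1) = true := by
    rw [Nat.testBit_two_pow_sub_one, decide_eq_true_eq]
    omega
  clear h2
  refine ⟨ho.le.trans hQ, ?_⟩
  simp only
  generalize g.2.2 = L at key
  induction L with
  | nil => exact base
  | cons q L ih =>
    rw [List.foldr_cons, Nat.testBit_and, ih fun q' hq => key q' (List.mem_cons_of_mem _ hq),
      key q List.mem_cons_self]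
    rfl

lemma testBit_shiftLeft_add (x m t : ℕ) : (x <<< m).testBit (m + t) = x.testBit t := by
  rw [Nat.testBit_shiftLeft, Nat.add_sub_cancel_left]
  simp

lemma not_prime_of_sieveCheck {i j k t : ℕ} (ht : t < 3854456) (hs : sieveCheck i j k = true)
    (h : ∀ n : ℕ, 1 ≤ n → n ≤ 50 →
      jacobiSym (sieveClass i (j * j) (k * k) + 25944 * t : ℕ) (24 * n - 1 : ℕ) ≠ -1) :
    ¬ (sieveClass i (j * j) (k * k) + 25944 * t).Prime := by
  obtain ⟨b, hb, hb'⟩ := exists_testBit_of_sieve (t := t) sieveMasks hs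
    (by rw [testBit_shiftLeft_add, Nat.testBit_two_pow_sub_one, decide_eq_true_eq]; exact ht)
    (testBit_sieveMasks ht h)
  have h1 : (squareBits (sieveClass i (j * j) (k * k)) (sieveRoots j k) 13).testBit t = true := by
    rw [← testBit_shiftLeft_add _ 1380049, ← Nat.eq_of_beq_eq_true hb', Nat.testBit_or, hb,
        Bool.true_or]
  rcases of_testBit_squareBits _ h1 with ⟨y, hy⟩ | hy
  · rw [← hy]
    exact fun hp => (Nat.prime_mul_iff.mp hp).elim (fun hh => absurd hh.2 (by
      rintro rfl; exact Nat.not_prime_one hh.1)) (fun hh => absurd hh.2 (by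
      rintro rfl; exact Nat.not_prime_one hh.1))
  · rw [hy]
    norm_num

end SieveSoundness

section SieveRun

set_option maxHeartbeats 0 in
set_option maxRecDepth 100000 in
lemma sieveCheck_eq_true {i j k : ℕ} (hi : i ∈ [1, 5, 7, 11, 13, 17, 19, 23]) (hj : j < 11)
    (hk : k < 23) : sieveCheck i (j + 1) (k + 1) = true := by
  simp only [List.mem_cons, List.not_mem_nil, or_false] at hi
  rcases hi with rfl | rfl | rfl | rfl | rfl | rfl | rfl | rfl
  · by_cases h : k < 12
    · interval_cases j <;> exact (by decide +kernel : ∀ k < 12, sieveCheck 1 _ (k + 1) = true) k h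
    · obtain ⟨m, rfl⟩ := Nat.exists_eq_add_of_le (not_lt.mp h)
      have hm : m < 11 := by omega
      interval_cases j <;>
        exact (by decide +kernel : ∀ m < 11, sieveCheck 1 _ (12 + m + 1) = true) m hm
  all_goals
    interval_cases j <;> exact (by decide +kernel : ∀ k < 23, sieveCheck _ _ (k + 1) = true) k hk

end SieveRun

section Main

lemma exists_modEq_sq_of_eulerSymbol : (∀ a < 23, a ≠ 0 → eulerSymbol a 23 ≠ -1 →
      ∃ j < 11, a = (j + 1) * (j + 1) % 23) ∧
    ∀ a < 47, a ≠ 0 → eulerSymbol a 47 ≠ -1 → ∃ k < 23, a = (k + 1) * (k + 1) % 47 := by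
  decide +kernel

lemma eulerSymbol_mod_ne_neg_one {p l : ℕ} (hp : p.Prime) (h2 : p ≠ 2) (hl : l.Prime) (hne : l ≠ p)
    (h : jacobiSym l p ≠ -1) :
    l % p < p ∧ l % p ≠ 0 ∧ eulerSymbol (l % p) p ≠ -1 := by
  refine ⟨Nat.mod_lt _ hp.pos, fun h0 => hne ?_, ?_⟩
  · exact ((Nat.prime_dvd_prime_iff_eq hp hl).mp (Nat.dvd_of_mod_eq_zero h0)).symm
  · rw [jacobiSym_eq_eulerSymbol hp h2] at h
    simpa only [eulerSymbol, Nat.mod_mod] using h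

lemma exists_jacobiSym_eq_neg_one {l : ℕ} (hl : l.Prime) (h5 : 5 ≤ l) (hX : l < 10 ^ 11)
    (h23 : l ≠ 23) (h47 : l ≠ 47) :
    ∃ n : ℕ, 1 ≤ n ∧ n ≤ 50 ∧ jacobiSym l (24 * n - 1 : ℕ) = -1 := by
  by_contra! h
  have a23 := eulerSymbol_mod_ne_neg_one (by norm_num) (by norm_num) hl h23
    (h 1 le_rfl (by norm_num))
  have a47 := eulerSymbol_mod_ne_neg_one (by norm_num) (by norm_num) hl h47
    (h 2 (by norm_num) (by norm_num))
  obtain ⟨j, hj, hj'⟩ := exists_modEq_sq_of_eulerSymbol.1 _ a23.1 a23.2.1 a23.2.2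
  obtain ⟨k, hk, hk'⟩ := exists_modEq_sq_of_eulerSymbol.2 _ a47.1 a47.2.1 a47.2.2
  have hi : l % 24 ∈ [1, 5, 7, 11, 13, 17, 19, 23] := by
    have h2 : ¬ 2 ∣ l := fun hd => by
      have := (Nat.prime_dvd_prime_iff_eq Nat.prime_two hl).mp hd
      omega
    have h3 : ¬ 3 ∣ l := fun hd => by
      have := (Nat.prime_dvd_prime_iff_eq Nat.prime_three hl).mp hd
      omega
    simp only [List.mem_cons, List.not_mem_nil, or_false]
    omega
  have hc : l % 25944 = sieveClass (l % 24) ((j + 1) * (j + 1)) ((k + 1) * (k + 1)) := by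
    rw [sieveClass]
    generalize (j + 1) * (j + 1) = x at hj' ⊢
    generalize (k + 1) * (k + 1) = y at hk' ⊢
    change l ≡ _ [MOD 24 * (23 * 47)]
    rw [← Nat.modEq_and_modEq_iff_modEq_mul (by norm_num),
      ← Nat.modEq_and_modEq_iff_modEq_mul (by norm_num)]
    refine ⟨?_, ?_, ?_⟩ <;> rw [Nat.ModEq] <;> omega
  have hd := Nat.mod_add_div l 25944
  rw [hc] at hd
  refine not_prime_of_sieveCheck (t := l / 25944) (by omega) (sieveCheck_eq_true hi hj hk) ?_ ?_
  · rwa [hd]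
  · rwa [hd]

/-- The primes dividing one of the integers in `sptValues`. -/
def exceptionalPrimes : List ℕ :=
  [2, 3, 5, 7, 11, 13, 17, 19, 23, 29, 31, 37, 41, 43, 59, 73, 97, 101, 103, 127, 131, 193, 211,
   241, 269, 277, 349, 409, 503, 613, 769, 1223, 2477, 2707, 5039, 6007, 7517, 10177, 11057,
   11261, 26591, 36469, 57559, 97687, 114547, 180773, 259277, 1423969]

lemma prime_of_mem_exceptionalPrimes {p : ℕ} (hp : p ∈ exceptionalPrimes) : p.Prime :=
  prime_of_trialDivision ((by decide +kernel :
    ∀ p ∈ exceptionalPrimes, trialDivision p 1200 = true) p hp)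

lemma sptValues_dvd : ∀ n < 51, sptValues.getD n 0 ∣ (exceptionalPrimes.prod : ℤ) ^ 8 := by
  decide +kernel

/-- Indices `n` together with the prime factors of `24 * n - 1`. -/
def smallFactorizations : List (ℕ × List ℕ) :=
  [(1, [23]), (2, [47]), (3, [71]), (4, [5, 19]), (5, [7, 17]), (6, [11, 13])]

lemma smallFactorizations_valid : ∀ q ∈ smallFactorizations, 1 ≤ q.1 ∧ q.1 < 51 ∧
    q.2.prod = 24 * q.1 - 1 ∧ ∀ p ∈ q.2, trialDivision p 10 = true ∧ p ≠ 2 := by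
  decide +kernel

lemma exists_smallFactorization : ∀ l ∈ 47 :: exceptionalPrimes, l ∈ [2, 3, 5, 7, 13] ∨
    ∃ q ∈ smallFactorizations, eulerSymbolProd l q.2 = -1 ∧ ¬ (l : ℤ) ∣ sptValues.getD q.1 0 := by
  decide +kernel

lemma not_forall_of_jacobiSym {l n : ℕ} [Fact l.Prime] (h5 : 5 ≤ l) (hn : 1 ≤ n) (hn' : n < 51)
    (h : jacobiSym l (24 * n - 1 : ℕ) = -1) (hd : ¬ (l : ℤ) ∣ sptValues.getD n 0) :
    ¬ ∀ n, 24 ∣ l * n + 1 → l ∣ spt ((l * n + 1) / 24) := by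
  refine not_forall_of_sptCoeff h5 (neg_one_of_jacobiSym h5 hn h) ?_
  rwa [sptCoeff_eq_sptValues hn', Ne, ZMod.intCast_zmod_eq_zero_iff_dvd]

lemma mem_exceptionalPrimes {l n : ℕ} (hl : l.Prime) (hn : n < 51)
    (hd : (l : ℤ) ∣ sptValues.getD n 0) : l ∈ exceptionalPrimes := by
  have h : l ∣ exceptionalPrimes.prod ^ 8 := by exact_mod_cast hd.trans (sptValues_dvd n hn)
  obtain ⟨p, hp, hlp⟩ := (Prime.dvd_prod_iff hl.prime).mp (hl.dvd_of_dvd_pow h)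
  rwa [(Nat.prime_dvd_prime_iff_eq hl (prime_of_mem_exceptionalPrimes hp)).mp hlp]

lemma eq_of_mem_exceptionalPrimes {l : ℕ} [Fact l.Prime] (h5 : 5 ≤ l)
    (hl : l ∈ 47 :: exceptionalPrimes)
    (h : ∀ n, 24 ∣ l * n + 1 → l ∣ spt ((l * n + 1) / 24)) : l = 5 ∨ l = 7 ∨ l = 13 := by
  rcases exists_smallFactorization l hl with h1 | ⟨q, hq, hs, hd⟩
  · simp only [List.mem_cons, List.not_mem_nil, or_false] at h1
    omega
  · obtain ⟨h1, h2, h3, h4⟩ := smallFactorizations_valid q hq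
    refine absurd h (not_forall_of_jacobiSym h5 h1 h2 ?_ hd)
    rw [← h3, jacobiSym_eq_eulerSymbolProd _ fun p hp =>
      ⟨prime_of_trialDivision (h4 p hp).1, (h4 p hp).2⟩, hs]

end Main

/-- For primes `5 ≤ ℓ < 10^11`, the function `spt` has a congruence at `ℓ`
(i.e. `ℓ ∣ spt((ℓn+1)/24)` whenever `24 ∣ ℓn + 1`) exactly when `ℓ ∈ {5, 7, 13}`. -/
theorem spt_congruence_iff_of_lt (ℓ : ℕ) (hℓ : ℓ.Prime) (h5 : 5 ≤ ℓ)
    (hX : ℓ < 10 ^ 11) :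
    (∀ n : ℕ, 24 ∣ ℓ * n + 1 → ℓ ∣ spt ((ℓ * n + 1) / 24)) ↔
      (ℓ = 5 ∨ ℓ = 7 ∨ ℓ = 13) := by
  have := Fact.mk hℓ
  constructor
  · intro h
    by_cases h23 : ℓ = 23
    · exact eq_of_mem_exceptionalPrimes h5 (by rw [h23]; decide) h
    by_cases h47 : ℓ = 47
    · exact eq_of_mem_exceptionalPrimes h5 (by rw [h47]; decide) h
    obtain ⟨n, h1, h2, h3⟩ := exists_jacobiSym_eq_neg_one hℓ h5 hX h23 h47
    by_cases hd : (ℓ : ℤ) ∣ sptValues.getD n 0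
    · exact eq_of_mem_exceptionalPrimes h5
        (List.mem_cons_of_mem _ (mem_exceptionalPrimes hℓ (by omega) hd)) h
    · exact absurd h (not_forall_of_jacobiSym h5 h1 (by omega) h3 hd)
  · rintro (rfl | rfl | rfl)
    all_goals exact spt_congruence_of_weight h5 (fun a b => by omega)
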